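/- There exist constants 0 < c ≤ C < ∞ such that for all n = 2^{j₀} and m = 2^{−i₀}n as above, c·m/n ≤ E(X_{n,m}) ≤ C·m/n. -/

import Mathlib

/-!
Critical site percolation on the triangular lattice realized on `ℤ²`.
A configuration assigns to each site `true` (open) or `false` (closed),
and `P` is the product Bernoulli(1/2) measure, axiomatized by
`IsBernoulliHalf` below (finite cylinder events have product probability).
-/

open MeasureTheory
open scoped ENNReal

/-- Sites of the lattice: vertices of `ℤ²`. -/
abbrev Site : Type := ℤ × ℤ

/-- A percolation configuration: `true` = open, `false` = closed. -/
abbrev Config : Type := Site → Bool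

/-- Adjacency for the triangular lattice realized on `ℤ²`:
the neighbors of `(x,y)` are `(x±1,y)`, `(x,y±1)`, `(x+1,y-1)`, `(x-1,y+1)`. -/
def Adj (a b : Site) : Prop :=
  (b.1 - a.1, b.2 - a.2) ∈
    ({(1, 0), (-1, 0), (0, 1), (0, -1), (1, -1), (-1, 1)} : Set (ℤ × ℤ))

/-- A (nonempty, self-avoiding) lattice path: a list of distinct sites in which
consecutive sites are neighbors. -/
def IsPath (p : List Site) : Prop := p ≠ [] ∧ p.Nodup ∧ p.Chain' Adj

/-- A path all of whose vertices lie in the set `S`. -/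
def PathIn (S : Set Site) (p : List Site) : Prop := IsPath p ∧ ∀ v ∈ p, v ∈ S

/-- All sites of `p` are open in `ω`. -/
def IsOpenOn (ω : Config) (p : List Site) : Prop := ∀ v ∈ p, ω v = true

/-- All sites of `p` are closed in `ω`. -/
def IsClosedOn (ω : Config) (p : List Site) : Prop := ∀ v ∈ p, ω v = false

/-- The first vertex of `p` lies in `A`. -/
def FirstIn (A : Set Site) (p : List Site) : Prop := ∃ a ∈ A, p.head? = some a

/-- The last vertex of `p` lies in `A`. -/
def LastIn (A : Set Site) (p : List Site) : Prop := ∃ a ∈ A, p.getLast? = some a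

/-- `μ` is the product Bernoulli(1/2) measure on configurations: a probability
measure for which every finite cylinder event has the product probability. -/
def IsBernoulliHalf (μ : Measure Config) : Prop :=
  IsProbabilityMeasure μ ∧
    ∀ (S : Finset Site) (f : Site → Bool),
      μ {ω | ∀ v ∈ S, ω v = f v} = (1 / 2 : ℝ≥0∞) ^ S.card

/-- The lattice rectangle `[x₀,x₁] × [y₀,y₁]`. -/
def rect (x₀ x₁ y₀ y₁ : ℤ) : Set Site :=
  {v | x₀ ≤ v.1 ∧ v.1 ≤ x₁ ∧ y₀ ≤ v.2 ∧ v.2 ≤ y₁}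

/-- The left side of a rectangle. -/
def rectLeft (x₀ x₁ y₀ y₁ : ℤ) : Set Site := {v ∈ rect x₀ x₁ y₀ y₁ | v.1 = x₀}

/-- The right side of a rectangle. -/
def rectRight (x₀ x₁ y₀ y₁ : ℤ) : Set Site := {v ∈ rect x₀ x₁ y₀ y₁ | v.1 = x₁}

/-- The top side of a rectangle. -/
def rectTop (x₀ x₁ y₀ y₁ : ℤ) : Set Site := {v ∈ rect x₀ x₁ y₀ y₁ | v.2 = y₁}

/-- The bottom side of a rectangle. -/
def rectBot (x₀ x₁ y₀ y₁ : ℤ) : Set Site := {v ∈ rect x₀ x₁ y₀ y₁ | v.2 = y₀}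

/-- A horizontal open crossing of the rectangle `[x₀,x₁] × [y₀,y₁]`:
an open path in the rectangle from its left side to its right side. -/
def HorizCrossing (x₀ x₁ y₀ y₁ : ℤ) (ω : Config) (p : List Site) : Prop :=
  PathIn (rect x₀ x₁ y₀ y₁) p ∧ IsOpenOn ω p ∧
    FirstIn (rectLeft x₀ x₁ y₀ y₁) p ∧ LastIn (rectRight x₀ x₁ y₀ y₁) p

/-- `v` is a pivotal site for the box `B(n) = [-n,n]²`: some horizontal open
crossing of `B(n)` contains `v`, and there are two disjoint closed paths in
`B(n)` started from `v` (i.e. starting at a neighbor of `v`), one to the top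
side and one to the bottom side of `B(n)`. -/
def Pivotal (n : ℤ) (ω : Config) (v : Site) : Prop :=
  (∃ p, HorizCrossing (-n) n (-n) n ω p ∧ v ∈ p) ∧
    ∃ q₁ q₂ : List Site,
      PathIn (rect (-n) n (-n) n) q₁ ∧ IsClosedOn ω q₁ ∧
        FirstIn {w | Adj v w} q₁ ∧ LastIn (rectTop (-n) n (-n) n) q₁ ∧
      PathIn (rect (-n) n (-n) n) q₂ ∧ IsClosedOn ω q₂ ∧
        FirstIn {w | Adj v w} q₂ ∧ LastIn (rectBot (-n) n (-n) n) q₂ ∧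
      List.Disjoint q₁ q₂

/-- `Q_n`: the set of pivotal sites for `B(n)`. -/
def Qset (n : ℤ) (ω : Config) : Set Site := {v | Pivotal n ω v}

/-- The block `H_k`: `{(x,y) ∈ B(n) : -n+(k-1)m < x ≤ -n+km, -n ≤ y ≤ -n+m}`. -/
def Hblock (n m : ℤ) (k : ℕ) : Set Site :=
  {v | -n + ((k : ℤ) - 1) * m < v.1 ∧ v.1 ≤ -n + (k : ℤ) * m ∧
        -n ≤ v.2 ∧ v.2 ≤ -n + m}

/-- The dyadic interval `I_j` (for `n = 2^j₀`, `m = 2^{j₀-i₀}`):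
`I_j = (n - 2^{-j}n, n - 2^{-j-1}n]` for `j < i₀` and `I_{i₀} = (n-m, n]`. -/
def Iset (j₀ i₀ j : ℕ) : Set ℤ :=
  if j = i₀ then Set.Ioc ((2 : ℤ) ^ j₀ - 2 ^ (j₀ - i₀)) ((2 : ℤ) ^ j₀)
  else Set.Ioc ((2 : ℤ) ^ j₀ - 2 ^ (j₀ - j)) ((2 : ℤ) ^ j₀ - 2 ^ (j₀ - j - 1))

/-- `X_{n,m}`: the number of indices `k ∈ {1,…,2n/m}` (here `2n/m = 2^{i₀+1}`,
with `n = 2^{j₀}`, `m = 2^{j₀-i₀}`) such that `Q_n ∩ H_k ≠ ∅`. -/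
noncomputable def Xnm (j₀ i₀ : ℕ) (ω : Config) : ℕ :=
  {k : ℕ | 1 ≤ k ∧ k ≤ 2 ^ (i₀ + 1) ∧
    (Qset ((2 : ℤ) ^ j₀) ω ∩ Hblock ((2 : ℤ) ^ j₀) ((2 : ℤ) ^ (j₀ - i₀)) k).Nonempty}.ncard

namespace Percolation

variable {μ : Measure Config}

/-- `a` and `b` are joined by a lattice walk inside `S`. -/
def Conn (S : Set Site) (a b : Site) : Prop :=
  a ∈ S ∧ Relation.ReflTransGen (fun u v => u ∈ S ∧ v ∈ S ∧ Adj u v) a b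

theorem adj_iff {a b : Site} : Adj a b ↔
    (b.1 = a.1 + 1 ∧ b.2 = a.2) ∨ (b.1 = a.1 - 1 ∧ b.2 = a.2) ∨
    (b.1 = a.1 ∧ b.2 = a.2 + 1) ∨ (b.1 = a.1 ∧ b.2 = a.2 - 1) ∨
    (b.1 = a.1 + 1 ∧ b.2 = a.2 - 1) ∨ (b.1 = a.1 - 1 ∧ b.2 = a.2 + 1) := by
  simp only [Adj, Set.mem_insert_iff, Set.mem_singleton_iff, Prod.mk.injEq]
  omega

theorem _root_.Adj.symm {a b : Site} (h : Adj a b) : Adj b a := by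
  rw [adj_iff] at *; omega

theorem Conn.refl {S : Set Site} {a : Site} (h : a ∈ S) : Conn S a a := ⟨h, .refl⟩

theorem Conn.left {S : Set Site} {a b : Site} (h : Conn S a b) : a ∈ S := h.1

theorem Conn.right {S : Set Site} {a b : Site} (h : Conn S a b) : b ∈ S := by
  obtain ⟨h1, h2⟩ := h
  induction h2 with
  | refl => exact h1
  | tail _ h _ => exact h.2.1

theorem Conn.trans {S : Set Site} {a b c : Site} (h : Conn S a b) (h' : Conn S b c) :
    Conn S a c := ⟨h.1, h.2.trans h'.2⟩

theorem Conn.tail {S : Set Site} {a b c : Site} (h : Conn S a b) (hc : c ∈ S) (h' : Adj b c) :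
    Conn S a c := ⟨h.1, h.2.tail ⟨h.right, hc, h'⟩⟩

theorem Conn.head {S : Set Site} {a b c : Site} (ha : a ∈ S) (h' : Adj a b) (h : Conn S b c) :
    Conn S a c := ⟨ha, h.2.head ⟨ha, h.left, h'⟩⟩

theorem Conn.single {S : Set Site} {a b : Site} (ha : a ∈ S) (hb : b ∈ S) (h : Adj a b) :
    Conn S a b := (Conn.refl ha).tail hb h

theorem Conn.mono {S T : Set Site} {a b : Site} (hST : S ⊆ T) (h : Conn S a b) : Conn T a b :=
  ⟨hST h.1, Relation.ReflTransGen.mono (fun _ _ h => ⟨hST h.1, hST h.2.1, h.2.2⟩) _ _ h.2⟩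

@[elab_as_elim]
theorem Conn.induction {S : Set Site} {a : Site} {P : ∀ b, Conn S a b → Prop} {b : Site}
    (h : Conn S a b) (base : ∀ ha, P a (Conn.refl ha))
    (step : ∀ u v (hu : Conn S a u) (hv : v ∈ S) (huv : Adj u v), P u hu →
      P v (hu.tail hv huv)) : P b h := by
  obtain ⟨h1, h2⟩ := h
  induction h2 with
  | refl => exact base h1
  | tail hu h ih => exact step _ _ ⟨h1, hu⟩ h.2.1 h.2.2 ih

theorem Conn.symm {S : Set Site} {a b : Site} (h : Conn S a b) : Conn S b a := by
  induction h using Conn.induction with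
  | base h => exact Conn.refl h
  | step u v hu hv huv ih => exact Conn.head hv huv.symm ih

/-- A property preserved by the steps of a walk holds all along the walk. -/
theorem Conn.restrict {S : Set Site} {a b : Site} (h : Conn S a b) (A : Set Site) (ha : a ∈ A)
    (hA : ∀ u v, u ∈ A → u ∈ S → v ∈ S → Adj u v → v ∈ A) : Conn (S ∩ A) a b := by
  induction h using Conn.induction with
  | base h => exact Conn.refl ⟨h, ha⟩
  | step u v hu hv huv ih => exact ih.tail ⟨hv, hA u v ih.right.2 ih.right.1 hv huv⟩ huv

/-- Splitting a walk at its last visit to `A`. -/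
theorem Conn.last_exit {S : Set Site} {a b : Site} (h : Conn S a b) (A : Set Site) (ha : a ∈ A)
    (hb : b ∉ A) : ∃ c ∈ A, ∃ d, Conn S a c ∧ Adj c d ∧ Conn (S \ A) d b := by
  revert hb
  induction h using Conn.induction with
  | base _ => exact fun h' => absurd ha h'
  | step u v hu hv huv ih =>
    intro hb
    by_cases hu' : u ∈ A
    · exact ⟨u, hu', v, hu, huv, Conn.refl ⟨hv, hb⟩⟩
    · obtain ⟨c, hc, d, h1, h2, h3⟩ := ih hu'
      exact ⟨c, hc, d, h1, h2, h3.tail ⟨hv, hb⟩ huv⟩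

/-- Splitting a walk at its first visit to `A`. -/
theorem Conn.first_entry {S : Set Site} {a b : Site} (h : Conn S a b) (A : Set Site) (ha : a ∉ A)
    (hb : b ∈ A) : ∃ d, ∃ c ∈ A, Conn (S \ A) a d ∧ Adj d c ∧ Conn S c b := by
  obtain ⟨c, hc, d, h1, h2, h3⟩ := h.symm.last_exit A hb ha
  exact ⟨d, c, hc, h3.symm, h2.symm, h1.symm⟩

theorem Conn.image {S T : Set Site} {a b : Site} (f : Site → Site) (hf : ∀ v ∈ S, f v ∈ T)
    (hadj : ∀ u v, Adj u v → Adj (f u) (f v)) (h : Conn S a b) : Conn T (f a) (f b) := by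
  induction h using Conn.induction with
  | base h => exact Conn.refl (hf _ h)
  | step u v hu hv huv ih => exact ih.tail (hf _ hv) (hadj _ _ huv)

/-- Horizontal segments are connected. -/
theorem conn_row {S : Set Site} {x x' y : ℤ} (hx : x ≤ x')
    (h : ∀ t, x ≤ t → t ≤ x' → ((t, y) : Site) ∈ S) : Conn S (x, y) (x', y) := by
  obtain ⟨k, rfl⟩ := Int.le.dest hx
  induction k with
  | zero => simpa using Conn.refl (h x le_rfl (by simp))
  | succ k ih =>
    refine (ih (by omega) fun t h1 h2 => h t h1 (by push_cast; omega)).tail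
      (h _ (by omega) le_rfl) (adj_iff.2 ?_)
    push_cast; omega

/-- Vertical segments are connected. -/
theorem conn_col {S : Set Site} {x y y' : ℤ} (hy : y ≤ y')
    (h : ∀ t, y ≤ t → t ≤ y' → ((x, t) : Site) ∈ S) : Conn S (x, y) (x, y') := by
  obtain ⟨k, rfl⟩ := Int.le.dest hy
  induction k with
  | zero => simpa using Conn.refl (h y le_rfl (by simp))
  | succ k ih =>
    refine (ih (by omega) fun t h1 h2 => h t h1 (by push_cast; omega)).tail
      (h _ (by omega) le_rfl) (adj_iff.2 ?_)
    push_cast; omega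

/-! ### Crossing parity -/

/-- Whether the edge `ab` goes from row `v.2` to row `v.2 + 1` to the right of `v`. -/
def crossesRay (v a b : Site) : Bool :=
  decide ((a.2 = v.2 ∧ b.2 = v.2 + 1 ∧ v.1 < a.1) ∨ (b.2 = v.2 ∧ a.2 = v.2 + 1 ∧ v.1 < b.1))

/-- Whether `a` lies on the horizontal ray to the right of `v`. -/
def onRay (v a : Site) : Bool := decide (a.2 = v.2 ∧ v.1 < a.1)

/-- Whether `a` lies weakly below the row of `v`. -/
def below (v a : Site) : Bool := decide (a.2 ≤ v.2)

theorem exists_parity {T : Set Site} {c d : Site} (h : Conn T c d) : ∃ N : Site → Bool,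
    (∀ v w : Site, w ∉ T → w.1 = v.1 + 1 → w.2 = v.2 → N v = N w) ∧
    (∀ v w : Site, v ∉ T → w ∉ T → w.2 = v.2 + 1 → (w.1 = v.1 ∨ w.1 = v.1 - 1) →
      (N v ^^ N w) = (onRay w c ^^ onRay w d)) ∧
    (∀ v : Site, (∀ t ∈ T, t.2 = v.2 → v.1 < t.1) → N v = (below v c ^^ below v d)) ∧
    (∀ v : Site, (∀ t ∈ T, t.2 = v.2 → t.1 ≤ v.1) → N v = false) := by
  induction h using Conn.induction with
  | base _ => exact ⟨fun _ => false, by simp, by simp, by simp, by simp⟩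
  | step a b hu hb hab ih =>
    have ha := hu.right
    obtain ⟨N, h1, h2, h3, h4⟩ := ih
    rw [adj_iff] at hab
    refine ⟨fun v => N v ^^ crossesRay v a b, ?_, ?_, ?_, ?_⟩
    · intro v w hw e1 e2
      have hwa : ¬ (a.1 = w.1 ∧ a.2 = w.2) := fun h => hw (by rwa [← Prod.ext h.1 h.2])
      have hwb : ¬ (b.1 = w.1 ∧ b.2 = w.2) := fun h => hw (by rwa [← Prod.ext h.1 h.2])
      have : crossesRay v a b = crossesRay w a b := by
        simp only [crossesRay, decide_eq_decide]; omega
      simp only [h1 v w hw e1 e2, this]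
    · intro v w hv hw e1 e2
      have hwa : ¬ (a.1 = w.1 ∧ a.2 = w.2) := fun h => hw (by rwa [← Prod.ext h.1 h.2])
      have hwb : ¬ (b.1 = w.1 ∧ b.2 = w.2) := fun h => hw (by rwa [← Prod.ext h.1 h.2])
      have hva : ¬ (a.1 = v.1 ∧ a.2 = v.2) := fun h => hv (by rwa [← Prod.ext h.1 h.2])
      have hvb : ¬ (b.1 = v.1 ∧ b.2 = v.2) := fun h => hv (by rwa [← Prod.ext h.1 h.2])
      have key : (crossesRay v a b ^^ crossesRay w a b) = (onRay w a ^^ onRay w b) := by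
        rw [Bool.eq_iff_iff]
        simp only [crossesRay, onRay, bne_iff_ne, ne_eq, decide_eq_decide]
        clear h1 h2 h3 h4
        rcases hab with hab | hab | hab | hab | hab | hab <;> grind (splits := 20)
      have := h2 v w hv hw e1 e2
      beta_reduce
      revert this key
      generalize N v = p, N w = q, crossesRay v a b = r, crossesRay w a b = s,
        onRay w a = i, onRay w b = j, onRay w c = k
      revert p q r s i j k
      decide
    · intro v hv
      have key : crossesRay v a b = (below v a ^^ below v b) := by
        have hva := hv a ha
        have hvb := hv b hb
        rw [Bool.eq_iff_iff]
        simp only [crossesRay, below, bne_iff_ne, ne_eq, decide_eq_decide, decide_eq_true_eq]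
        omega
      have := h3 v hv
      beta_reduce
      revert this key
      generalize N v = p, crossesRay v a b = r, below v a = i, below v b = j, below v c = k
      revert p r i j k
      decide
    · intro v hv
      have key : crossesRay v a b = false := by
        have hva := hv a ha
        have hvb := hv b hb
        simp only [crossesRay, decide_eq_false_iff_not]
        omega
      simp [key, h4 v hv]

theorem eq_of_xor_eq_false {p q : Bool} (h : (p ^^ q) = (false ^^ false)) : p = q := by
  revert p q; decide

/-- A left-right walk and a top-bottom walk cannot be disjoint. -/
theorem no_crossing {S T : Set Site} {a b c d : Site} {x₀ x₁ ylo yhi : ℤ}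
    (hS : Conn S a b) (hT : Conn T c d) (hdisj : ∀ v ∈ S, v ∉ T)
    (hrow : ∀ v ∈ S, ylo ≤ v.2 ∧ v.2 ≤ yhi) (hcol : ∀ v ∈ T, x₀ ≤ v.1 ∧ v.1 ≤ x₁)
    (ha : a.1 ≤ x₀) (hb : x₁ ≤ b.1) (hc : yhi < c.2) (hd : d.2 < ylo) : False := by
  obtain ⟨N, h1, h2, h3, h4⟩ := exists_parity hT
  have hray : ∀ w ∈ S, onRay w c = false ∧ onRay w d = false := by
    intro w hw
    have := hrow w hw
    simp only [onRay, decide_eq_false_iff_not]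
    omega
  have hconst : N b = N a := by
    clear hb
    induction hS using Conn.induction with
    | base _ => rfl
    | step u v hu hv huv ih =>
      have hu' := hu.right
      have e := hray u hu'
      have e' := hray v hv
      refine Eq.trans ?_ ih
      rw [adj_iff] at huv
      rcases huv with ⟨p, q⟩ | ⟨p, q⟩ | ⟨p, q⟩ | ⟨p, q⟩ | ⟨p, q⟩ | ⟨p, q⟩
      · exact (h1 u v (hdisj v hv) p q).symm
      · exact h1 v u (hdisj u hu') (by omega) (by omega)
      · have := h2 u v (hdisj u hu') (hdisj v hv) q (by omega)
        rw [e'.1, e'.2] at this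
        exact (eq_of_xor_eq_false this).symm
      · have := h2 v u (hdisj v hv) (hdisj u hu') (by omega) (by omega)
        rw [e.1, e.2] at this
        exact eq_of_xor_eq_false this
      · have := h2 v u (hdisj v hv) (hdisj u hu') (by omega) (by omega)
        rw [e.1, e.2] at this
        exact eq_of_xor_eq_false this
      · have := h2 u v (hdisj u hu') (hdisj v hv) q (by omega)
        rw [e'.1, e'.2] at this
        exact (eq_of_xor_eq_false this).symm
  have hNa := h3 a fun t ht e => by
    have := hcol t ht
    rcases (show a.1 ≤ t.1 by omega).lt_or_eq with h | h
    · exact h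
    · exact absurd (Prod.ext h e.symm ▸ ht) (hdisj a hS.left)
  have hNb := h4 b fun t ht e => by
    have := hcol t ht
    omega
  have e1 : below a c = false := by
    have := hrow a hS.left
    simp only [below, decide_eq_false_iff_not]; omega
  have e2 : below a d = true := by
    have := hrow a hS.left
    simp only [below, decide_eq_true_eq]; omega
  rw [hconst, hNa, e1, e2] at hNb
  exact absurd hNb (by decide)

theorem not_disjoint_of_cross {S T : Set Site} {a b c d : Site} {x₀ x₁ y₀ y₁ : ℤ}
    (hS : Conn S a b) (hT : Conn T c d) (hdisj : ∀ v ∈ S, v ∉ T)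
    (hrow : ∀ v ∈ S, y₀ ≤ v.2 ∧ v.2 ≤ y₁) (hcol : ∀ v ∈ T, x₀ ≤ v.1 ∧ v.1 ≤ x₁)
    (ha : a.1 ≤ x₀) (hb : x₁ ≤ b.1) (hc : y₁ ≤ c.2) (hd : d.2 ≤ y₀) : False := by
  set T' : Set Site := T ∪ {(c.1, c.2 + 1), (d.1, d.2 - 1)} with hT'
  have hsub : T ⊆ T' := Set.subset_union_left
  have h1 : Conn T' (c.1, c.2 + 1) (d.1, d.2 - 1) :=
    Conn.head (by simp [hT']) (adj_iff.2 (by simp))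
      ((hT.mono hsub).tail (by simp [hT']) (adj_iff.2 (by simp)))
  refine no_crossing (x₀ := x₀) (x₁ := x₁) hS h1 ?_ hrow ?_ ha hb (by simp; omega) (by simp; omega)
  · rintro v hv (h | h | h)
    · exact hdisj v hv h
    · have := hrow v hv
      rw [h] at this
      simp at this; omega
    · have := hrow v hv
      rw [h] at this
      simp at this; omega
  · rintro v (h | rfl | rfl)
    · exact hcol v h
    · exact hcol c hT.left
    · exact hcol d hT.right

theorem left_leg_meets {S T : Set Site} {a b c d : Site} {x₀ x₁ y₀ y₁ : ℤ}
    (hS : Conn S a b) (hT : Conn T c d) (hdisj : ∀ v ∈ S, v ∉ T)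
    (hSr : ∀ v ∈ S, y₀ ≤ v.2 ∧ v.2 ≤ y₁) (hTr : ∀ v ∈ T, x₀ ≤ v.1 ∧ v.1 ≤ x₁ ∧ y₀ ≤ v.2)
    (ha : a.1 ≤ x₀) (hb : b.2 = y₀) (hc : y₁ ≤ c.2) (hd : d.2 = y₀) (hx : d.1 < b.1) : False := by
  have e1 := hTr d hT.right
  have e2 := hSr b hS.right
  set S' : Set Site := S ∪ {v | v.2 = y₀ - 1 ∧ b.1 ≤ v.1} with hS'
  set T' : Set Site := T ∪ {(d.1, y₀ - 1)} with hT'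
  have h1 : Conn S' a (max b.1 x₁, y₀ - 1) :=
    ((hS.mono Set.subset_union_left).tail (c := (b.1, y₀ - 1)) (by simp)
      (adj_iff.2 (by simp; omega))).trans (conn_row (by simp) fun t h1 h2 => by simp [h1])
  have h2 : Conn T' c (d.1, y₀ - 1) :=
    (hT.mono Set.subset_union_left).tail (by simp) (adj_iff.2 (by simp; omega))
  refine not_disjoint_of_cross (x₀ := x₀) (x₁ := x₁) (y₀ := y₀ - 1) (y₁ := y₁) h1 h2
    ?_ ?_ ?_ ha (by simp) hc (by simp)
  · rintro v (hv | hv) (h | h)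
    · exact hdisj v hv h
    · have := hSr v hv
      rw [h] at this
      simp at this
    · have := (hTr v h).2.2
      have := hv.1
      omega
    · rw [h] at hv
      have := hv.2
      simp at this; omega
  · rintro v (hv | hv)
    · have := hSr v hv; omega
    · have := hv.1; omega
  · rintro v (hv | hv)
    · have := hTr v hv; omega
    · rw [hv]; simp; omega

theorem right_leg_meets {S T : Set Site} {a b c d : Site} {x₀ x₁ y₀ y₁ : ℤ}
    (hS : Conn S a b) (hT : Conn T c d) (hdisj : ∀ v ∈ S, v ∉ T)
    (hSr : ∀ v ∈ S, y₀ ≤ v.2 ∧ v.2 ≤ y₁) (hTr : ∀ v ∈ T, x₀ ≤ v.1 ∧ v.1 ≤ x₁ ∧ y₀ ≤ v.2)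
    (ha : x₁ ≤ a.1) (hb : b.2 = y₀) (hc : y₁ ≤ c.2) (hd : d.2 = y₀) (hx : b.1 < d.1) : False := by
  have e1 := hTr d hT.right
  have e2 := hSr b hS.right
  set S' : Set Site := S ∪ {v | v.2 = y₀ - 1 ∧ v.1 ≤ b.1} with hS'
  set T' : Set Site := T ∪ {(d.1, y₀ - 1)} with hT'
  have h1 : Conn S' (min b.1 x₀, y₀ - 1) a :=
    (conn_row (x' := b.1) (by simp) fun t h1 h2 => by simp [hS', h2]).trans
      (Conn.head (by simp [hS']) (adj_iff.2 (by simp; omega)) (hS.mono Set.subset_union_left).symm)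
  have h2 : Conn T' c (d.1, y₀ - 1) :=
    (hT.mono Set.subset_union_left).tail (by simp) (adj_iff.2 (by simp; omega))
  refine not_disjoint_of_cross (x₀ := x₀) (x₁ := x₁) (y₀ := y₀ - 1) (y₁ := y₁) h1 h2
    ?_ ?_ ?_ (by simp) ha hc (by simp)
  · rintro v (hv | hv) (h | h)
    · exact hdisj v hv h
    · have := hSr v hv
      rw [h] at this
      simp at this
    · have := (hTr v h).2.2
      have := hv.1
      omega
    · rw [h] at hv
      have := hv.2
      simp at this; omega
  · rintro v (hv | hv)
    · have := hSr v hv; omega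
    · have := hv.1; omega
  · rintro v (hv | hv)
    · have := hTr v hv; omega
    · rw [hv]; simp; omega

/-- A walk from the left wall and a walk from the right wall reaching the bottom row in the
wrong order meet. -/
theorem legs_meet {S T : Set Site} {a b c d : Site} {x₀ x₁ y₀ y₁ : ℤ}
    (hS : Conn S a b) (hT : Conn T c d) (hdisj : ∀ v ∈ S, v ∉ T)
    (hSr : ∀ v ∈ S, v.1 ≤ x₁ ∧ y₀ ≤ v.2 ∧ v.2 ≤ y₁)
    (hTr : ∀ v ∈ T, x₀ ≤ v.1 ∧ v.1 ≤ x₁ ∧ y₀ ≤ v.2 ∧ v.2 ≤ y₁)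
    (ha : a.1 ≤ x₀) (hb : b.2 = y₀) (hc : c.1 = x₁) (hd : d.2 = y₀) (hx : d.1 < b.1) : False := by
  have e1 := hTr d hT.right
  have e2 := hSr b hS.right
  have e3 := hTr c hT.left
  set S' : Set Site := S ∪ {v | v.2 = y₀ - 1 ∧ b.1 ≤ v.1} with hS'
  set T' : Set Site := T ∪ ({v | v.1 = x₁ + 1 ∧ y₀ ≤ v.2} ∪ {(d.1, y₀ - 1)}) with hT'
  have h1 : Conn S' a (x₁ + 1, y₀ - 1) :=
    ((hS.mono Set.subset_union_left).tail (c := (b.1, y₀ - 1)) (by simp)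
      (adj_iff.2 (by simp; omega))).trans
      (conn_row (by omega) fun t h1 h2 => by simp [h1])
  have h2 : Conn T' (x₁ + 1, y₁) (d.1, y₀ - 1) :=
    ((conn_col (y := c.2) (y' := y₁) (by omega) fun t h1 h2 => by
      simp; omega).symm.tail (hT.mono Set.subset_union_left).left
        (adj_iff.2 (by simp; omega))).trans
    ((hT.mono Set.subset_union_left).tail (by simp) (adj_iff.2 (by simp; omega)))
  refine not_disjoint_of_cross (x₀ := x₀) (x₁ := x₁ + 1) (y₀ := y₀ - 1) (y₁ := y₁) h1 h2
    ?_ ?_ ?_ ha (by simp) (by simp) (by simp)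
  · rintro v (hv | hv) (h | h | h)
    · exact hdisj v hv h
    · have := hSr v hv
      have := h.1
      omega
    · have := hSr v hv
      rw [h] at this
      simp at this
    · have := (hTr v h).2.2
      have := hv.1
      omega
    · have := hv.1
      have := h.2
      omega
    · rw [h] at hv
      have := hv.2
      simp at this; omega
  · rintro v (hv | hv)
    · have := hSr v hv; omega
    · have := hv.1; omega
  · rintro v (hv | hv | hv)
    · have := hTr v hv; omega
    · have := hv.1; omega
    · rw [hv]; simp; omega

/-- Two top-bottom walks whose endpoints are in opposite orders meet. -/
theorem swapped_walks_meet {S T : Set Site} {a b c d : Site} {y₀ y₁ : ℤ}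
    (hS : Conn S a b) (hT : Conn T c d) (hdisj : ∀ v ∈ S, v ∉ T) (hfin : T.Finite)
    (hSr : ∀ v ∈ S, y₀ ≤ v.2 ∧ v.2 ≤ y₁) (hTr : ∀ v ∈ T, y₀ ≤ v.2 ∧ v.2 ≤ y₁)
    (ha : a.2 = y₁) (hb : b.2 = y₀) (hc : c.2 = y₁) (hd : d.2 = y₀)
    (hca : c.1 < a.1) (hbd : b.1 < d.1) : False := by
  obtain ⟨x₀, hx₀⟩ := (hfin.image Prod.fst).bddBelow
  obtain ⟨x₁, hx₁⟩ := (hfin.image Prod.fst).bddAbove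
  have hcol : ∀ v ∈ T, x₀ ≤ v.1 ∧ v.1 ≤ x₁ := fun v hv =>
    ⟨hx₀ ⟨v, hv, rfl⟩, hx₁ ⟨v, hv, rfl⟩⟩
  have e1 := hTr d hT.right
  set S' : Set Site := S ∪ ({v | v.2 = y₁ + 1 ∧ a.1 ≤ v.1} ∪ {v | v.2 = y₀ - 1 ∧ v.1 ≤ b.1}) with hS'
  set T' : Set Site := T ∪ {(c.1, y₁ + 1), (d.1, y₀ - 1)} with hT'
  have h1 : Conn S' (min b.1 x₀, y₀ - 1) (max a.1 x₁, y₁ + 1) :=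
    ((conn_row (x' := b.1) (by simp) fun t h1 h2 => by simp [h2]).trans
      (Conn.head (by simp) (adj_iff.2 (by simp; omega))
        (hS.mono Set.subset_union_left).symm)).trans
    (Conn.head (hS.mono Set.subset_union_left).left (adj_iff.2 (by simp; omega))
      (conn_row (x := a.1) (by simp) fun t h1 h2 => by simp [h1]))
  have h2 : Conn T' (c.1, y₁ + 1) (d.1, y₀ - 1) :=
    Conn.head (by simp [hT']) (adj_iff.2 (by simp; omega))
    ((hT.mono Set.subset_union_left).tail (by simp) (adj_iff.2 (by simp; omega)))
  refine not_disjoint_of_cross (x₀ := x₀) (x₁ := x₁) (y₀ := y₀ - 1) (y₁ := y₁ + 1) h1 h2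
    ?_ ?_ ?_ (by simp) (by simp) (by simp) (by simp)
  · rintro v (hv | hv | hv) (h | h | h)
    · exact hdisj v hv h
    · have := hSr v hv
      rw [h] at this
      simp at this
    · have := hSr v hv
      rw [h] at this
      simp at this
    · have := hTr v h
      have := hv.1
      omega
    · rw [h] at hv
      have := hv.2
      simp at this; omega
    · rw [h] at hv
      have := hv.1
      simp at this; omega
    · have := hTr v h
      have := hv.1
      omega
    · rw [h] at hv
      have := hv.1
      simp at this; omega
    · rw [h] at hv
      have := hv.2
      simp at this; omega
  · rintro v (hv | hv | hv)
    · have := hSr v hv; omega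
    · have := hv.1; omega
    · have := hv.1; omega
  · rintro v (hv | hv | hv)
    · exact hcol v hv
    · rw [hv]; exact hcol c hT.left
    · rw [hv]; exact hcol d hT.right

/-! ### The game of Y and the Hex theorem -/

/-- The triangle `{x, y ≥ 0, x + y ≤ n}`. -/
def triangle (n : ℤ) : Set Site := {v | 0 ≤ v.1 ∧ 0 ≤ v.2 ∧ v.1 + v.2 ≤ n}

/-- The upward unit triangle with corner `v`. -/
def corner (v : Site) : Set Site := {v, (v.1 + 1, v.2), (v.1, v.2 + 1)}

theorem corner_adj {v s t : Site} (hs : s ∈ corner v) (ht : t ∈ corner v) : s = t ∨ Adj s t := by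
  rcases hs with rfl | rfl | rfl <;> rcases ht with rfl | rfl | rfl <;> simp [adj_iff]

theorem exists_mono_Y (n : ℕ) : ∀ c : Site → Bool, ∃ b p q r, p.1 = 0 ∧ q.2 = 0 ∧
    r.1 + r.2 = (n : ℤ) ∧ Conn (triangle n ∩ {v | c v = b}) p q ∧
    Conn (triangle n ∩ {v | c v = b}) p r := by
  induction n with
  | zero =>
    intro c
    have h0 : ((0, 0) : Site) ∈ triangle (0 : ℕ) ∩ {v | c v = c (0, 0)} := by simp [triangle]
    exact ⟨c (0, 0), (0, 0), (0, 0), (0, 0), rfl, rfl, by simp, Conn.refl h0, Conn.refl h0⟩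
  | succ n ih =>
    intro c
    obtain ⟨b, p, q, r, hp, hq, hr, hpq, hpr⟩ := ih fun v =>
      (c v && c (v.1 + 1, v.2)) || (c v && c (v.1, v.2 + 1)) ||
        (c (v.1 + 1, v.2) && c (v.1, v.2 + 1))
    set S' : Set Site := triangle n ∩ {v | ((c v && c (v.1 + 1, v.2)) || (c v && c (v.1, v.2 + 1)) ||
        (c (v.1 + 1, v.2) && c (v.1, v.2 + 1))) = b} with hS'
    set S : Set Site := triangle (n + 1 : ℕ) ∩ {v | c v = b} with hS
    have htri : ∀ v ∈ triangle n, corner v ⊆ triangle (n + 1 : ℕ) := by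
      rintro v hv w (rfl | rfl | rfl) <;> simp only [triangle, Set.mem_ofPred_eq] at * <;>
        push_cast <;> omega
    have hmaj : ∀ v ∈ S', (c v = b ∧ c (v.1 + 1, v.2) = b) ∨ (c v = b ∧ c (v.1, v.2 + 1) = b) ∨
        (c (v.1 + 1, v.2) = b ∧ c (v.1, v.2 + 1) = b) := by
      rintro v ⟨-, hv⟩
      simp only [Set.mem_ofPred_eq] at hv
      revert hv
      generalize c v = i, c (v.1 + 1, v.2) = j, c (v.1, v.2 + 1) = k
      clear * -
      revert i j k b
      decide
    have key : ∀ u v, u ∈ S' → v ∈ S' → Adj u v →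
        ∃ s ∈ corner u ∩ S, ∃ t ∈ corner v ∩ S, s = t ∨ Adj s t := by
      suffices key' : ∀ u v, u ∈ S' → v ∈ S' → ((v.1 = u.1 + 1 ∧ v.2 = u.2) ∨
          (v.1 = u.1 ∧ v.2 = u.2 + 1) ∨ (v.1 = u.1 + 1 ∧ v.2 = u.2 - 1)) →
          ∃ s ∈ corner u ∩ S, ∃ t ∈ corner v ∩ S, s = t ∨ Adj s t by
        intro u v hu hv huv
        rw [adj_iff] at huv
        by_cases h : (v.1 = u.1 + 1 ∧ v.2 = u.2) ∨
          (v.1 = u.1 ∧ v.2 = u.2 + 1) ∨ (v.1 = u.1 + 1 ∧ v.2 = u.2 - 1)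
        · exact key' u v hu hv h
        · obtain ⟨s, hs, t, ht, hst⟩ := key' v u hv hu (by omega)
          exact ⟨t, ht, s, hs, hst.imp Eq.symm Adj.symm⟩
      intro u v hu hv huv
      by_contra hcon
      push Not at hcon
      have hcon' : ∀ s ∈ corner u, ∀ t ∈ corner v, c s = b → c t = b → s ≠ t ∧ ¬ Adj s t :=
        fun s hs t ht es et => hcon s ⟨hs, htri u hu.1 hs, es⟩ t ⟨ht, htri v hv.1 ht, et⟩
      have mu := hmaj u hu
      have mv := hmaj v hv
      clear hcon hu hv
      obtain ⟨x, y⟩ := u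
      obtain ⟨x', y'⟩ := v
      simp only at huv mu mv
      rcases huv with ⟨rfl, rfl⟩ | ⟨rfl, rfl⟩ | ⟨rfl, rfl⟩ <;>
        rcases mu with ⟨m1, m2⟩ | ⟨m1, m2⟩ | ⟨m1, m2⟩ <;>
        rcases mv with ⟨m3, m4⟩ | ⟨m3, m4⟩ | ⟨m3, m4⟩ <;>
        first
        | (have := hcon' _ (by simp [corner]) _ (by simp [corner]) m1 m3
           simp [adj_iff] at this; done)
        | (have := hcon' _ (by simp [corner]) _ (by simp [corner]) m1 m4
           simp [adj_iff] at this; done)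
        | (have := hcon' _ (by simp [corner]) _ (by simp [corner]) m2 m3
           simp [adj_iff] at this; done)
        | (have := hcon' _ (by simp [corner]) _ (by simp [corner]) m2 m4
           simp [adj_iff] at this)
    have hconn : ∀ v, Conn S' p v → ∀ s ∈ corner p ∩ S, ∀ t ∈ corner v ∩ S, Conn S s t := by
      intro v hv
      induction hv using Conn.induction with
      | base _ =>
        intro s hs t ht
        rcases corner_adj hs.1 ht.1 with rfl | h
        · exact Conn.refl hs.2
        · exact Conn.single hs.2 ht.2 h
      | step u v hu hv huv ih =>
        intro s hs t ht
        obtain ⟨x, hx, y, hy, hxy⟩ := key u v hu.right hv huv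
        have h1 := ih s hs x hx
        have h2 : Conn S x y := by
          rcases hxy with rfl | h
          · exact Conn.refl hx.2
          · exact Conn.single hx.2 hy.2 h
        rcases corner_adj hy.1 ht.1 with rfl | h
        · exact h1.trans h2
        · exact (h1.trans h2).tail ht.2 h
    have hp' := hmaj p hpq.left
    have hq' := hmaj q hpq.right
    have hr' := hmaj r hpr.right
    obtain ⟨p', hpp, hp0⟩ : ∃ p' ∈ corner p ∩ S, p'.1 = 0 := by
      rcases hp' with h | h | h
      · exact ⟨p, ⟨by simp [corner], htri p hpq.left.1 (by simp [corner]), h.1⟩, hp⟩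
      · exact ⟨p, ⟨by simp [corner], htri p hpq.left.1 (by simp [corner]), h.1⟩, hp⟩
      · exact ⟨_, ⟨by simp [corner], htri p hpq.left.1 (by simp [corner]), h.2⟩, hp⟩
    obtain ⟨q', hqq, hq0⟩ : ∃ q' ∈ corner q ∩ S, q'.2 = 0 := by
      rcases hq' with h | h | h
      · exact ⟨q, ⟨by simp [corner], htri q hpq.right.1 (by simp [corner]), h.1⟩, hq⟩
      · exact ⟨q, ⟨by simp [corner], htri q hpq.right.1 (by simp [corner]), h.1⟩, hq⟩
      · exact ⟨_, ⟨by simp [corner], htri q hpq.right.1 (by simp [corner]), h.1⟩, hq⟩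
    obtain ⟨r', hrr, hr0⟩ : ∃ r' ∈ corner r ∩ S, r'.1 + r'.2 = ((n + 1 : ℕ) : ℤ) := by
      rcases hr' with h | h | h
      · exact ⟨_, ⟨by simp [corner], htri r hpr.right.1 (by simp [corner]), h.2⟩, by
          push_cast; omega⟩
      · exact ⟨_, ⟨by simp [corner], htri r hpr.right.1 (by simp [corner]), h.2⟩, by
          push_cast; omega⟩
      · exact ⟨_, ⟨by simp [corner], htri r hpr.right.1 (by simp [corner]), h.2⟩, by
          push_cast; omega⟩
    exact ⟨b, p', q', r', hp0, hq0, hr0, hconn q hpq p' hpp q' hqq, hconn r hpr p' hpp r' hrr⟩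

/-- Extracting the part of a walk between two levels of a `1`-Lipschitz function. -/
theorem Conn.window {S : Set Site} {c d : Site} (h : Conn S c d) (f : Site → ℤ)
    (hf : ∀ u v, Adj u v → f u ≤ f v + 1) {lo hi : ℤ} (hc : hi ≤ f c) (hd : f d ≤ lo)
    (hlh : lo ≤ hi) : ∃ c' d', f c' = hi ∧ f d' = lo ∧
      Conn (S ∩ {v | lo ≤ f v ∧ f v ≤ hi}) c' d' ∧ Conn S c c' := by
  obtain ⟨c', hc', hcc, hcd⟩ : ∃ c', f c' = hi ∧ Conn S c c' ∧
      Conn (S ∩ {v | f v ≤ hi}) c' d := by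
    by_cases hdh : hi ≤ f d
    · have : f d = hi := by omega
      exact ⟨d, this, h, Conn.refl ⟨h.right, this.le⟩⟩
    · obtain ⟨p, hp, q, h1, h2, h3⟩ := h.last_exit {v | hi ≤ f v} hc hdh
      have e1 := hf p q h2
      have e2 : ¬ hi ≤ f q := h3.left.2
      have e3 : hi ≤ f p := hp
      refine ⟨p, by omega, h1, Conn.head ⟨h1.right, ?_⟩ h2 (h3.mono ?_)⟩
      · change f p ≤ hi; omega
      · rintro v ⟨hv, hv'⟩
        refine ⟨hv, ?_⟩
        change ¬ hi ≤ f v at hv'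
        change f v ≤ hi; omega
  by_cases hcl : f c' ≤ lo
  · have : f c' = lo := by omega
    exact ⟨c', c', hc', this, Conn.refl ⟨hcc.right, this.ge, hc'.le⟩, hcc⟩
  · obtain ⟨p, q, hq, h1, h2, h3⟩ := hcd.first_entry {v | f v ≤ lo} hcl hd
    have e1 := hf p q h2
    have e2 : ¬ f p ≤ lo := h1.right.2
    have e3 : f q ≤ lo := hq
    refine ⟨c', q, hc', by omega, Conn.tail (h1.mono ?_) ⟨h3.left.1, by omega, by omega⟩ h2, hcc⟩
    rintro v ⟨⟨hv, hv'⟩, hv''⟩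
    change ¬ f v ≤ lo at hv''
    exact ⟨hv, by omega, hv'⟩

/-- The part of `O` in a rectangle contains a left-right walk. -/
def LR (x₀ x₁ y₀ y₁ : ℤ) (O : Set Site) : Prop :=
  ∃ a b : Site, a.1 = x₀ ∧ b.1 = x₁ ∧ Conn (rect x₀ x₁ y₀ y₁ ∩ O) a b

/-- The part of `O` in a rectangle contains a top-bottom walk. -/
def TB (x₀ x₁ y₀ y₁ : ℤ) (O : Set Site) : Prop :=
  ∃ c d : Site, c.2 = y₁ ∧ d.2 = y₀ ∧ Conn (rect x₀ x₁ y₀ y₁ ∩ O) c d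

theorem LR.mono {x₀ x₁ y₀ y₁ : ℤ} {O O' : Set Site} (h : O ⊆ O') (h' : LR x₀ x₁ y₀ y₁ O) :
    LR x₀ x₁ y₀ y₁ O' := by
  obtain ⟨a, b, ha, hb, h1⟩ := h'
  exact ⟨a, b, ha, hb, h1.mono (Set.inter_subset_inter_right _ h)⟩

theorem TB.mono {x₀ x₁ y₀ y₁ : ℤ} {O O' : Set Site} (h : O ⊆ O') (h' : TB x₀ x₁ y₀ y₁ O) :
    TB x₀ x₁ y₀ y₁ O' := by
  obtain ⟨a, b, ha, hb, h1⟩ := h'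
  exact ⟨a, b, ha, hb, h1.mono (Set.inter_subset_inter_right _ h)⟩

theorem LR.not_TB {x₀ x₁ y₀ y₁ : ℤ} {O O' : Set Site} (h : LR x₀ x₁ y₀ y₁ O)
    (h' : TB x₀ x₁ y₀ y₁ O') (hd : ∀ v ∈ O, v ∉ O') : False := by
  obtain ⟨a, b, ha, hb, hab⟩ := h
  obtain ⟨c, d, hc, hd', hcd⟩ := h'
  exact not_disjoint_of_cross hab hcd (fun v hv hv' => hd v hv.2 hv'.2)
    (fun v hv => hv.1.2.2) (fun v hv => ⟨hv.1.1, hv.1.2.1⟩) ha.le hb.ge hc.ge hd'.le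

/-- A walk going from height at least `y₁` to height at most `y₀` within columns `[x₀, x₁]`
contains a top-bottom crossing. -/
theorem Conn.toTB {S : Set Site} {c d : Site} (h : Conn S c d) {x₀ x₁ y₀ y₁ : ℤ} (hy : y₀ ≤ y₁)
    (hc : y₁ ≤ c.2) (hd : d.2 ≤ y₀) {O : Set Site}
    (hS : ∀ v ∈ S, y₀ ≤ v.2 → v.2 ≤ y₁ → x₀ ≤ v.1 ∧ v.1 ≤ x₁ ∧ v ∈ O) :
    TB x₀ x₁ y₀ y₁ O := by
  obtain ⟨c', d', h1, h2, h3, -⟩ := h.window (fun v => v.2)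
    (fun u v h => by rw [adj_iff] at h; omega) hc hd hy
  refine ⟨c', d', h1, h2, h3.mono ?_⟩
  rintro v ⟨hv, h1, h2⟩
  have := hS v hv h1 h2
  exact ⟨⟨this.1, this.2.1, h1, h2⟩, this.2.2⟩

theorem Conn.toLR {S : Set Site} {a b : Site} (h : Conn S a b) {x₀ x₁ y₀ y₁ : ℤ} (hx : x₀ ≤ x₁)
    (ha : a.1 ≤ x₀) (hb : x₁ ≤ b.1) {O : Set Site}
    (hS : ∀ v ∈ S, x₀ ≤ v.1 → v.1 ≤ x₁ → y₀ ≤ v.2 ∧ v.2 ≤ y₁ ∧ v ∈ O) :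
    LR x₀ x₁ y₀ y₁ O := by
  obtain ⟨c', d', h1, h2, h3, -⟩ := h.symm.window (fun v => v.1)
    (fun u v h => by rw [adj_iff] at h; omega) hb ha hx
  refine ⟨d', c', h2, h1, (h3.mono ?_).symm⟩
  rintro v ⟨hv, h1, h2⟩
  have := hS v hv h1 h2
  exact ⟨⟨h1, h2, this.1, this.2.1⟩, this.2.2⟩

/-- The Hex theorem. -/
theorem hex {x₀ x₁ y₀ y₁ : ℤ} (hx : x₀ ≤ x₁) (hy : y₀ ≤ y₁) (O : Set Site) :
    LR x₀ x₁ y₀ y₁ O ∨ TB x₀ x₁ y₀ y₁ Oᶜ := by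
  classical
  obtain ⟨a, rfl⟩ := Int.le.dest hx
  obtain ⟨b, rfl⟩ := Int.le.dest hy
  obtain ⟨col, p, q, r, hp, hq, hr, hpq, hpr⟩ := exists_mono_Y (a + b + 1) fun v =>
    decide ((a : ℤ) < v.1 ∨ (v.2 ≤ b ∧ (x₀ + v.1, y₀ + v.2) ∈ O))
  have hshift : ∀ u v, Adj u v → Adj (x₀ + u.1, y₀ + u.2) (x₀ + v.1, y₀ + v.2) := by
    intro u v h
    rw [adj_iff] at *
    simp only; omega
  push_cast at hr
  cases col with
  | true =>
    left
    have h1 := hpr.image (T := {v : Site | x₀ ≤ v.1 ∧ y₀ ≤ v.2 ∧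
      (x₀ + a < v.1 ∨ (v.2 ≤ y₀ + b ∧ v ∈ O)) ∧ v.1 + v.2 ≤ x₀ + y₀ + a + b + 1})
      (fun v => (x₀ + v.1, y₀ + v.2)) ?_ hshift
    · refine h1.toLR (by omega) (by simp [hp]) ?_ ?_
      · have h := hpr.right.2
        simp only [Set.mem_ofPred_eq, decide_eq_true_eq] at h
        simp only; omega
      · rintro v ⟨h1, h2, h3 | h3, h4⟩ h5 h6
        · omega
        · exact ⟨h2, h3⟩
    · rintro v ⟨⟨h1, h2, h3⟩, h4⟩
      simp only [Set.mem_ofPred_eq, decide_eq_true_eq] at h4 ⊢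
      push_cast at h3
      refine ⟨by omega, by omega, ?_, by omega⟩
      rcases h4 with h4 | h4
      · left; omega
      · right; exact ⟨by omega, h4.2⟩
  | false =>
    right
    have h1 := (hpq.symm.trans hpr).symm.image (T := {v : Site | x₀ ≤ v.1 ∧ v.1 ≤ x₀ + a ∧ y₀ ≤ v.2 ∧
      (y₀ + b < v.2 ∨ v ∉ O)}) (fun v => (x₀ + v.1, y₀ + v.2)) ?_ hshift
    · refine h1.toTB (by omega) ?_ (by simp [hq]) ?_
      · have h := hpr.right.2
        simp only [Set.mem_ofPred_eq, decide_eq_false_iff_not] at h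
        simp only; omega
      · rintro v ⟨h1, h2, h3, h4 | h4⟩ h5 h6
        · omega
        · exact ⟨h1, h2, h4⟩
    · rintro v ⟨⟨h1, h2, h3⟩, h4⟩
      simp only [Set.mem_ofPred_eq, decide_eq_false_iff_not] at h4 ⊢
      push_cast at h3
      push Not at h4
      refine ⟨by omega, by omega, by omega, ?_⟩
      by_cases hb : v.2 ≤ b
      · exact Or.inr (h4.2 hb)
      · left; omega

theorem not_LR_iff {x₀ x₁ y₀ y₁ : ℤ} (hx : x₀ ≤ x₁) (hy : y₀ ≤ y₁) (O : Set Site) :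
    ¬ LR x₀ x₁ y₀ y₁ O ↔ TB x₀ x₁ y₀ y₁ Oᶜ :=
  ⟨(hex hx hy O).resolve_left, fun h h' => h'.not_TB h fun _ h => not_not.2 h⟩

/-- The sites of colour `b`. -/
def Col (b : Bool) (ω : Config) : Set Site := {v | ω v = b}

/-- The event `E` depends only on the sites in `A`. -/
def Det (A : Set Site) (E : Set Config) : Prop :=
  ∀ ω ω' : Config, (∀ v ∈ A, ω v = ω' v) → ω ∈ E → ω' ∈ E

theorem Det.mono {A B : Set Site} {E : Set Config} (h : Det A E) (hAB : A ⊆ B) : Det B E :=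
  fun ω ω' h' => h ω ω' fun v hv => h' v (hAB hv)

theorem Det.compl {A : Set Site} {E : Set Config} (h : Det A E) : Det A Eᶜ :=
  fun ω ω' h' hω hω' => hω (h ω' ω (fun v hv => (h' v hv).symm) hω')

theorem Det.inter {A : Set Site} {E F : Set Config} (h : Det A E) (h' : Det A F) :
    Det A (E ∩ F) := fun ω ω' e hω => ⟨h ω ω' e hω.1, h' ω ω' e hω.2⟩

theorem Det.union {A : Set Site} {E F : Set Config} (h : Det A E) (h' : Det A F) :
    Det A (E ∪ F) := fun ω ω' e hω => hω.imp (h ω ω' e) (h' ω ω' e)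

theorem det_empty (A : Set Site) : Det A ∅ := fun _ _ _ h => h

/-- Events defined through the colour-`b` sites of `A` depend only on `A`. -/
theorem det_col (A : Set Site) (b : Bool) (Q : Set Site → Prop) :
    Det A {ω | Q (A ∩ Col b ω)} := by
  intro ω ω' h hω
  have : A ∩ Col b ω = A ∩ Col b ω' := by
    ext v
    simp only [Col, Set.mem_inter_iff, Set.mem_ofPred_eq, and_congr_right_iff]
    intro hv
    rw [h v hv]
  simpa only [Set.mem_ofPred_eq, this] using hω

theorem Det.measurableSet {A : Set Site} {E : Set Config} (h : Det A E) (hA : A.Finite) :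
    MeasurableSet E := by
  have := hA.fintype
  have h1 : E = (fun (ω : Config) (a : A) => ω a) ⁻¹' ((fun (ω : Config) (a : A) => ω a) '' E) := by
    ext ω
    constructor
    · exact fun h => ⟨ω, h, rfl⟩
    · rintro ⟨ω', h1, h2⟩
      exact h ω' ω (fun v hv => congrFun h2 ⟨v, hv⟩) h1
  rw [h1]
  exact measurableSet_preimage (by fun_prop) (Set.toFinite _).measurableSet

/-- The configuration with colour `b` exactly on `s`. -/
noncomputable def chi (b : Bool) {Λ : Finset Site} (s : Finset Λ) : Config :=
  open Classical in fun v => if ∃ h : v ∈ Λ, (⟨v, h⟩ : Λ) ∈ s then b else !b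

/-- The cylinder of `chi b s`. -/
def cyl (b : Bool) {Λ : Finset Site} (s : Finset Λ) : Set Config :=
  {ω | ∀ v ∈ Λ, ω v = chi b s v}

theorem chi_mem (b : Bool) {Λ : Finset Site} (s : Finset Λ) (v : Λ) :
    chi b s v = b ↔ v ∈ s := by
  cases b <;> simp [chi]

theorem det_cyl (b : Bool) {Λ : Finset Site} (s : Finset Λ) : Det Λ (cyl b s) :=
  fun _ _ h hω v hv => (h v hv).symm.trans (hω v hv)

theorem cyl_disjoint (b : Bool) {Λ : Finset Site} {s t : Finset Λ} (h : s ≠ t) :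
    Disjoint (cyl b s) (cyl b t) := by
  rw [Set.disjoint_left]
  intro ω h1 h2
  apply h
  ext v
  rw [← chi_mem b s, ← chi_mem b t, ← h1 v v.2, ← h2 v v.2]

open Classical in
theorem exists_cyl (b : Bool) (Λ : Finset Site) (ω : Config) : ∃ s : Finset Λ, ω ∈ cyl b s := by
  refine ⟨Finset.univ.filter fun v : Λ => ω v = b, fun v hv => ?_⟩
  by_cases h : ω v = b
  · rw [h]; exact ((chi_mem b _ ⟨v, hv⟩).2 (by simpa using h)).symm
  · have := (chi_mem b (Finset.univ.filter fun v : Λ => ω v = b) ⟨v, hv⟩).not.2 (by simpa using h)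
    revert h this
    generalize ω v = x, chi b _ _ = y
    revert x y b
    decide

open Classical in
/-- The finite sets of colour-`b` sites realizing `E`. -/
noncomputable def fam (b : Bool) (Λ : Finset Site) (E : Set Config) : Finset (Finset Λ) :=
  Finset.univ.filter fun s => chi b s ∈ E

theorem Det.eq_biUnion {Λ : Finset Site} {E : Set Config} (h : Det Λ E) (b : Bool) :
    E = ⋃ s ∈ fam b Λ E, cyl b s := by
  ext ω
  simp only [fam, Finset.mem_filter, Finset.mem_univ, true_and, Set.mem_iUnion, exists_prop]
  constructor
  · intro hω
    obtain ⟨s, hs⟩ := exists_cyl b Λ ω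
    exact ⟨s, h _ _ hs hω, hs⟩
  · rintro ⟨s, h1, h2⟩
    exact h _ _ (fun v hv => (h2 v hv).symm) h1

theorem Det.real_inter {Λ : Finset Site} {E F : Set Config} (h : Det Λ E) (b : Bool)
    (hF : MeasurableSet F) (μ : Measure Config) [IsProbabilityMeasure μ] :
    μ.real (E ∩ F) = ∑ s ∈ fam b Λ E, μ.real (cyl b s ∩ F) := by
  conv_lhs => rw [h.eq_biUnion b, Set.iUnion₂_inter]
  refine measureReal_biUnion_finset ?_ ?_
  · intro s _ t _ hst
    exact (cyl_disjoint b hst).mono Set.inter_subset_left Set.inter_subset_left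
  · exact fun s _ => ((det_cyl b s).measurableSet Λ.finite_toSet).inter hF


theorem real_cylinder (hμ : IsBernoulliHalf μ) (S : Finset Site) (f : Site → Bool) :
    μ.real {ω | ∀ v ∈ S, ω v = f v} = (1 / 2) ^ S.card := by
  rw [Measure.real, hμ.2 S f]
  simp

theorem real_eq_card (hμ : IsBernoulliHalf μ) {Λ : Finset Site} {E : Set Config} (h : Det Λ E)
    (b : Bool) : μ.real E = (fam b Λ E).card * (1 / 2) ^ Λ.card := by
  have := hμ.1
  have h1 := h.real_inter b MeasurableSet.univ μ
  rw [Set.inter_univ] at h1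
  rw [h1, ← nsmul_eq_mul, ← Finset.sum_const]
  exact Finset.sum_congr rfl fun s _ => by
    rw [Set.inter_univ]; exact real_cylinder hμ Λ (chi b s)

theorem real_congr {μ' : Measure Config} (hμ : IsBernoulliHalf μ) (hμ' : IsBernoulliHalf μ')
    {A : Set Site} (hA : A.Finite) {E : Set Config} (h : Det A E) : μ.real E = μ'.real E := by
  have h' : Det hA.toFinset E := h.mono (by simp)
  rw [real_eq_card hμ h' true, real_eq_card hμ' h' true]

theorem real_indep (hμ : IsBernoulliHalf μ) {A B : Set Site} (hA : A.Finite) (hB : B.Finite)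
    (hAB : Disjoint A B) {E F : Set Config} (hE : Det A E) (hF : Det B F) :
    μ.real (E ∩ F) = μ.real E * μ.real F := by
  classical
  have := hμ.1
  have hE' : Det hA.toFinset E := hE.mono (by simp)
  have hF' : Det hB.toFinset F := hF.mono (by simp)
  have hd : Disjoint hA.toFinset hB.toFinset := by simpa using hAB
  rw [hE'.real_inter true (hF.measurableSet hB), real_eq_card hμ hE' true, mul_assoc,
    ← nsmul_eq_mul, ← Finset.sum_const]
  refine Finset.sum_congr rfl fun s _ => ?_
  rw [Set.inter_comm, hF'.real_inter true ((det_cyl true s).measurableSet (Finset.finite_toSet _)),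
    real_eq_card hμ hF' true, mul_left_comm, ← pow_add, ← Finset.card_union_of_disjoint hd,
    ← nsmul_eq_mul, ← Finset.sum_const]
  refine Finset.sum_congr rfl fun t _ => ?_
  rw [← real_cylinder hμ _ fun v => if v ∈ hA.toFinset then chi true s v else chi true t v]
  congr 1
  ext ω
  constructor
  · rintro ⟨h1, h2⟩ v hv
    by_cases hvA : v ∈ hA.toFinset
    · simp only [hvA, if_true]; exact h2 v hvA
    · simp only [hvA, if_false]; exact h1 v ((Finset.mem_union.1 hv).resolve_left hvA)
  · intro h
    refine ⟨fun v hv => ?_, fun v hv => ?_⟩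
    · have := h v (Finset.mem_union_right _ hv)
      simpa only [Finset.disjoint_right.1 hd hv, if_false] using this
    · have := h v (Finset.mem_union_left _ hv)
      simpa only [hv, if_true] using this

/-- The configuration seen through a lattice symmetry, possibly with colours exchanged. -/
def recolor (flip : Bool) (τ : Site ≃ Site) (ω : Config) : Config := fun v => flip ^^ ω (τ v)

theorem isBernoulliHalf_map (hμ : IsBernoulliHalf μ) (flip : Bool) (τ : Site ≃ Site) :
    IsBernoulliHalf (μ.map (recolor flip τ)) := by
  classical
  have := hμ.1
  have hmeas : Measurable (recolor flip τ) := by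
    refine measurable_pi_lambda _ fun v => ?_
    exact (measurable_of_countable fun x : Bool => flip ^^ x).comp (measurable_pi_apply (τ v))
  refine ⟨Measure.isProbabilityMeasure_map hmeas.aemeasurable, fun S f => ?_⟩
  rw [Measure.map_apply hmeas]
  · rw [← Finset.card_map (f := τ.toEmbedding), ← hμ.2 _ fun v => flip ^^ f (τ.symm v)]
    congr 1
    ext ω
    simp only [recolor, Set.preimage_ofPred_eq, Set.mem_ofPred_eq, Finset.mem_map_equiv]
    constructor
    · intro h v hv
      have := h _ hv
      rw [← this]
      simp
    · intro h v hv
      have := h (τ v) (by simpa using hv)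
      rw [this]
      simp
  · refine Det.measurableSet (A := S) ?_ S.finite_toSet
    exact fun _ _ h hω v hv => (h v hv).symm.trans (hω v hv)

theorem real_recolor (hμ : IsBernoulliHalf μ) (flip : Bool) (τ : Site ≃ Site) {A : Set Site}
    (hA : A.Finite) {E : Set Config} (h : Det A E) :
    μ.real (recolor flip τ ⁻¹' E) = μ.real E := by
  have hmeas : Measurable (recolor flip τ) := by
    refine measurable_pi_lambda _ fun v => ?_
    exact (measurable_of_countable fun x : Bool => flip ^^ x).comp (measurable_pi_apply (τ v))
  rw [← real_congr (isBernoulliHalf_map hμ flip τ) hμ hA h,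
    map_measureReal_apply hmeas (h.measurableSet hA)]

/-- `E` is preserved when the set of colour-`b` sites shrinks. -/
def Av (b : Bool) (E : Set Config) : Prop :=
  ∀ ω ω' : Config, Col b ω' ⊆ Col b ω → ω ∈ E → ω' ∈ E

theorem Av.inter {b : Bool} {E F : Set Config} (h : Av b E) (h' : Av b F) : Av b (E ∩ F) :=
  fun ω ω' e hω => ⟨h ω ω' e hω.1, h' ω ω' e hω.2⟩

/-- The Harris inequality. -/
theorem harris (hμ : IsBernoulliHalf μ) {A : Set Site} (hA : A.Finite) {b : Bool} {E F : Set Config}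
    (hE : Det A E) (hF : Det A F) (hE' : Av b E) (hF' : Av b F) :
    μ.real E * μ.real F ≤ μ.real (E ∩ F) := by
  classical
  have h1 : Det hA.toFinset E := hE.mono (by simp)
  have h2 : Det hA.toFinset F := hF.mono (by simp)
  rw [real_eq_card hμ h1 b, real_eq_card hμ h2 b, real_eq_card hμ (h1.inter h2) b]
  have hlow : ∀ G : Set Config, Av b G → IsLowerSet (fam b hA.toFinset G : Set (Finset hA.toFinset)) := by
    intro G hG s t hts hs
    simp only [fam, Finset.coe_filter, Finset.mem_univ, true_and, Set.mem_ofPred_eq] at hs ⊢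
    refine hG _ _ (fun v hv => ?_) hs
    simp only [Col, Set.mem_ofPred_eq, chi] at hv ⊢
    split_ifs at hv with h
    · obtain ⟨h, h'⟩ := h
      rw [if_pos ⟨h, hts h'⟩]
    · cases b <;> simp at hv
  have key := (hlow E hE').le_card_inter_finset (hlow F hF')
  have hinter : fam b hA.toFinset E ∩ fam b hA.toFinset F = fam b hA.toFinset (E ∩ F) := by
    ext s; simp [fam]
  rw [hinter, Fintype.card_coe] at key
  have key' : ((fam b hA.toFinset E).card : ℝ) * (fam b hA.toFinset F).card ≤
      2 ^ hA.toFinset.card * (fam b hA.toFinset (E ∩ F)).card := by exact_mod_cast key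
  have hp : (0 : ℝ) < (1 / 2) ^ hA.toFinset.card := by positivity
  have hq : (2 : ℝ) ^ hA.toFinset.card * (1 / 2) ^ hA.toFinset.card = 1 := by
    rw [← mul_pow]; norm_num
  calc _ = ((fam b hA.toFinset E).card : ℝ) * (fam b hA.toFinset F).card *
        ((1 / 2) ^ hA.toFinset.card * (1 / 2) ^ hA.toFinset.card) := by ring
    _ ≤ 2 ^ hA.toFinset.card * (fam b hA.toFinset (E ∩ F)).card *
        ((1 / 2) ^ hA.toFinset.card * (1 / 2) ^ hA.toFinset.card) := by gcongr
    _ = (2 ^ hA.toFinset.card * (1 / 2) ^ hA.toFinset.card) *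
        ((fam b hA.toFinset (E ∩ F)).card * (1 / 2) ^ hA.toFinset.card) := by ring
    _ = _ := by rw [hq, one_mul]

/-- The colour-`b` sites of `D` connected to `T` by colour-`b` walks in `D`. -/
def cluster (D T : Set Site) (b : Bool) (ω : Config) : Set Site :=
  {v | ∃ t ∈ T, Conn (D ∩ Col b ω) t v}

/-- The sites explored when the cluster of `T` in `D` turns out to be `c`. -/
def explored (D T c : Set Site) : Set Site := {v ∈ D | v ∈ T ∨ v ∈ c ∨ ∃ u ∈ c, Adj u v}

theorem explored_subset (D T c : Set Site) : explored D T c ⊆ D := fun _ h => h.1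

theorem cluster_subset (D T : Set Site) (b : Bool) (ω : Config) :
    cluster D T b ω ⊆ D ∩ Col b ω := fun _ ⟨_, _, h⟩ => h.right

theorem cluster_subset_explored (D T : Set Site) (b : Bool) (ω : Config) :
    cluster D T b ω ⊆ explored D T (cluster D T b ω) :=
  fun _ h => ⟨(cluster_subset D T b ω h).1, Or.inr (Or.inl h)⟩

theorem mem_cluster_of_conn {D T : Set Site} {b : Bool} {ω : Config} {u v : Site}
    (hu : u ∈ cluster D T b ω) (h : Conn (D ∩ Col b ω) u v) : v ∈ cluster D T b ω := by
  obtain ⟨t, ht, h'⟩ := hu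
  exact ⟨t, ht, h'.trans h⟩

theorem mem_cluster_of_adj {D T : Set Site} {b : Bool} {ω : Config} {u v : Site}
    (hu : u ∈ cluster D T b ω) (huv : Adj u v) (hv : v ∈ D) (hv' : ω v = b) :
    v ∈ cluster D T b ω :=
  mem_cluster_of_conn hu (Conn.single (cluster_subset _ _ _ _ hu) ⟨hv, hv'⟩ huv)

theorem cluster_conn {D T : Set Site} {b : Bool} {ω : Config} {v : Site}
    (hv : v ∈ cluster D T b ω) : ∃ t ∈ T, Conn (cluster D T b ω) t v := by
  obtain ⟨t, ht, h⟩ := hv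
  refine ⟨t, ht, (h.restrict (cluster D T b ω) ⟨t, ht, Conn.refl h.left⟩ ?_).mono
    Set.inter_subset_right⟩
  intro u w hu _ hw huw
  exact mem_cluster_of_adj hu huw hw.1 hw.2

/-- Explored sites outside the cluster have the other colour. -/
theorem color_of_explored {D T : Set Site} {b : Bool} {ω : Config} {v : Site}
    (hv : v ∈ explored D T (cluster D T b ω)) (hv' : v ∉ cluster D T b ω) : ω v ≠ b := by
  obtain ⟨hD, hT | hc | ⟨u, hu, huv⟩⟩ := hv
  · exact fun h => hv' ⟨v, hT, Conn.refl ⟨hD, h⟩⟩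
  · exact absurd hc hv'
  · exact fun h => hv' (mem_cluster_of_adj hu huv hD h)

theorem det_cluster_eq (D T : Set Site) (b : Bool) (c : Set Site) :
    Det (explored D T c) {ω | cluster D T b ω = c} := by
  rintro ω ω' h rfl
  apply Set.Subset.antisymm
  · rintro v ⟨t, ht, hv⟩
    induction hv using Conn.induction with
    | base h' =>
      refine ⟨t, ht, Conn.refl ⟨h'.1, ?_⟩⟩
      exact (h t ⟨h'.1, Or.inl ht⟩).trans h'.2
    | step u v hu hv huv ih =>
      refine mem_cluster_of_adj ih huv hv.1 ?_
      exact (h v ⟨hv.1, Or.inr (Or.inr ⟨u, ih, huv⟩)⟩).trans hv.2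
  · intro v hv
    obtain ⟨t, ht, h'⟩ := cluster_conn hv
    refine ⟨t, ht, h'.mono fun w hw => ?_⟩
    have hw' := cluster_subset D T b ω hw
    exact ⟨hw'.1, (h w (cluster_subset_explored D T b ω hw)).symm.trans hw'.2⟩

theorem real_explored (hμ : IsBernoulliHalf μ) {D T Λ : Set Site} (hD : D.Finite) (hΛ : Λ.Finite)
    (b : Bool) (E : Set Site → Set Config) (hE : ∀ c, Det (Λ \ explored D T c) (E c)) :
    μ.real {ω | ω ∈ E (cluster D T b ω)} =
      ∑ c ∈ hD.finite_subsets.toFinset, μ.real {ω | cluster D T b ω = c} * μ.real (E c) := by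
  have := hμ.1
  have hfin : ∀ c, (explored D T c).Finite := fun c => hD.subset (explored_subset D T c)
  have h1 : {ω | ω ∈ E (cluster D T b ω)} =
      ⋃ c ∈ hD.finite_subsets.toFinset, {ω | cluster D T b ω = c} ∩ E c := by
    ext ω
    simp only [Set.mem_ofPred_eq, Set.mem_iUnion, Set.mem_inter_iff, Set.Finite.mem_toFinset,
      exists_prop]
    constructor
    · exact fun h => ⟨_, (cluster_subset D T b ω).trans Set.inter_subset_left, rfl, h⟩
    · rintro ⟨c, -, rfl, h⟩
      exact h
  rw [h1, measureReal_biUnion_finset]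
  · refine Finset.sum_congr rfl fun c _ => ?_
    exact real_indep hμ (hfin c) hΛ.sdiff Set.disjoint_sdiff_right
      (det_cluster_eq D T b c) (hE c)
  · intro c _ c' _ hcc
    refine Set.disjoint_left.2 ?_
    rintro ω ⟨h, -⟩ ⟨h', -⟩
    exact hcc (h.symm.trans h')
  · exact fun c _ => ((det_cluster_eq D T b c).measurableSet (hfin c)).inter
      ((hE c).measurableSet hΛ.sdiff)

/-- Comparison of two events conditionally on an explored cluster. -/
theorem explore_le (hμ : IsBernoulliHalf μ) {D T Λ : Set Site} (hD : D.Finite) (hΛ : Λ.Finite)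
    (b : Bool) {E₁ E₂ : Set Site → Set Config} {q : ℝ}
    (h₁ : ∀ c, Det (Λ \ explored D T c) (E₁ c)) (h₂ : ∀ c, Det (Λ \ explored D T c) (E₂ c))
    (hq : ∀ c, q * μ.real (E₁ c) ≤ μ.real (E₂ c)) :
    q * μ.real {ω | ω ∈ E₁ (cluster D T b ω)} ≤ μ.real {ω | ω ∈ E₂ (cluster D T b ω)} := by
  rw [real_explored hμ hD hΛ b E₁ h₁, real_explored hμ hD hΛ b E₂ h₂, Finset.mul_sum]
  refine Finset.sum_le_sum fun c _ => ?_
  calc _ = μ.real {ω | cluster D T b ω = c} * (q * μ.real (E₁ c)) := by ring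
    _ ≤ _ := mul_le_mul_of_nonneg_left (hq c) measureReal_nonneg

theorem finite_rect (x₀ x₁ y₀ y₁ : ℤ) : (rect x₀ x₁ y₀ y₁).Finite := by
  refine ((Set.finite_Icc x₀ x₁).prod (Set.finite_Icc y₀ y₁)).subset ?_
  rintro v ⟨h1, h2, h3, h4⟩
  exact ⟨⟨h1, h2⟩, h3, h4⟩

theorem det_TB (x₀ x₁ y₀ y₁ : ℤ) (b : Bool) :
    Det (rect x₀ x₁ y₀ y₁) {ω | TB x₀ x₁ y₀ y₁ (Col b ω)} :=
  det_col _ b fun S => ∃ c d : Site, c.2 = y₁ ∧ d.2 = y₀ ∧ Conn S c d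

theorem det_LR (x₀ x₁ y₀ y₁ : ℤ) (b : Bool) :
    Det (rect x₀ x₁ y₀ y₁) {ω | LR x₀ x₁ y₀ y₁ (Col b ω)} :=
  det_col _ b fun S => ∃ c d : Site, c.1 = x₀ ∧ d.1 = x₁ ∧ Conn S c d

theorem col_compl (b : Bool) (ω : Config) : (Col b ω)ᶜ = Col (!b) ω := by
  ext v
  simp only [Col, Set.mem_compl_iff, Set.mem_ofPred_eq]
  generalize ω v = x
  revert x b
  decide

theorem av_not_col (b : Bool) (Q : Set Site → Prop) (hQ : ∀ S S', S ⊆ S' → Q S → Q S') :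
    Av b {ω | ¬ Q (Col b ω)} := fun _ _ h hω hω' => hω (hQ _ _ h hω')

theorem Conn.avoid_or_entry {S : Set Site} {a b : Site} (h : Conn S a b) (A : Set Site)
    (ha : a ∉ A) : Conn (S \ A) a b ∨ ∃ d, ∃ c ∈ A, Conn (S \ A) a d ∧ Adj d c ∧ c ∈ S := by
  induction h using Conn.induction with
  | base h => exact .inl (Conn.refl ⟨h, ha⟩)
  | step u v hu hv huv ih =>
    rcases ih with ih | ih
    · by_cases hvA : v ∈ A
      · exact .inr ⟨u, v, hvA, ih, huv, hv⟩
      · exact .inl (ih.tail ⟨hv, hvA⟩ huv)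
    · exact .inr ih

/-- The part of the horizontal strip of height `H` between two lines of slope `-2`. -/
def slab (H A B : ℤ) : Set Site :=
  {v | 0 ≤ v.2 ∧ v.2 ≤ H ∧ A ≤ 2 * v.1 + v.2 ∧ 2 * v.1 + v.2 ≤ B}

/-- `U` connects height `H` to height `0`. -/
def VC (H : ℤ) (U : Set Site) : Prop := ∃ a d : Site, a.2 = H ∧ d.2 = 0 ∧ Conn U a d

theorem VC.mono {H : ℤ} {U U' : Set Site} (h : U ⊆ U') : VC H U → VC H U' :=
  fun ⟨a, d, ha, hd, hc⟩ => ⟨a, d, ha, hd, hc.mono h⟩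

theorem finite_slab (H A B : ℤ) : (slab H A B).Finite := by
  refine (finite_rect (min A 0 - max H 0) (max B 0) 0 H).subset ?_
  rintro ⟨x, y⟩ ⟨h1, h2, h3, h4⟩
  simp only [rect, Set.mem_ofPred_eq] at *
  omega

/-- The reflection of the lattice fixing the line `2 * x + y = κ`. -/
def mirror (κ : ℤ) : Site ≃ Site where
  toFun v := (κ - v.1 - v.2, v.2)
  invFun v := (κ - v.1 - v.2, v.2)
  left_inv v := by ext <;> simp; ring
  right_inv v := by ext <;> simp; ring

theorem mirror_fst (κ : ℤ) (v : Site) : (mirror κ v).1 = κ - v.1 - v.2 := rfl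
theorem mirror_snd (κ : ℤ) (v : Site) : (mirror κ v).2 = v.2 := rfl
theorem mirror_mirror (κ : ℤ) (v : Site) : mirror κ (mirror κ v) = v := (mirror κ).left_inv v

theorem mirror_adj (κ : ℤ) (u v : Site) (h : Adj u v) : Adj (mirror κ u) (mirror κ v) := by
  rw [adj_iff] at *
  simp only [mirror_fst, mirror_snd]
  omega

/-- Reaching, from the right part of the top side, the mirror image of `s` through sites
of `s` and its mirror image removed. -/
def Reach (H κ W : ℤ) (s S : Set Site) : Prop :=
  ∃ t u w : Site, t.2 = H ∧ κ ≤ 2 * t.1 + t.2 ∧ mirror κ w ∈ s ∧ Adj u w ∧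
    Conn ((slab H (κ - W) (κ + W) \ (s ∪ mirror κ ⁻¹' s)) ∩ S) t u

theorem reach_disjoint {H κ W : ℤ} {s : Set Site} (hs : s ⊆ slab H (κ + 1) (κ + W))
    (hbot : ∀ v ∈ s, ∃ d : Site, d.2 = 0 ∧ Conn s v d) {ω : Config}
    (h : Reach H κ W s (Col false ω))
    (h' : Reach H κ W s (Col false (recolor true (mirror κ) ω))) : False := by
  obtain ⟨t, u, w, ht, htl, hw, huw, hc⟩ := h
  obtain ⟨t', u', w', ht', htl', hw', huw', hc'⟩ := h'
  set Fr := slab H (κ - W) (κ + W) \ (s ∪ mirror κ ⁻¹' s) with hFr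
  have hmF : ∀ v ∈ Fr, mirror κ v ∈ Fr := by
    rintro v ⟨hv, hv'⟩
    refine ⟨?_, ?_⟩
    · simp only [slab, Set.mem_ofPred_eq, mirror_fst, mirror_snd] at hv ⊢
      omega
    · simpa only [Set.mem_union, Set.mem_preimage, mirror_mirror, or_comm] using hv'
  have hopen : Conn (Fr ∩ Col true ω) (mirror κ t') (mirror κ u') := by
    refine hc'.image _ ?_ (mirror_adj κ)
    rintro v ⟨hv, hv'⟩
    refine ⟨hmF v hv, ?_⟩
    simpa [Col, recolor] using hv'
  obtain ⟨b, hb, hwb⟩ := hbot _ hw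
  obtain ⟨d, hd, hwd⟩ := hbot _ hw'
  have hwb' : Conn (mirror κ ⁻¹' s) w (mirror κ b) := by
    have := hwb.image (T := mirror κ ⁻¹' s) (mirror κ)
      (fun v hv => by simpa [mirror_mirror] using hv) (mirror_adj κ)
    rwa [mirror_mirror] at this
  have hS : Conn ((Fr ∩ Col false ω) ∪ mirror κ ⁻¹' s) t (mirror κ b) :=
    ((hc.mono Set.subset_union_left).tail (Or.inr hwb'.left) huw).trans
      (hwb'.mono Set.subset_union_right)
  have hT : Conn ((Fr ∩ Col true ω) ∪ s) (mirror κ t') d :=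
    ((hopen.mono Set.subset_union_left).tail (Or.inr hw') (mirror_adj κ _ _ huw')).trans
      (hwd.mono Set.subset_union_right)
  have hdisj : ∀ v ∈ (Fr ∩ Col false ω) ∪ mirror κ ⁻¹' s, v ∉ (Fr ∩ Col true ω) ∪ s := by
    rintro v (⟨hv, hv1⟩ | hv) (⟨hv', hv2⟩ | hv')
    · simp_all [Col]
    · exact hv.2 (Or.inl hv')
    · exact hv'.2 (Or.inr hv)
    · have h1 := hs hv'
      have h2 := hs hv
      simp only [slab, Set.mem_ofPred_eq, mirror_fst, mirror_snd] at h1 h2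
      omega
  have hrow : ∀ v : Site, v ∈ Fr ∨ v ∈ s ∨ mirror κ v ∈ s → 0 ≤ v.2 ∧ v.2 ≤ H := by
    rintro v (hv | hv | hv)
    · exact ⟨hv.1.1, hv.1.2.1⟩
    · exact ⟨(hs hv).1, (hs hv).2.1⟩
    · exact ⟨(hs hv).1, (hs hv).2.1⟩
  refine swapped_walks_meet hS hT hdisj ?_ ?_ ?_ ht (by rw [mirror_snd]; exact hb)
    (by rw [mirror_snd]; exact ht') hd ?_ ?_
  · exact (((finite_slab _ _ _).subset Set.sdiff_subset).subset Set.inter_subset_left).union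
      ((finite_slab _ _ _).subset hs)
  · rintro v (hv | hv)
    exacts [hrow v (.inl hv.1), hrow v (.inr (.inr hv))]
  · rintro v (hv | hv)
    exacts [hrow v (.inl hv.1), hrow v (.inr (.inl hv))]
  · have hne : mirror κ t' ≠ t := by
      intro e
      refine hdisj t (.inl hc.left) (.inl ?_)
      rw [← e]; exact hopen.left
    have : ¬ (mirror κ t').1 = t.1 := by
      intro e
      exact hne (Prod.ext e (by rw [mirror_snd, ht, ht']))
    rw [mirror_fst] at this ⊢
    omega
  · have h1 := hs hwb.right
    have h2 := hs hwd.right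
    simp only [slab, Set.mem_ofPred_eq] at h1 h2
    rw [mirror_fst]
    omega

theorem det_reach (H κ W : ℤ) (s : Set Site) :
    Det (slab H (κ - W) (κ + W) \ s) {ω | Reach H κ W s (Col false ω)} :=
  (det_col (slab H (κ - W) (κ + W) \ (s ∪ mirror κ ⁻¹' s)) false fun S =>
    ∃ t u w : Site, t.2 = H ∧ κ ≤ 2 * t.1 + t.2 ∧ mirror κ w ∈ s ∧ Adj u w ∧ Conn S t u).mono
    (Set.sdiff_subset_sdiff_right Set.subset_union_left)

theorem real_compl' (hμ : IsBernoulliHalf μ) {A : Set Site} (hA : A.Finite) {E : Set Config}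
    (hE : Det A E) : μ.real Eᶜ = 1 - μ.real E := by
  have := hμ.1
  exact probReal_compl_eq_one_sub (hE.measurableSet hA)

theorem real_reach_le (hμ : IsBernoulliHalf μ) {H κ W : ℤ} {s : Set Site}
    (hs : s ⊆ slab H (κ + 1) (κ + W)) (hbot : ∀ v ∈ s, ∃ d : Site, d.2 = 0 ∧ Conn s v d) :
    μ.real {ω | Reach H κ W s (Col false ω)} ≤ 1 / 2 := by
  have := hμ.1
  have hfin := (finite_slab H (κ - W) (κ + W)).subset (Set.sdiff_subset (t := s))
  have h1 := real_recolor hμ true (mirror κ) hfin (det_reach H κ W s)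
  have hm := (det_reach H κ W s).measurableSet hfin
  have h2 : recolor true (mirror κ) ⁻¹' {ω | Reach H κ W s (Col false ω)} ⊆
      {ω | Reach H κ W s (Col false ω)}ᶜ :=
    fun ω h' h => reach_disjoint hs hbot h h'
  have h3 := measureReal_mono (μ := μ) h2
  rw [real_compl' hμ hfin (det_reach H κ W s)] at h3
  linarith

/-- `S` connects the right half of the top side of the slab to the bottom side. -/
def HalfVC (H κ W : ℤ) (S : Set Site) : Prop :=
  ∃ a d : Site, a.2 = H ∧ d.2 = 0 ∧ κ ≤ 2 * a.1 + a.2 ∧ Conn (slab H (κ - W) (κ + W) ∩ S) a d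

theorem reach_of_halfVC {H κ W : ℤ} (hW : 2 ≤ W ∨ κ % 2 = 1) {ω : Config} {T : Set Site}
    (hT : T = {v | v.2 = 0}) {V : Set Site} (hV : V = cluster (slab H (κ + 1) (κ + W)) T false ω)
    (htop : ∀ v ∈ V, v.2 ≠ H) (h : HalfVC H κ W (Col false ω)) :
    Reach H κ W (explored (slab H (κ + 1) (κ + W)) T V) (Col false ω) := by
  obtain ⟨a, d, ha, hd, hal, hc⟩ := h
  set D := slab H (κ + 1) (κ + W) with hD
  set s := explored D T V with hs
  have hsV : ∀ v ∈ s, ω v = false → v ∈ V := by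
    intro v hv hv'
    by_contra h
    subst hV
    exact color_of_explored hv h hv'
  have hrow0 : ∀ v ∈ D, v.2 = 0 → v ∈ s := fun v hv hv0 => ⟨hv, .inl (by simpa [hT] using hv0)⟩
  have haA : a ∉ s ∪ mirror κ ⁻¹' s := by
    rintro (h | h)
    · exact htop a (hsV a h hc.left.2) ha
    · have := h.1
      simp only [hD, slab, Set.mem_ofPred_eq, mirror_fst, mirror_snd] at this
      omega
  rcases hc.avoid_or_entry _ haA with had | ⟨p, c, hcA, hap, hpc, hcS⟩
  · have h1 := had.right.1.1
    have h2 := had.right.2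
    have h3 : d.2 = 0 → 2 * d.1 + d.2 = κ := by
      intro hd0
      by_contra hne
      rcases lt_or_gt_of_ne hne with hlt | hlt
      · refine h2 (.inr (hrow0 _ ?_ (by rw [mirror_snd]; exact hd0)))
        simp only [hD, slab, Set.mem_ofPred_eq, mirror_fst, mirror_snd] at h1 ⊢
        omega
      · refine h2 (.inl (hrow0 _ ?_ hd0))
        simp only [hD, slab, Set.mem_ofPred_eq] at h1 ⊢
        omega
    refine ⟨a, d, (d.1 - 1, d.2), ha, hal, hrow0 _ ?_ hd, ?_,
      had.mono fun v hv => ⟨⟨hv.1.1, hv.2⟩, hv.1.2⟩⟩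
    · have := h3 hd
      simp only [hD, slab, Set.mem_ofPred_eq, mirror_fst, mirror_snd] at h1 ⊢
      omega
    · rw [adj_iff]; simp
  · have hap' : Conn ((slab H (κ - W) (κ + W) \ (s ∪ mirror κ ⁻¹' s)) ∩ Col false ω) a p :=
      hap.mono fun v hv => ⟨⟨hv.1.1, hv.2⟩, hv.1.2⟩
    rcases hcA with hcs | hcs
    · have hcV := hsV c hcs hcS.2
      have hpD : p ∉ D := fun h => hap.right.2 (.inl ⟨h, .inr (.inr ⟨c, hcV, hpc.symm⟩)⟩)
      have h1 := hap.right.1.1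
      have h2 := hcs.1
      have h3 := adj_iff.1 hpc
      have hpl : 2 * p.1 + p.2 ≤ κ := by
        by_contra h
        apply hpD
        simp only [hD, slab, Set.mem_ofPred_eq] at h1 h2 ⊢
        omega
      have hpl' : 2 * p.1 + p.2 = κ := by
        by_contra h
        apply hap.right.2
        right
        have : mirror κ p = c := by
          simp only [hD, slab, Set.mem_ofPred_eq] at h1 h2
          ext
          · rw [mirror_fst]; omega
          · rw [mirror_snd]; omega
        simpa [this] using hcs
      refine ⟨a, p, mirror κ c, ha, hal, by rwa [mirror_mirror], ?_, hap'⟩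
      have : p = mirror κ p := by
        ext
        · rw [mirror_fst]; omega
        · rw [mirror_snd]
      rw [this]
      exact mirror_adj κ _ _ hpc
    · exact ⟨a, p, c, ha, hal, hcs, hpc, hap'⟩

theorem explored_bottom {D T : Set Site} {b : Bool} {ω : Config} {V : Set Site}
    (hV : V = cluster D T b ω) {v : Site} (hv : v ∈ explored D T V) :
    ∃ d ∈ T, Conn (explored D T V) v d := by
  have hsub : V ⊆ explored D T V := by subst hV; exact cluster_subset_explored D T b ω
  have key : ∀ u ∈ V, ∃ d ∈ T, Conn (explored D T V) u d := by
    intro u hu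
    rw [hV] at hu
    obtain ⟨t, ht, hc⟩ := cluster_conn hu
    rw [← hV] at hc
    exact ⟨t, ht, (hc.mono hsub).symm⟩
  rcases hv.2 with h | h | ⟨u, hu, huv⟩
  · exact ⟨v, h, Conn.refl hv⟩
  · exact key v h
  · obtain ⟨d, hd, hc⟩ := key u hu
    exact ⟨d, hd, hc.head hv huv.symm⟩

theorem det_halfVC (H κ W : ℤ) (b : Bool) :
    Det (slab H (κ - W) (κ + W)) {ω | HalfVC H κ W (Col b ω)} :=
  det_col (slab H (κ - W) (κ + W)) b fun S =>
    ∃ a d : Site, a.2 = H ∧ d.2 = 0 ∧ κ ≤ 2 * a.1 + a.2 ∧ Conn S a d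

theorem det_VC (H : ℤ) (D : Set Site) (b : Bool) : Det D {ω | VC H (D ∩ Col b ω)} :=
  det_col D b fun S => VC H S

theorem real_not_halfVC (hμ : IsBernoulliHalf μ) {H κ W : ℤ}
    (hW : 2 ≤ W ∨ κ % 2 = 1) :
    1 / 2 * μ.real {ω | ¬ VC H (slab H κ (κ + W) ∩ Col false ω)} ≤
      μ.real {ω | ¬ HalfVC H κ W (Col false ω)} := by
  classical
  have := hμ.1
  set D := slab H (κ + 1) (κ + W) with hD
  set Λ := slab H (κ - W) (κ + W) with hΛ
  set T : Set Site := {v ∈ D | v.2 = 0} with hT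
  have hT' : ∀ V, explored D T V = explored D {v : Site | v.2 = 0} V := by
    intro V
    ext v
    simp only [explored, hT, Set.mem_ofPred_eq]
    tauto
  set good : Set Site → Prop := fun c => (∀ v ∈ c, v.2 ≠ H) ∧ ∃ ω, c = cluster D T false ω with hg
  have key := explore_le (T := T) hμ (finite_slab H (κ + 1) (κ + W)) (finite_slab H (κ - W) (κ + W))
    false (q := 1 / 2) (E₁ := fun c => if good c then Set.univ else ∅)
    (E₂ := fun c => if good c then {ω | ¬ Reach H κ W (explored D T c) (Col false ω)} else ∅)
    (by intro c; split_ifs <;> intro _ _ _ h <;> simp_all)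
    (by
      intro c
      split_ifs
      · exact (det_reach H κ W _).compl
      · exact det_empty _)
    (by
      intro c
      split_ifs with hc
      · obtain ⟨-, ω, hω⟩ := hc
        have h1 := real_reach_le (W := W) (κ := κ) (H := H) hμ (explored_subset D T c)
          (fun v hv => by
            obtain ⟨d, hd, h⟩ := explored_bottom hω hv
            exact ⟨d, hd.2, h⟩)
        have h2 := real_compl' hμ ((finite_slab H (κ - W) (κ + W)).subset Set.sdiff_subset)
          (det_reach H κ W (explored D T c))
        change _ ≤ μ.real {ω | Reach H κ W (explored D T c) (Col false ω)}ᶜ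
        rw [h2]
        simp
        linarith
      · simp)
  refine le_trans (mul_le_mul_of_nonneg_left (measureReal_mono ?_) (by norm_num))
    (key.trans (measureReal_mono ?_))
  · intro ω hω
    have : good (cluster D T false ω) := by
      refine ⟨fun v hv hvH => hω ?_, ω, rfl⟩
      obtain ⟨t, ht, hc⟩ := cluster_conn hv
      refine ⟨v, t, hvH, ht.2, (hc.mono ?_).symm⟩
      refine (cluster_subset _ _ _ _).trans (Set.inter_subset_inter_left _ ?_)
      rintro w ⟨h1, h2, h3, h4⟩
      exact ⟨h1, h2, by omega, h4⟩
    rw [Set.mem_ofPred_eq, if_pos this]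
    trivial
  · intro ω hω hVC
    simp only [Set.mem_ofPred_eq] at hω
    split_ifs at hω with hc
    · apply hω
      have hcl : cluster D T false ω = cluster D {v : Site | v.2 = 0} false ω := by
        ext v
        simp only [cluster, Set.mem_ofPred_eq]
        constructor
        · rintro ⟨t, ht, h⟩; exact ⟨t, ht.2, h⟩
        · rintro ⟨t, ht, h⟩; exact ⟨t, ⟨h.left.1, ht⟩, h⟩
      rw [hT']
      exact reach_of_halfVC hW rfl hcl hc.1 hVC
    · exact hω

theorem real_not_VC_double (hμ : IsBernoulliHalf μ) {H κ W : ℤ}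
    (hW : 2 ≤ W ∨ κ % 2 = 1) {q : ℝ} (hq : 0 ≤ q)
    (h : q ≤ μ.real {ω | ¬ VC H (slab H κ (κ + W) ∩ Col false ω)}) :
    (q / 2) ^ 2 ≤ μ.real {ω | ¬ VC H (slab H (κ - W) (κ + W) ∩ Col false ω)} := by
  have := hμ.1
  have hfin := finite_slab H (κ - W) (κ + W)
  have hdet : Det (slab H (κ - W) (κ + W)) {ω | ¬ HalfVC H κ W (Col false ω)} :=
    (det_halfVC H κ W false).compl
  have h1 := real_not_halfVC hμ (H := H) hW (μ := μ)
  have h2 := real_recolor hμ false (mirror κ) hfin hdet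
  have hmem : ∀ v, v ∈ slab H (κ - W) (κ + W) → mirror κ v ∈ slab H (κ - W) (κ + W) := by
    intro v hv
    simp only [slab, Set.mem_ofPred_eq, mirror_fst, mirror_snd] at hv ⊢
    omega
  have hdet' : Det (slab H (κ - W) (κ + W))
      (recolor false (mirror κ) ⁻¹' {ω | ¬ HalfVC H κ W (Col false ω)}) := by
    intro ω ω' e hω
    refine hdet _ _ (fun v hv => ?_) hω
    simp only [recolor, e _ (hmem v hv)]
  have hav : Av false {ω | ¬ HalfVC H κ W (Col false ω)} :=
    av_not_col false _ fun S S' hS ⟨a, d, h1, h2, h3, h4⟩ =>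
      ⟨a, d, h1, h2, h3, h4.mono (Set.inter_subset_inter_right _ hS)⟩
  have hav' : Av false (recolor false (mirror κ) ⁻¹' {ω | ¬ HalfVC H κ W (Col false ω)}) := by
    intro ω ω' e hω
    refine hav _ _ ?_ hω
    intro v hv
    have := @e (mirror κ v)
    simp only [Col, recolor, Set.mem_ofPred_eq, Bool.false_xor] at this hv ⊢
    exact this hv
  have h3 := harris hμ hfin hdet hdet' hav hav'
  rw [h2] at h3
  refine le_trans ?_ (h3.trans (measureReal_mono ?_))
  · have : q / 2 ≤ μ.real {ω | ¬ HalfVC H κ W (Col false ω)} := by linarith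
    nlinarith
  · rintro ω ⟨hω, hω'⟩ ⟨a, d, ha, hd, hc⟩
    rcases le_total κ (2 * a.1 + a.2) with hl | hl
    · exact hω ⟨a, d, ha, hd, hl, hc⟩
    · refine hω' ⟨mirror κ a, mirror κ d, ha, hd, ?_, ?_⟩
      · rw [mirror_fst, mirror_snd]; omega
      · refine hc.image _ (fun v hv => ⟨hmem v hv.1, ?_⟩) (mirror_adj κ)
        simpa [Col, recolor, mirror_mirror] using hv.2

/-- Exchange of the two coordinates. -/
def swapSite : Site ≃ Site := Equiv.prodComm ℤ ℤ

theorem swapSite_adj (u v : Site) (h : Adj u v) : Adj (swapSite u) (swapSite v) := by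
  rw [adj_iff] at *
  simp only [swapSite, Equiv.prodComm_apply, Prod.fst_swap, Prod.snd_swap]
  omega

theorem TB.swap {x₀ x₁ y₀ y₁ : ℤ} {O : Set Site} (h : TB x₀ x₁ y₀ y₁ O) :
    LR y₀ y₁ x₀ x₁ (swapSite ⁻¹' O) := by
  obtain ⟨c, d, hc, hd, h⟩ := h
  refine ⟨swapSite d, swapSite c, hd, hc, h.symm.image _ ?_ swapSite_adj⟩
  rintro v ⟨⟨h1, h2, h3, h4⟩, hv⟩
  exact ⟨⟨h3, h4, h1, h2⟩, hv⟩

theorem LR.swap {x₀ x₁ y₀ y₁ : ℤ} {O : Set Site} (h : LR x₀ x₁ y₀ y₁ O) :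
    TB y₀ y₁ x₀ x₁ (swapSite ⁻¹' O) := by
  obtain ⟨c, d, hc, hd, h⟩ := h
  refine ⟨swapSite d, swapSite c, hd, hc, h.symm.image _ ?_ swapSite_adj⟩
  rintro v ⟨⟨h1, h2, h3, h4⟩, hv⟩
  exact ⟨⟨h3, h4, h1, h2⟩, hv⟩

theorem col_recolor (b flip : Bool) (τ : Site ≃ Site) (ω : Config) :
    Col b (recolor flip τ ω) = τ ⁻¹' Col (flip ^^ b) ω := by
  ext v
  simp only [Col, recolor, Set.mem_ofPred_eq, Set.mem_preimage]
  cases flip <;> cases b <;> simp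

theorem swap_swap_preimage (O : Set Site) : swapSite ⁻¹' (swapSite ⁻¹' O) = O := by
  ext v; simp [swapSite]

theorem real_TB_swap (hμ : IsBernoulliHalf μ) (x₀ x₁ y₀ y₁ : ℤ) (b b' : Bool) :
    μ.real {ω | TB x₀ x₁ y₀ y₁ (Col b ω)} = μ.real {ω | LR y₀ y₁ x₀ x₁ (Col b' ω)} := by
  rw [← real_recolor hμ (b ^^ b') swapSite (finite_rect _ _ _ _) (det_TB x₀ x₁ y₀ y₁ b)]
  congr 1
  ext ω
  have hb : ((b ^^ b') ^^ b) = b' := by cases b <;> cases b' <;> rfl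
  simp only [Set.mem_preimage, Set.mem_ofPred_eq, col_recolor, hb]
  constructor
  · intro h
    have := h.swap
    rwa [swap_swap_preimage] at this
  · exact fun h => h.swap

theorem real_TB_square (hμ : IsBernoulliHalf μ) (H : ℤ) (b : Bool) :
    μ.real {ω | TB 0 H 0 H (Col b ω)} ≤ 1 / 2 := by
  have := hμ.1
  have h1 := real_TB_swap hμ 0 H 0 H b (!b)
  have h2 := real_compl' hμ (finite_rect _ _ _ _) (det_TB 0 H 0 H b)
  have h3 : μ.real {ω | LR 0 H 0 H (Col (!b) ω)} ≤ μ.real {ω | TB 0 H 0 H (Col b ω)}ᶜ := by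
    refine measureReal_mono ?_
    intro ω h h'
    refine LR.not_TB h h' fun v hv hv' => ?_
    simp only [Col, Set.mem_ofPred_eq] at hv hv'
    simp [hv'] at hv
  linarith

theorem real_not_VC_slab (hμ : IsBernoulliHalf μ) {H : ℤ} (hH : 1 ≤ H) :
    (2 : ℝ)⁻¹ ^ 22 ≤ μ.real {ω | ¬ VC H (slab H (-6 * H) (2 * H) ∩ Col false ω)} := by
  have := hμ.1
  have h0 : (2 : ℝ)⁻¹ ≤ μ.real {ω | ¬ VC H (slab H H (H + H) ∩ Col false ω)} := by
    have h1 := real_TB_square hμ H false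
    have h2 := real_compl' hμ (finite_rect _ _ _ _) (det_TB 0 H 0 H false)
    have h3 : μ.real {ω | TB 0 H 0 H (Col false ω)}ᶜ ≤
        μ.real {ω | ¬ VC H (slab H H (H + H) ∩ Col false ω)} := by
      refine measureReal_mono fun ω h h' => h ?_
      obtain ⟨a, d, ha, hd, hc⟩ := h'
      refine hc.toTB (by omega) ha.ge hd.le ?_
      rintro v ⟨⟨hv1, hv2, hv3, hv4⟩, hv⟩ - -
      exact ⟨by omega, by omega, hv⟩
    norm_num at h1 ⊢
    linarith
  have h1 := real_not_VC_double hμ (H := H) (by omega) (by norm_num) h0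
  have e1 : slab H (H - H) (H + H) = slab H 0 (0 + 2 * H) := by congr 1 <;> ring
  rw [e1] at h1
  have h2 := real_not_VC_double hμ (H := H) (by omega) (by norm_num) h1
  have e2 : slab H (0 - 2 * H) (0 + 2 * H) = slab H (-2 * H) (-2 * H + 4 * H) := by
    congr 1 <;> ring
  rw [e2] at h2
  have h3 := real_not_VC_double hμ (H := H) (by omega) (by norm_num) h2
  have e3 : slab H (-2 * H - 4 * H) (-2 * H + 4 * H) = slab H (-6 * H) (2 * H) := by
    congr 1 <;> ring
  rw [e3] at h3
  refine le_trans (le_of_eq ?_) h3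
  norm_num

/-- Translation of the lattice. -/
def shift (z : Site) : Site ≃ Site := Equiv.addRight z

theorem shift_fst (z v : Site) : (shift z v).1 = v.1 + z.1 := rfl
theorem shift_snd (z v : Site) : (shift z v).2 = v.2 + z.2 := rfl

theorem shift_adj (z u v : Site) (h : Adj u v) : Adj (shift z u) (shift z v) := by
  rw [adj_iff] at *
  simp only [shift_fst, shift_snd]
  omega

/-- Rectangles of bounded aspect ratio have no vertical crossing of a given colour
with probability bounded below. -/
theorem rsw_TB (hμ : IsBernoulliHalf μ) {x₀ x₁ y₀ y₁ : ℤ} (hy : 1 ≤ y₁ - y₀)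
    (hx : x₁ - x₀ ≤ 3 * (y₁ - y₀)) (b : Bool) :
    (2 : ℝ)⁻¹ ^ 22 ≤ μ.real {ω | ¬ TB x₀ x₁ y₀ y₁ (Col b ω)} := by
  have := hμ.1
  set H := y₁ - y₀ with hH
  have h1 := real_not_VC_slab hμ hy
  have hdet : Det (slab H (-6 * H) (2 * H))
      {ω | ¬ VC H (slab H (-6 * H) (2 * H) ∩ Col false ω)} := (det_VC H _ false).compl
  rw [← real_recolor hμ b (shift (x₀ + 3 * H, y₀)) (finite_slab H (-6 * H) (2 * H)) hdet] at h1
  refine h1.trans (measureReal_mono ?_)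
  rintro ω hω ⟨c, d, hc, hd, h⟩
  refine hω ⟨shift (-(x₀ + 3 * H), -y₀) c, shift (-(x₀ + 3 * H), -y₀) d, ?_, ?_,
    h.image _ ?_ (shift_adj _)⟩
  · rw [shift_snd]; simp only; omega
  · rw [shift_snd]; simp only; omega
  · rintro v ⟨⟨hv1, hv2, hv3, hv4⟩, hv⟩
    refine ⟨?_, ?_⟩
    · simp only [slab, Set.mem_ofPred_eq, shift_fst, shift_snd]
      omega
    · have hvv : shift (x₀ + 3 * H, y₀) (shift (-(x₀ + 3 * H), -y₀) v) = v := by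
        ext
        · simp only [shift_fst]; omega
        · simp only [shift_snd]; omega
      have hv' : ω v = b := hv
      simp only [Col, recolor, Set.mem_ofPred_eq, hvv, hv', Bool.xor_self]

theorem rsw_LR (hμ : IsBernoulliHalf μ) {x₀ x₁ y₀ y₁ : ℤ} (hx : 1 ≤ x₁ - x₀)
    (hy : y₁ - y₀ ≤ 3 * (x₁ - x₀)) (b : Bool) :
    (2 : ℝ)⁻¹ ^ 22 ≤ μ.real {ω | ¬ LR x₀ x₁ y₀ y₁ (Col b ω)} := by
  have h1 := rsw_TB hμ hx hy b
  have h2 := real_compl' hμ (finite_rect _ _ _ _) (det_TB y₀ y₁ x₀ x₁ b)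
  have h3 := real_compl' hμ (finite_rect _ _ _ _) (det_LR x₀ x₁ y₀ y₁ b)
  have h4 := real_TB_swap hμ y₀ y₁ x₀ x₁ b b
  change _ ≤ μ.real {ω | TB y₀ y₁ x₀ x₁ (Col b ω)}ᶜ at h1
  change _ ≤ μ.real {ω | LR x₀ x₁ y₀ y₁ (Col b ω)}ᶜ
  rw [h2] at h1
  rw [h3]
  linarith

/-- The `ℓ∞` distance between `z` and `v`. -/
def dst (z v : Site) : ℤ := max |v.1 - z.1| |v.2 - z.2|

theorem dst_le_iff {z v : Site} {r : ℤ} : dst z v ≤ r ↔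
    z.1 - r ≤ v.1 ∧ v.1 ≤ z.1 + r ∧ z.2 - r ≤ v.2 ∧ v.2 ≤ z.2 + r := by
  simp only [dst, max_le_iff, abs_le]
  omega

theorem dst_adj (z u v : Site) (h : Adj u v) : dst z u ≤ dst z v + 1 := by
  rw [dst_le_iff]
  have := (dst_le_iff (z := z) (v := v)).1 le_rfl
  rw [adj_iff] at h
  omega

/-- `U` contains an arm crossing the annulus of radii `r` and `R` around `z`. -/
def Arm (z : Site) (r R : ℤ) (U : Set Site) : Prop :=
  ∃ a b : Site, dst z a = R ∧ dst z b = r + 1 ∧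
    Conn ({v | r + 1 ≤ dst z v ∧ dst z v ≤ R} ∩ U) a b

theorem Arm.mono {z : Site} {r R : ℤ} {U U' : Set Site} (hU : U ⊆ U') :
    Arm z r R U → Arm z r R U' :=
  fun ⟨a, b, ha, hb, h⟩ => ⟨a, b, ha, hb, h.mono (Set.inter_subset_inter_right _ hU)⟩

theorem Conn.arm {U V : Set Site} {a b z : Site} {r R : ℤ} (h : Conn U a b) (hr : r < R)
    (ha : dst z a ≤ r + 1) (hb : R ≤ dst z b) (hU : ∀ v ∈ U, r < dst z v → dst z v ≤ R → v ∈ V) :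
    Arm z r R V := by
  obtain ⟨c, d, hc, hd, h, -⟩ := h.symm.window (dst z) (dst_adj z) hb ha (by omega)
  exact ⟨c, d, hc, hd, h.mono fun v hv => ⟨hv.2, hU v hv.1 (by have := hv.2.1; omega) hv.2.2⟩⟩

theorem Arm.crosses {z : Site} {r R : ℤ} {U : Set Site} (hr : r < R) (h : Arm z r R U) :
    (LR (z.1 + (r + 1)) (z.1 + R) (z.2 - R) (z.2 + R) U ∨
      LR (z.1 - R) (z.1 - (r + 1)) (z.2 - R) (z.2 + R) U) ∨
    TB (z.1 - R) (z.1 + R) (z.2 + (r + 1)) (z.2 + R) U ∨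
      TB (z.1 - R) (z.1 + R) (z.2 - R) (z.2 - (r + 1)) U := by
  obtain ⟨a, b, ha, hb, h⟩ := h
  have hb' := dst_le_iff.1 hb.le
  have hin : ∀ v ∈ {v | r + 1 ≤ dst z v ∧ dst z v ≤ R} ∩ U,
      (z.1 - R ≤ v.1 ∧ v.1 ≤ z.1 + R ∧ z.2 - R ≤ v.2 ∧ v.2 ≤ z.2 + R) ∧ v ∈ U :=
    fun v hv => ⟨dst_le_iff.1 hv.1.2, hv.2⟩
  have ha' := (hin a h.left).1
  have ha'' : ¬ dst z a ≤ R - 1 := by omega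
  rw [dst_le_iff] at ha''
  have hcases : z.1 + R ≤ a.1 ∨ a.1 ≤ z.1 - R ∨ z.2 + R ≤ a.2 ∨ a.2 ≤ z.2 - R := by omega
  rcases hcases with h1 | h1 | h1 | h1
  · refine .inl (.inl (h.symm.toLR (by omega) (by omega) h1 fun v hv _ _ => ?_))
    exact ⟨(hin v hv).1.2.2.1, (hin v hv).1.2.2.2, (hin v hv).2⟩
  · refine .inl (.inr (h.toLR (by omega) h1 (by omega) fun v hv _ _ => ?_))
    exact ⟨(hin v hv).1.2.2.1, (hin v hv).1.2.2.2, (hin v hv).2⟩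
  · refine .inr (.inl (h.toTB (by omega) h1 (by omega) fun v hv _ _ => ?_))
    exact ⟨(hin v hv).1.1, (hin v hv).1.2.1, (hin v hv).2⟩
  · refine .inr (.inr (h.symm.toTB (by omega) (by omega) h1 fun v hv _ _ => ?_))
    exact ⟨(hin v hv).1.1, (hin v hv).1.2.1, (hin v hv).2⟩

theorem finite_ball (z : Site) (r : ℤ) : {v | dst z v ≤ r}.Finite :=
  (finite_rect (z.1 - r) (z.1 + r) (z.2 - r) (z.2 + r)).subset fun _ hv => dst_le_iff.1 hv

theorem det_not_arm (z : Site) (r R : ℤ) (s : Set Site) (b : Bool) :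
    Det ({v | dst z v ≤ R} \ s) {ω | ¬ Arm z r R (Col b ω \ s)} := by
  have h := (det_col ({v | r + 1 ≤ dst z v ∧ dst z v ≤ R} \ s) b fun S =>
    ∃ a b : Site, dst z a = R ∧ dst z b = r + 1 ∧ Conn S a b).compl
  refine Det.mono (A := {v | r + 1 ≤ dst z v ∧ dst z v ≤ R} \ s) ?_ fun v hv => ⟨hv.1.2, hv.2⟩
  convert h using 1
  ext ω
  simp only [Arm, Set.mem_ofPred_eq, Set.mem_compl_iff, ← Set.inter_sdiff_assoc,
    Set.sdiff_inter_right_comm]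

theorem av_not_arm (z : Site) (r R : ℤ) (s : Set Site) (b : Bool) :
    Av b {ω | ¬ Arm z r R (Col b ω \ s)} :=
  av_not_col b (fun S => Arm z r R (S \ s)) fun _ _ h => Arm.mono (Set.sdiff_subset_sdiff_left h)

/-- A lower bound for the probability that an annulus is blocked. -/
noncomputable def c₀ : ℝ := 2⁻¹ ^ 88

theorem c₀_pos : 0 < c₀ := by unfold c₀; positivity

theorem real_not_arm (hμ : IsBernoulliHalf μ) (z : Site) {r R : ℤ} (hr : 1 ≤ r) (hR : R = 6 * r)
    (s : Set Site) (b : Bool) : c₀ ≤ μ.real {ω | ¬ Arm z r R (Col b ω \ s)} := by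
  have := hμ.1
  set Λ := rect (z.1 - R) (z.1 + R) (z.2 - R) (z.2 + R) with hΛ
  have hfin : Λ.Finite := finite_rect _ _ _ _
  have hLR : ∀ x₀ x₁ y₀ y₁ : ℤ, Av b {ω | ¬ LR x₀ x₁ y₀ y₁ (Col b ω)} := fun _ _ _ _ =>
    av_not_col b _ fun _ _ h => LR.mono h
  have hTB : ∀ x₀ x₁ y₀ y₁ : ℤ, Av b {ω | ¬ TB x₀ x₁ y₀ y₁ (Col b ω)} := fun _ _ _ _ =>
    av_not_col b _ fun _ _ h => TB.mono h
  have hsub : ∀ x₀ x₁ y₀ y₁ : ℤ, z.1 - R ≤ x₀ → x₁ ≤ z.1 + R → z.2 - R ≤ y₀ → y₁ ≤ z.2 + R →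
      rect x₀ x₁ y₀ y₁ ⊆ Λ := by
    rintro x₀ x₁ y₀ y₁ h1 h2 h3 h4 v ⟨h5, h6, h7, h8⟩
    exact ⟨by omega, by omega, by omega, by omega⟩
  have d1 : Det Λ {ω | ¬ LR (z.1 + (r + 1)) (z.1 + R) (z.2 - R) (z.2 + R) (Col b ω)} :=
    ((det_LR _ _ _ _ b).compl).mono (hsub _ _ _ _ (by omega) (by omega) (by omega) (by omega))
  have d2 : Det Λ {ω | ¬ LR (z.1 - R) (z.1 - (r + 1)) (z.2 - R) (z.2 + R) (Col b ω)} :=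
    ((det_LR _ _ _ _ b).compl).mono (hsub _ _ _ _ (by omega) (by omega) (by omega) (by omega))
  have d3 : Det Λ {ω | ¬ TB (z.1 - R) (z.1 + R) (z.2 + (r + 1)) (z.2 + R) (Col b ω)} :=
    ((det_TB _ _ _ _ b).compl).mono (hsub _ _ _ _ (by omega) (by omega) (by omega) (by omega))
  have d4 : Det Λ {ω | ¬ TB (z.1 - R) (z.1 + R) (z.2 - R) (z.2 - (r + 1)) (Col b ω)} :=
    ((det_TB _ _ _ _ b).compl).mono (hsub _ _ _ _ (by omega) (by omega) (by omega) (by omega))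
  have p1 := rsw_LR hμ (x₀ := z.1 + (r + 1)) (x₁ := z.1 + R) (y₀ := z.2 - R) (y₁ := z.2 + R)
    (by omega) (by omega) b
  have p2 := rsw_LR hμ (x₀ := z.1 - R) (x₁ := z.1 - (r + 1)) (y₀ := z.2 - R) (y₁ := z.2 + R)
    (by omega) (by omega) b
  have p3 := rsw_TB hμ (x₀ := z.1 - R) (x₁ := z.1 + R) (y₀ := z.2 + (r + 1)) (y₁ := z.2 + R)
    (by omega) (by omega) b
  have p4 := rsw_TB hμ (x₀ := z.1 - R) (x₁ := z.1 + R) (y₀ := z.2 - R) (y₁ := z.2 - (r + 1))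
    (by omega) (by omega) b
  have q1 := harris hμ hfin d1 d2 (hLR _ _ _ _) (hLR _ _ _ _)
  have q2 := harris hμ hfin d3 d4 (hTB _ _ _ _) (hTB _ _ _ _)
  have q3 := harris hμ hfin (d1.inter d2) (d3.inter d4) ((hLR _ _ _ _).inter (hLR _ _ _ _))
    ((hTB _ _ _ _).inter (hTB _ _ _ _))
  have hδ : (0 : ℝ) ≤ 2⁻¹ ^ 22 := by positivity
  have q1' := (mul_le_mul p1 p2 hδ measureReal_nonneg).trans q1
  have q2' := (mul_le_mul p3 p4 hδ measureReal_nonneg).trans q2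
  have q3' := (mul_le_mul q1' q2' (by positivity) measureReal_nonneg).trans q3
  calc c₀ = 2⁻¹ ^ 22 * 2⁻¹ ^ 22 * (2⁻¹ ^ 22 * 2⁻¹ ^ 22) := by unfold c₀; norm_num
    _ ≤ _ := q3'
    _ ≤ _ := by
      refine measureReal_mono ?_
      rintro ω ⟨⟨h1, h2⟩, h3, h4⟩ h
      rcases (h.mono Set.sdiff_subset).crosses (by omega) with (h | h) | (h | h)
      exacts [h1 h, h2 h, h3 h, h4 h]

/-- Comparison of sums of probabilities from a pointwise comparison of counts. -/
theorem sum_real_le [IsProbabilityMeasure μ] {ι κ : Type} (s : Finset ι) (t : Finset κ)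
    (E : ι → Set Config) (G : κ → Set Config) (c : ℝ) (hE : ∀ i ∈ s, MeasurableSet (E i))
    (hG : ∀ j ∈ t, MeasurableSet (G j))
    (h : ∀ ω, ∑ i ∈ s, (E i).indicator (1 : Config → ℝ) ω ≤
      c * ∑ j ∈ t, (G j).indicator (1 : Config → ℝ) ω) :
    ∑ i ∈ s, μ.real (E i) ≤ c * ∑ j ∈ t, μ.real (G j) := by
  have key : ∀ {α : Type} (s : Finset α) (E : α → Set Config), (∀ i ∈ s, MeasurableSet (E i)) →
      Integrable (fun ω => ∑ i ∈ s, (E i).indicator (1 : Config → ℝ) ω) μ ∧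
      ∫ ω, ∑ i ∈ s, (E i).indicator (1 : Config → ℝ) ω ∂μ = ∑ i ∈ s, μ.real (E i) := by
    intro α s E hE
    have hi : ∀ i ∈ s, Integrable ((E i).indicator (1 : Config → ℝ)) μ := fun i hi =>
      (integrable_const (1 : ℝ)).indicator (hE i hi)
    refine ⟨integrable_finsetSum s hi, ?_⟩
    rw [integral_finsetSum s hi]
    exact Finset.sum_congr rfl fun i hi => integral_indicator_one (hE i hi)
  rw [← (key s E hE).2, ← (key t G hG).2, ← integral_const_mul]
  exact integral_mono (key s E hE).1 ((key t G hG).1.const_mul c) h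

/-- There are `i` sites of `ts`, pairwise not connected, that are connected to height `y`. -/
def Many (D : Set Site) (y : ℤ) (ts : Finset Site) (i : ℕ) (U : Set Site) : Prop :=
  ∃ P ⊆ ts, P.card = i ∧ (∀ p ∈ P, ∃ d : Site, d.2 = y ∧ Conn (D ∩ U) p d) ∧
    ∀ p ∈ P, ∀ q ∈ P, p ≠ q → ¬ Conn (D ∩ U) p q

theorem det_many (D : Set Site) (y : ℤ) (ts : Finset Site) (i : ℕ) (b : Bool) :
    Det D {ω | Many D y ts i (Col b ω)} :=
  det_col D b fun S => ∃ P ⊆ ts, P.card = i ∧ (∀ p ∈ P, ∃ d : Site, d.2 = y ∧ Conn S p d) ∧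
    ∀ p ∈ P, ∀ q ∈ P, p ≠ q → ¬ Conn S p q

theorem many_one_iff {D : Set Site} {y : ℤ} {ts : Finset Site} {U : Set Site} :
    Many D y ts 1 U ↔ ∃ p ∈ ts, ∃ d : Site, d.2 = y ∧ Conn (D ∩ U) p d := by
  constructor
  · rintro ⟨P, hP, hc, h, -⟩
    obtain ⟨p, rfl⟩ := Finset.card_eq_one.1 hc
    exact ⟨p, hP (by simp), h p (by simp)⟩
  · rintro ⟨p, hp, h⟩
    refine ⟨{p}, by simpa using hp, by simp, by simpa using h, ?_⟩
    intro p hp q hq hpq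
    simp_all

/-- A closed walk started off the explored cluster stays off it. -/
theorem Conn.diff_explored {D T : Set Site} {b : Bool} {ω : Config} {p q : Site}
    (h : Conn (D ∩ Col b ω) p q) (hp : p ∉ cluster D T b ω) :
    Conn ((D \ explored D T (cluster D T b ω)) ∩ Col b ω) p q := by
  have hoff : ∀ v ∈ D ∩ Col b ω, v ∉ cluster D T b ω → v ∉ explored D T (cluster D T b ω) :=
    fun v hv hv' hve => color_of_explored hve hv' hv.2
  have := h.restrict (cluster D T b ω)ᶜ hp (fun u v hu hu' hv huv hv' =>
    hu (mem_cluster_of_adj hv' huv.symm hu'.1 hu'.2))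
  exact this.mono fun v hv => ⟨⟨hv.1.1, hoff v hv.1 hv.2⟩, hv.1.2⟩

theorem many_explore {D : Set Site} {y : ℤ} {ts : Finset Site} {t : Site} {i : ℕ} {b : Bool}
    {ω : Config} (h : Many D y (insert t ts) (i + 1) (Col b ω)) :
    ((∃ d ∈ cluster D {t} b ω, d.2 = y) ∧
        Many (D \ explored D {t} (cluster D {t} b ω)) y ts i (Col b ω)) ∨
      Many (D \ explored D {t} (cluster D {t} b ω)) y ts (i + 1) (Col b ω) := by
  classical
  obtain ⟨P, hP, hcard, hd, hpq⟩ := h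
  set V := cluster D {t} b ω with hV
  have hsub : (D \ explored D {t} V) ∩ Col b ω ⊆ D ∩ Col b ω := fun v hv => ⟨hv.1.1, hv.2⟩
  have htV : ∀ p ∈ P, p ∉ V → p ∈ ts := by
    intro p hp hpV
    rcases Finset.mem_insert.1 (hP hp) with rfl | h
    · obtain ⟨d, -, hc⟩ := hd p hp
      exact absurd ⟨p, rfl, Conn.refl hc.left⟩ hpV
    · exact h
  by_cases hex : ∃ p ∈ P, p ∈ V
  · obtain ⟨p₀, hp₀, hp₀V⟩ := hex
    left
    constructor
    · obtain ⟨d, hdy, hc⟩ := hd p₀ hp₀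
      exact ⟨d, mem_cluster_of_conn hp₀V hc, hdy⟩
    · have hnot : ∀ p ∈ P.erase p₀, p ∉ V := by
        intro p hp hpV
        rw [Finset.mem_erase] at hp
        obtain ⟨t₁, ht₁, h₁⟩ := hp₀V
        obtain ⟨t₂, ht₂, h₂⟩ := hpV
        rw [Set.mem_singleton_iff] at ht₁ ht₂
        subst ht₁ ht₂
        exact hpq p hp.2 p₀ hp₀ hp.1 (h₂.symm.trans h₁)
      refine ⟨P.erase p₀, fun p hp => htV p (Finset.mem_of_mem_erase hp) (hnot p hp), ?_, ?_, ?_⟩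
      · rw [Finset.card_erase_of_mem hp₀, hcard]; rfl
      · intro p hp
        obtain ⟨d, hdy, hc⟩ := hd p (Finset.mem_of_mem_erase hp)
        exact ⟨d, hdy, hc.diff_explored (hnot p hp)⟩
      · intro p hp q hq hne hc
        exact hpq p (Finset.mem_of_mem_erase hp) q (Finset.mem_of_mem_erase hq) hne (hc.mono hsub)
  · push Not at hex
    right
    refine ⟨P, fun p hp => htV p hp (hex p hp), hcard, ?_, ?_⟩
    · intro p hp
      obtain ⟨d, hdy, hc⟩ := hd p hp
      exact ⟨d, hdy, hc.diff_explored (hex p hp)⟩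
    · intro p hp q hq hne hc
      exact hpq p hp q hq hne (hc.mono hsub)

theorem Many.pred {D : Set Site} {y : ℤ} {ts : Finset Site} {i : ℕ} {U : Set Site}
    (h : Many D y ts (i + 1) U) : Many D y ts i U := by
  classical
  obtain ⟨P, hP, hcard, hd, hpq⟩ := h
  obtain ⟨p, hp⟩ : P.Nonempty := by rw [← Finset.card_pos]; omega
  exact ⟨P.erase p, (Finset.erase_subset _ _).trans hP,
    by rw [Finset.card_erase_of_mem hp, hcard]; rfl,
    fun q hq => hd q (Finset.mem_of_mem_erase hq),
    fun q hq q' hq' => hpq q (Finset.mem_of_mem_erase hq) q' (Finset.mem_of_mem_erase hq')⟩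

theorem real_many_le_one (hμ : IsBernoulliHalf μ) {K : Set Site} (hK : K.Finite) {y : ℤ} {p : ℝ}
    (hp : 0 < p) (top : Finset Site)
    (hp1 : μ.real {ω | Many K y top 1 (Col false ω)} ≤ p) (ts : Finset Site) (hts : ts ⊆ top) :
    ∀ (i : ℕ) (D : Set Site), D ⊆ K → μ.real {ω | Many D y ts (i + 1) (Col false ω)} ≤
      p ^ i * μ.real {ω | Many D y ts 1 (Col false ω)} := by
  classical
  have := hμ.1
  have hone : ∀ (ts : Finset Site) (D : Set Site), ts ⊆ top → D ⊆ K →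
      μ.real {ω | Many D y ts 1 (Col false ω)} ≤ p := by
    intro ts D hts hD
    refine (measureReal_mono ?_).trans hp1
    intro ω h
    rw [Set.mem_ofPred_eq, many_one_iff] at h ⊢
    obtain ⟨t, ht, d, hd, h⟩ := h
    exact ⟨t, hts ht, d, hd, h.mono (Set.inter_subset_inter_left _ hD)⟩
  induction ts using Finset.induction_on with
  | empty =>
    intro i D hD
    have : {ω | Many D y ∅ (i + 1) (Col false ω)} = ∅ := by
      ext ω
      simp only [Set.mem_ofPred_eq, Set.mem_empty_iff_false, iff_false]
      rintro ⟨P, hP, hcard, -⟩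
      rw [Finset.subset_empty.1 hP] at hcard
      simp at hcard
    rw [this]
    simp only [measureReal_empty]
    positivity
  | insert t ts htts ih =>
    intro i D hD
    have hts' : ts ⊆ top := (Finset.subset_insert _ _).trans hts
    have ih := ih hts'
    have hDf := hK.subset hD
    have key := explore_le (T := {t}) hμ hDf hDf false (q := (p ^ i)⁻¹)
      (E₁ := fun c => if ∃ d ∈ c, d.2 = y then {ω | Many (D \ explored D {t} c) y ts i (Col false ω)}
        else {ω | Many (D \ explored D {t} c) y ts (i + 1) (Col false ω)})
      (E₂ := fun c => if ∃ d ∈ c, d.2 = y then Set.univ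
        else {ω | Many (D \ explored D {t} c) y ts 1 (Col false ω)})
      (by intro c; split_ifs <;> exact det_many _ _ _ _ _)
      (by
        intro c
        split_ifs
        · exact fun _ _ _ _ => trivial
        · exact det_many _ _ _ _ _)
      (by
        intro c
        rw [inv_mul_le_iff₀ (by positivity)]
        split_ifs
        · rw [probReal_univ, mul_one]
          rcases i with _ | j
          · simp
          · refine (ih j _ (Set.sdiff_subset.trans hD)).trans ?_
            rw [pow_succ]
            exact mul_le_mul_of_nonneg_left (hone _ _ hts' (Set.sdiff_subset.trans hD))
              (by positivity)
        · exact ih i _ (Set.sdiff_subset.trans hD))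
    rw [inv_mul_le_iff₀ (by positivity)] at key
    refine (measureReal_mono ?_).trans (key.trans (mul_le_mul_of_nonneg_left
      (measureReal_mono ?_) (by positivity)))
    · intro ω h
      rcases many_explore h with ⟨h1, h2⟩ | h2
      · rw [Set.mem_ofPred_eq, if_pos h1]
        exact h2
      · rw [Set.mem_ofPred_eq]
        split_ifs with h1
        · exact h2.pred
        · exact h2
    · intro ω h
      rw [Set.mem_ofPred_eq] at h
      rw [Set.mem_ofPred_eq, many_one_iff]
      split_ifs at h with h1
      · obtain ⟨d, ⟨t', ht', hc⟩, hdy⟩ := h1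
        rw [Set.mem_singleton_iff] at ht'
        subst ht'
        exact ⟨t', Finset.mem_insert_self _ _, d, hdy, hc⟩
      · rw [Set.mem_ofPred_eq, many_one_iff] at h
        obtain ⟨t', ht', d, hd, h⟩ := h
        exact ⟨t', Finset.mem_insert_of_mem ht', d, hd,
          h.mono (Set.inter_subset_inter_left _ Set.sdiff_subset)⟩

theorem real_many_le (hμ : IsBernoulliHalf μ) {K : Set Site} (hK : K.Finite) {y : ℤ} {p : ℝ}
    (hp : 0 < p) (top : Finset Site) (hp1 : μ.real {ω | Many K y top 1 (Col false ω)} ≤ p)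
    (i : ℕ) : μ.real {ω | Many K y top (i + 1) (Col false ω)} ≤ p ^ (i + 1) := by
  rw [pow_succ]
  exact (real_many_le_one hμ hK hp top hp1 top subset_rfl i K subset_rfl).trans
    (mul_le_mul_of_nonneg_left hp1 (by positivity))

/-- The rows `[y, y']` of a box of half-width `n` have an open horizontal crossing, but the rows
`[y + M, y']` do not. -/
def FE (n y M y' : ℤ) : Set Config :=
  {ω | ¬ TB (-n) n y y' (Col false ω) ∧ TB (-n) n (y + M) y' (Col false ω)}

theorem det_FE (n y M y' : ℤ) : Det (rect (-n) n y y' ∪ rect (-n) n (y + M) y') (FE n y M y') :=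
  ((det_TB _ _ _ _ false).compl.mono Set.subset_union_left).inter
    ((det_TB _ _ _ _ false).mono Set.subset_union_right)

theorem finite_FE (n y M y' : ℤ) : (rect (-n) n y y' ∪ rect (-n) n (y + M) y').Finite :=
  (finite_rect _ _ _ _).union (finite_rect _ _ _ _)

theorem TB.translate {x₀ x₁ y₀ y₁ : ℤ} {O : Set Site} (h : TB x₀ x₁ y₀ y₁ O) (k : ℤ) :
    TB x₀ x₁ (y₀ + k) (y₁ + k) (shift (0, -k) ⁻¹' O) := by
  obtain ⟨c, d, hc, hd, h⟩ := h
  refine ⟨shift (0, k) c, shift (0, k) d, by rw [shift_snd, hc], by rw [shift_snd, hd],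
    h.image _ ?_ (shift_adj _)⟩
  rintro v ⟨⟨h1, h2, h3, h4⟩, hv⟩
  refine ⟨?_, ?_⟩
  · simp only [rect, Set.mem_ofPred_eq, shift_fst, shift_snd]
    omega
  · have : shift (0, -k) (shift (0, k) v) = v := by
      ext
      · simp only [shift_fst]; omega
      · simp only [shift_snd]; omega
    rw [Set.mem_preimage, this]
    exact hv

theorem tb_recolor_shift {x₀ x₁ y₀ y₁ k : ℤ} {b : Bool} {ω : Config} :
    TB x₀ x₁ y₀ y₁ (Col b (recolor false (shift (0, k)) ω)) ↔
      TB x₀ x₁ (y₀ + k) (y₁ + k) (Col b ω) := by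
  rw [col_recolor, Bool.false_xor]
  constructor
  · intro h
    refine (h.translate k).mono fun v hv => ?_
    have : shift (0, k) (shift (0, -k) v) = v := by
      ext
      · simp only [shift_fst]; omega
      · simp only [shift_snd]; omega
    rw [Set.mem_preimage, Set.mem_preimage, this] at hv
    exact hv
  · intro h
    have := h.translate (-k)
    simpa using this

theorem real_FE_shift (hμ : IsBernoulliHalf μ) (n y M y' k : ℤ) :
    μ.real (FE n (y + k) M (y' + k)) = μ.real (FE n y M y') := by
  rw [← real_recolor hμ false (shift (0, k)) (finite_FE n y M y') (det_FE n y M y')]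
  congr 1
  ext ω
  simp only [FE, Set.mem_preimage, Set.mem_ofPred_eq, tb_recolor_shift, add_right_comm]

/-- Successive windows without crossing contribute clusters that are not connected
to each other. -/
theorem many_of_windows {n M H : ℤ} {J : ℕ} (hM : 1 ≤ M) (hJ : J * M ≤ H) {ω : Config}
    {top : Finset Site} (htop : ∀ v : Site, -n ≤ v.1 → v.1 ≤ n → v.2 = H → v ∈ top)
    (A : Finset ℕ) (hA : ∀ j ∈ A, j < J ∧ ω ∈ FE n (j * M) M (j * M + H)) :
    Many (rect (-n) n (J * M) H) (J * M) top A.card (Col false ω) := by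
  classical
  have hrep : ∀ j ∈ A, ∃ t : Site, t ∈ top ∧ (∃ d : Site, d.2 = J * M ∧
      Conn (rect (-n) n (J * M) H ∩ Col false ω) t d) ∧
      (∃ c : Site, c.2 = j * M + H ∧
        Conn (rect (-n) n ((j + 1) * M) (j * M + H) ∩ Col false ω) c t) ∧
      (∃ e : Site, e.2 = (j + 1) * M ∧
        Conn (rect (-n) n ((j + 1) * M) (j * M + H) ∩ Col false ω) t e) := by
    intro j hj
    obtain ⟨hjJ, -, c, d, hc, hd, h⟩ := hA j hj
    have e : (j : ℤ) * M + M = (j + 1) * M := by ring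
    rw [e] at hd h
    have hjM : ((j : ℤ) + 1) * M ≤ J * M := by
      have : (j : ℤ) + 1 ≤ J := by exact_mod_cast hjJ
      exact mul_le_mul_of_nonneg_right this (by omega)
    have hj0 : 0 ≤ (j : ℤ) * M := by positivity
    obtain ⟨c', d', hc', hd', h1, h2⟩ := h.window (fun v => v.2)
      (fun u v huv => by rw [adj_iff] at huv; omega) (lo := J * M) (hi := H) (by omega)
      (by omega) hJ
    have hr := h1.left.1.1
    refine ⟨c', htop _ hr.1 hr.2.1 hc', ⟨d', hd', h1.mono ?_⟩, ⟨c, hc, h2⟩,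
      ⟨d, hd, h2.symm.trans h⟩⟩
    rintro v ⟨⟨⟨hv1, hv2, hv3, hv4⟩, hv⟩, hv5, hv6⟩
    exact ⟨⟨hv1, hv2, hv5, hv6⟩, hv⟩
  choose! t ht htd htc hte using hrep
  have hsep : ∀ j ∈ A, ∀ j' ∈ A, j < j' →
      ¬ Conn (rect (-n) n (J * M) H ∩ Col false ω) (t j) (t j') := by
    intro j hj j' hj' hlt hc
    obtain ⟨c, hcy, h1⟩ := htc j' hj'
    obtain ⟨e, hey, h2⟩ := hte j hj
    have hjj : ((j : ℤ) + 1) * M ≤ j' * M := by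
      have : (j : ℤ) + 1 ≤ j' := by exact_mod_cast hlt
      exact mul_le_mul_of_nonneg_right this (by omega)
    have hj0 : 0 ≤ (j' : ℤ) * M := by positivity
    have hcols : ∀ y y' : ℤ, rect (-n) n y y' ∩ Col false ω ⊆
        {v | -n ≤ v.1 ∧ v.1 ≤ n ∧ v ∈ Col false ω} := fun y y' v hv => ⟨hv.1.1, hv.1.2.1, hv.2⟩
    have h3 := ((h1.mono (hcols _ _)).trans (hc.symm.mono (hcols _ _))).trans (h2.mono (hcols _ _))
    refine (hA j' hj').2.1 (h3.toTB ?_ hcy.ge (by omega) fun v hv _ _ => hv)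
    have : (j' : ℤ) * M + M ≤ J * M := by
      have : (j' : ℤ) + 1 ≤ J := by exact_mod_cast (hA j' hj').1
      nlinarith
    omega
  have hinj : ∀ j ∈ A, ∀ j' ∈ A, t j = t j' → j = j' := by
    intro j hj j' hj' e
    by_contra hne
    obtain ⟨d, -, hd⟩ := htd j hj
    rcases lt_or_gt_of_ne hne with h | h
    · exact hsep j hj j' hj' h (e ▸ Conn.refl hd.left)
    · exact hsep j' hj' j hj h (e ▸ Conn.refl hd.left)
  refine ⟨A.image t, ?_, Finset.card_image_of_injOn hinj, ?_, ?_⟩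
  · intro p hp
    obtain ⟨j, hj, rfl⟩ := Finset.mem_image.1 hp
    exact ht j hj
  · intro p hp
    obtain ⟨j, hj, rfl⟩ := Finset.mem_image.1 hp
    exact htd j hj
  · intro p hp q hq hpq
    obtain ⟨j, hj, rfl⟩ := Finset.mem_image.1 hp
    obtain ⟨j', hj', rfl⟩ := Finset.mem_image.1 hq
    rcases lt_trichotomy j j' with h | h | h
    · exact hsep j hj j' hj' h
    · exact absurd (congrArg t h) hpq
    · exact fun hc => hsep j' hj' j hj h hc.symm

theorem sum_pow_le {p : ℝ} (hp : 0 ≤ p) (hp1 : p < 1) (J : ℕ) :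
    ∑ i ∈ Finset.range J, p ^ (i + 1) ≤ (1 - p)⁻¹ := by
  have h1 : ∑ i ∈ Finset.range J, p ^ (i + 1) ≤ ∑ i ∈ Finset.range J, p ^ i :=
    Finset.sum_le_sum fun i _ => pow_le_pow_of_le_one hp hp1.le (by omega)
  refine h1.trans ?_
  rw [← one_div, le_div_iff₀ (by linarith), geom_sum_mul_neg]
  have : 0 ≤ p ^ J := by positivity
  linarith

theorem real_FE_le (hμ : IsBernoulliHalf μ) {n y M y' : ℤ} (hn : 1 ≤ n) (hM : 1 ≤ M)
    (hy : 2 * n ≤ y' - y) : μ.real (FE n y M y') ≤ 2 ^ 23 * (M / n) := by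
  classical
  have := hμ.1
  have hnR : (1 : ℝ) ≤ n := by exact_mod_cast hn
  have hMR : (1 : ℝ) ≤ M := by exact_mod_cast hM
  rcases lt_or_ge n M with hlt | hle
  · have h1 : (n : ℝ) ≤ M := by exact_mod_cast hlt.le
    have h2 : (1 : ℝ) ≤ M / n := by rw [le_div_iff₀ (by linarith)]; linarith
    calc _ ≤ (1 : ℝ) := measureReal_le_one
      _ ≤ _ := by nlinarith
  set H := y' - y with hH
  have hshift : ∀ k : ℤ, μ.real (FE n k M (k + H)) = μ.real (FE n y M y') := by
    intro k
    rw [← real_FE_shift hμ n y M y' (k - y)]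
    congr 2 <;> omega
  obtain ⟨J, hJ⟩ : ∃ J : ℕ, (J : ℤ) = n / M := ⟨(n / M).toNat, by
    rw [Int.toNat_of_nonneg]; exact Int.ediv_nonneg (by omega) (by omega)⟩
  have hJn : J * M ≤ n := by rw [hJ]; exact Int.ediv_mul_le n (by omega)
  have hJn' : n < (J + 1) * M := by rw [hJ]; exact Int.lt_ediv_add_one_mul_self n (by omega)
  set K := rect (-n) n (J * M) H with hK
  set top := (finite_rect (-n) n H H).toFinset with htop
  have hp1 : μ.real {ω | Many K (J * M) top 1 (Col false ω)} ≤ 1 - 2⁻¹ ^ 22 := by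
    have h1 := rsw_TB hμ (x₀ := -n) (x₁ := n) (y₀ := J * M) (y₁ := H) (by omega) (by omega) false
    have h2 := real_compl' hμ (finite_rect _ _ _ _) (det_TB (-n) n (J * M) H false)
    change _ ≤ μ.real {ω | TB (-n) n (J * M) H (Col false ω)}ᶜ at h1
    rw [h2] at h1
    have h3 : μ.real {ω | Many K (J * M) top 1 (Col false ω)} ≤
        μ.real {ω | TB (-n) n (J * M) H (Col false ω)} := by
      refine measureReal_mono fun ω h => ?_
      rw [Set.mem_ofPred_eq, many_one_iff] at h
      obtain ⟨p, hp, d, hd, hc⟩ := h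
      refine ⟨p, d, ?_, hd, hc⟩
      have hp' := (Set.Finite.mem_toFinset _).1 hp
      exact le_antisymm hp'.2.2.2 hp'.2.2.1
    linarith
  have hmany := real_many_le hμ (finite_rect _ _ _ _) (by norm_num) top hp1
  have hsum := sum_real_le (μ := μ) (Finset.range J) (Finset.range J)
    (fun j => FE n (j * M) M (j * M + H)) (fun i => {ω | Many K (J * M) top (i + 1) (Col false ω)})
    1 (fun j _ => (det_FE _ _ _ _).measurableSet (finite_FE _ _ _ _))
    (fun i _ => (det_many _ _ _ _ _).measurableSet (finite_rect _ _ _ _)) (by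
      intro ω
      simp only [Set.indicator_apply, Pi.one_apply, one_mul, Finset.sum_boole, Nat.cast_le]
      set A := (Finset.range J).filter fun j : ℕ => ω ∈ FE n (j * M) M (j * M + H) with hA
      have hcard : A.card ≤ J := (Finset.card_filter_le _ _).trans (by simp)
      have hsub : Finset.range A.card ⊆ (Finset.range J).filter
          fun i => ω ∈ {ω | Many K (J * M) top (i + 1) (Col false ω)} := by
        intro i hi
        rw [Finset.mem_range] at hi
        obtain ⟨B, hB, hBc⟩ := Finset.exists_subset_card_eq (show i + 1 ≤ A.card from hi)
        rw [Finset.mem_filter, Finset.mem_range]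
        refine ⟨by omega, ?_⟩
        rw [Set.mem_ofPred_eq, ← hBc]
        refine many_of_windows hM (by omega) ?_ B ?_
        · intro v h1 h2 h3
          exact (Set.Finite.mem_toFinset _).2 ⟨h1, h2, h3.ge, h3.le⟩
        · intro j hj
          have := hB hj
          rwa [hA, Finset.mem_filter, Finset.mem_range] at this
      simpa using Finset.card_le_card hsub)
  rw [one_mul] at hsum
  have hbound := hsum.trans ((Finset.sum_le_sum fun i _ => hmany i).trans
      (sum_pow_le (by norm_num) (by norm_num) J))
  simp only [hshift, Finset.sum_const, Finset.card_range, nsmul_eq_mul] at hbound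
  have e : (1 - (1 - (2 : ℝ)⁻¹ ^ 22))⁻¹ = 2 ^ 22 := by norm_num
  rw [e] at hbound
  have hJ1 : (1 : ℝ) ≤ J := by
    have : (0 : ℤ) < J := by rw [hJ]; exact lt_of_lt_of_le Int.one_pos (Int.le_ediv_of_mul_le (by omega) (by omega))
    exact_mod_cast this
  have hJR : (n : ℝ) ≤ (J + 1) * M := by exact_mod_cast hJn'.le
  have hx : 0 ≤ μ.real (FE n y M y') := measureReal_nonneg
  rw [mul_div_assoc', le_div_iff₀ (by linarith)]
  calc μ.real (FE n y M y') * n ≤ μ.real (FE n y M y') * (2 * J * M) := by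
        refine mul_le_mul_of_nonneg_left (hJR.trans ?_) hx
        nlinarith
    _ = (J * μ.real (FE n y M y')) * (2 * M) := by ring
    _ ≤ 2 ^ 22 * (2 * M) := mul_le_mul_of_nonneg_right hbound (by linarith)
    _ = 2 ^ 23 * M := by ring

theorem le_real_FE (hμ : IsBernoulliHalf μ) {n y M y' : ℤ} (hn : 1 ≤ n) (hM : 1 ≤ M) (hMn : M ≤ n)
    (hy : y' - y = 2 * n - 1) : 2⁻¹ ^ 44 * (M / (3 * n)) ≤ μ.real (FE n y M y') := by
  classical
  have := hμ.1
  have hnR : (1 : ℝ) ≤ n := by exact_mod_cast hn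
  have hMR : (1 : ℝ) ≤ M := by exact_mod_cast hM
  set H := y' - y with hH
  have hshift : ∀ k : ℤ, μ.real (FE n k M (k + H)) = μ.real (FE n y M y') := by
    intro k
    rw [← real_FE_shift hμ n y M y' (k - y)]
    congr 2 <;> omega
  obtain ⟨J, hJ⟩ : ∃ J : ℕ, (J : ℤ) = 2 * n / M + 1 := ⟨(2 * n / M + 1).toNat, by
    rw [Int.toNat_of_nonneg]
    have : 0 ≤ 2 * n / M := Int.ediv_nonneg (by omega) (by omega)
    omega⟩
  have hJ1 : 2 * n < J * M := by rw [hJ]; exact Int.lt_ediv_add_one_mul_self _ (by omega)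
  have hJ2 : J * M ≤ 3 * n := by
    have := Int.ediv_mul_le (2 * n) (show M ≠ 0 by omega)
    rw [hJ]; linarith
  set A := fun j : ℕ => {ω : Config | TB (-n) n (j * M) (j * M + H) (Col false ω)} with hA
  have h0 : (2 : ℝ)⁻¹ ^ 22 ≤ μ.real (A 0)ᶜ := by
    have := rsw_TB hμ (x₀ := -n) (x₁ := n) (y₀ := 0) (y₁ := H) (by omega) (by omega) false
    change _ ≤ μ.real {ω | TB (-n) n 0 H (Col false ω)}ᶜ at this
    simpa only [hA, Nat.cast_zero, zero_mul, zero_add] using this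
  have h1 : (2 : ℝ)⁻¹ ^ 22 ≤ μ.real (A J) := by
    have := rsw_LR hμ (x₀ := -n) (x₁ := n) (y₀ := J * M) (y₁ := J * M + H) (by omega) (by omega)
      true
    refine this.trans (measureReal_mono fun ω h => ?_)
    have h' := (not_LR_iff (by omega) (by omega) _).1 h
    rwa [col_compl] at h'
  have hind := real_indep hμ (finite_rect _ _ _ _) (finite_rect _ _ _ _) (by
    rw [Set.disjoint_left]
    rintro v ⟨-, -, h3, h4⟩ ⟨-, -, h5, h6⟩
    simp only [Nat.cast_zero, zero_mul, zero_add] at h4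
    omega) (det_TB (-n) n ((0 : ℕ) * M) ((0 : ℕ) * M + H) false).compl
    (det_TB (-n) n (J * M) (J * M + H) false)
  have hsub : (A 0)ᶜ ∩ A J ⊆ ⋃ j ∈ Finset.range J, FE n (j * M) M (j * M + H) := by
    rintro ω ⟨hω0, hωJ⟩
    have : ∃ j < J, ω ∉ A j ∧ ω ∈ A (j + 1) := by
      by_contra hcon
      push Not at hcon
      have : ∀ j ≤ J, ω ∉ A j := by
        intro j hj
        induction j with
        | zero => exact hω0
        | succ j ih => exact hcon j (by omega) (ih (by omega))
      exact this J le_rfl hωJ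
    obtain ⟨j, hj, hj1, c, d, hc, hd, h⟩ := this
    simp only [Set.mem_iUnion, Finset.mem_range]
    refine ⟨j, hj, hj1, ?_⟩
    push_cast at hc hd h
    refine h.toTB (by omega) (by linarith) (by linarith) fun v hv _ _ => ⟨hv.1.1, hv.1.2.1, hv.2⟩
  have hU := (measureReal_mono (μ := μ) hsub (measure_ne_top _ _)).trans (measureReal_biUnion_finset_le _ _)
  simp only [hshift, Finset.sum_const, Finset.card_range, nsmul_eq_mul] at hU
  have hG : (2 : ℝ)⁻¹ ^ 44 ≤ μ.real ((A 0)ᶜ ∩ A J) := by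
    refine le_trans ?_ hind.ge
    calc (2 : ℝ)⁻¹ ^ 44 = 2⁻¹ ^ 22 * 2⁻¹ ^ 22 := by norm_num
      _ ≤ _ := mul_le_mul h0 h1 (by positivity) measureReal_nonneg
  have hJR : (J : ℝ) * M ≤ 3 * n := by exact_mod_cast hJ2
  have hx : 0 ≤ μ.real (FE n y M y') := measureReal_nonneg
  rw [mul_div_assoc', div_le_iff₀ (by linarith)]
  calc (2 : ℝ)⁻¹ ^ 44 * M ≤ (J * μ.real (FE n y M y')) * M :=
        mul_le_mul_of_nonneg_right (hG.trans hU) (by linarith)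
    _ = μ.real (FE n y M y') * (J * M) := by ring
    _ ≤ _ := mul_le_mul_of_nonneg_left hJR hx

/-- Conditionally on an explored cluster satisfying `good`, an event of conditional probability at
least `q` is added. -/
theorem explore_mul_le (hμ : IsBernoulliHalf μ) {D T Λ : Set Site} (hD : D.Finite) (hΛ : Λ.Finite)
    (b : Bool) {q : ℝ} (good : Set Site → Prop) (E : Set Site → Set Config)
    (hE : ∀ c, good c → Det (Λ \ explored D T c) (E c)) (hq : ∀ c, good c → q ≤ μ.real (E c)) :
    q * μ.real {ω | good (cluster D T b ω)} ≤
      μ.real {ω | good (cluster D T b ω) ∧ ω ∈ E (cluster D T b ω)} := by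
  classical
  have := hμ.1
  have key := explore_le (T := T) hμ hD hΛ b (q := q)
    (E₁ := fun c => if good c then Set.univ else ∅) (E₂ := fun c => if good c then E c else ∅)
    (by intro c; split_ifs <;> intro _ _ _ h <;> simp_all)
    (by
      intro c
      split_ifs with hc
      · exact hE c hc
      · exact det_empty _)
    (by
      intro c
      split_ifs with hc
      · simpa using hq c hc
      · simp)
  have e1 : {ω | good (cluster D T b ω)} =
      {ω | ω ∈ (if good (cluster D T b ω) then Set.univ else ∅ : Set Config)} := by
    ext ω
    simp only [Set.mem_ofPred_eq]
    split_ifs with h <;> simp [h]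
  have e2 : {ω | good (cluster D T b ω) ∧ ω ∈ E (cluster D T b ω)} =
      {ω | ω ∈ (if good (cluster D T b ω) then E (cluster D T b ω) else ∅ : Set Config)} := by
    ext ω
    simp only [Set.mem_ofPred_eq]
    split_ifs with h <;> simp [h]
  rw [e1, e2]
  exact key

/-- A pivotality criterion in terms of connectivity. -/
def PivConn (n : ℤ) (ω : Config) (c : Site) : Prop :=
  c ∈ rect (-n) n (-n) n ∧ ¬ TB (-n) n (-n) n (Col false ω) ∧
    (∃ a t : Site, Adj c a ∧ t.2 = n ∧ Conn (rect (-n) n (-n) n ∩ Col false ω) a t) ∧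
    ∃ b d : Site, Adj c b ∧ d.2 = -n ∧ Conn (rect (-n) n (-n) n ∩ Col false ω) b d

/-- The closed cluster of the top side of `[-n, n] × [y, y']`. -/
def topCluster (n y y' : ℤ) (ω : Config) : Set Site :=
  cluster (rect (-n) n y y') (rectTop (-n) n y y') false ω

theorem not_TB_iff_topCluster {n y y' : ℤ} {ω : Config} :
    ¬ TB (-n) n y y' (Col false ω) ↔ ∀ v ∈ topCluster n y y' ω, v.2 ≠ y := by
  constructor
  · rintro h v ⟨t, ht, hv⟩ hvy
    exact h ⟨t, v, ht.2, hvy, hv⟩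
  · rintro h ⟨c, d, hc, hd, hcd⟩
    exact h d ⟨c, ⟨hcd.left.1, hc⟩, hcd⟩ hd

theorem exists_topCluster_of_TB {n y M y' : ℤ} (hM : 0 ≤ M) {ω : Config}
    (h : TB (-n) n (y + M) y' (Col false ω)) : ∃ u ∈ topCluster n y y' ω, u.2 = y + M := by
  obtain ⟨c, d, hc, hd, hcd⟩ := h
  have hsub : rect (-n) n (y + M) y' ∩ Col false ω ⊆ rect (-n) n y y' ∩ Col false ω := by
    rintro v ⟨⟨h1, h2, h3, h4⟩, hv⟩
    exact ⟨⟨h1, h2, by omega, h4⟩, hv⟩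
  exact ⟨d, ⟨c, ⟨(hsub hcd.left).1, hc⟩, hcd.mono hsub⟩, hd⟩

theorem not_TB_of_topCluster {n : ℤ} (hn : 1 ≤ n) {ω : Config}
    (h : ∀ v ∈ topCluster n (-n + 1) n ω, v.2 ≠ -n + 1) : ¬ TB (-n) n (-n) n (Col false ω) := by
  rintro ⟨c, d, hc, hd, hcd⟩
  refine not_TB_iff_topCluster.2 h (hcd.toTB (by omega) hc.ge (by omega) ?_)
  exact fun v hv _ _ => ⟨hv.1.1, hv.1.2.1, hv.2⟩

theorem topCluster_conn {n y y' : ℤ} {ω : Config} {u : Site} (hu : u ∈ topCluster n y y' ω) :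
    ∃ t : Site, t.2 = y' ∧ Conn (topCluster n y y' ω) u t := by
  obtain ⟨t, ht, h⟩ := cluster_conn hu
  exact ⟨t, ht.2, h.symm⟩

theorem topCluster_subset (n y y' : ℤ) (ω : Config) :
    topCluster n y y' ω ⊆ rect (-n) n y y' ∩ Col false ω := cluster_subset _ _ _ _

theorem rect_subset_rect {x₀ x₁ y₀ y₁ x₀' x₁' y₀' y₁' : ℤ} (h1 : x₀' ≤ x₀) (h2 : x₁ ≤ x₁')
    (h3 : y₀' ≤ y₀) (h4 : y₁ ≤ y₁') : rect x₀ x₁ y₀ y₁ ⊆ rect x₀' x₁' y₀' y₁' := by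
  rintro v ⟨h5, h6, h7, h8⟩
  exact ⟨by omega, by omega, by omega, by omega⟩

/-- Surrounding a point close to the bottom of the top cluster produces a pivotal site. -/
theorem exists_pivConn {n r : ℤ} (hr : 1 ≤ r) (hrn : 6 * r + 1 ≤ n) {ω : Config} {u : Site}
    (hu : u ∈ topCluster n (-n + 1) n ω) (hur : u.2 ≤ -n + r)
    (hU : ∀ v ∈ topCluster n (-n + 1) n ω, v.2 ≠ -n + 1)
    (harm : ¬ Arm (u.1, -n) r (6 * r) (Col true ω \
      explored (rect (-n) n (-n + 1) n) (rectTop (-n) n (-n + 1) n) (topCluster n (-n + 1) n ω))) :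
    ∃ c, PivConn n ω c ∧ c.2 ≤ -n + (6 * r + 1) ∧ -n < c.1 := by
  set U := topCluster n (-n + 1) n ω with hUdef
  set s := explored (rect (-n) n (-n + 1) n) (rectTop (-n) n (-n + 1) n) U with hs
  set z : Site := (u.1, -n) with hz
  set R := rect (-n) n (-n) n with hR
  have hDR : rect (-n) n (-n + 1) n ⊆ R := rect_subset_rect le_rfl le_rfl (by omega) le_rfl
  have hUR : U ⊆ R ∩ Col false ω :=
    (topCluster_subset _ _ _ _).trans (Set.inter_subset_inter_left _ hDR)
  set A : Set Site := U ∪ {v | v ∈ s ∧ v.1 ≠ -n} ∪ {v | ω v = false ∧ dst z v ≤ 6 * r ∧ v ∉ s}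
    with hA
  have huR := (hUR hu).1
  obtain ⟨hu1, hu2, hu3, hu4⟩ := huR
  rcases hex (x₀ := -n) (x₁ := n) (y₀ := -n) (y₁ := n) (by omega) (by omega) Aᶜ with h | h
  · exfalso
    obtain ⟨a, b, ha, hb, hab⟩ := h
    have hopen : ∀ v ∈ (R ∩ Aᶜ) \ {v | v.1 = -n}, r < dst z v → dst z v ≤ 6 * r →
        v ∈ Col true ω \ s := by
      rintro v ⟨⟨hvR, hvA⟩, hv1⟩ - hv2
      have hvs : v ∉ s := fun h => hvA (.inl (.inr ⟨h, hv1⟩))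
      refine ⟨?_, hvs⟩
      by_contra hv
      exact hvA (.inr ⟨by simpa [Col] using hv, hv2, hvs⟩)
    obtain ⟨c, hc, d, hac, hcd, hdb⟩ := hab.last_exit {v | v.1 = -n} ha (by
      rw [Set.mem_ofPred_eq]; omega)
    rw [Set.mem_ofPred_eq] at hc
    set P : Set Site := {v | Conn ((R ∩ Aᶜ) \ {v | v.1 = -n}) v b} with hP
    have hPc : Conn (P ∪ {c}) c b := by
      refine Conn.head (.inr rfl) hcd ?_
      have : Conn (((R ∩ Aᶜ) \ {v | v.1 = -n}) ∩ P) b d :=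
        hdb.symm.restrict P (Conn.refl hdb.right) fun u' v' h1 _ h3 h4 =>
          Conn.head h3 h4.symm h1
      exact this.symm.mono fun v hv => .inl hv.2
    obtain ⟨t, ht, hut⟩ := topCluster_conn hu
    have hPR : ∀ v ∈ P ∪ {c}, v ∈ R ∧ v ∉ A := by
      rintro v (hv | rfl)
      · exact hv.left.1
      · exact hac.right
    have hvert : Conn (U ∪ {v | v.1 = u.1 ∧ v.2 ≤ u.2 ∧ -n ≤ v.2}) t (u.1, -n) := by
      refine (hut.symm.mono Set.subset_union_left).trans (Conn.symm ?_)
      refine conn_col (x := u.1) (y := -n) (y' := u.2) hu3 fun t h1 h2 => .inr ⟨rfl, h2, h1⟩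
    obtain ⟨w, hwP, hw1, hw2, hw3⟩ : ∃ w ∈ P ∪ {c}, w.1 = u.1 ∧ w.2 ≤ u.2 ∧ -n ≤ w.2 := by
      by_contra hcon
      push Not at hcon
      refine not_disjoint_of_cross (x₀ := -n) (x₁ := n) (y₀ := -n) (y₁ := n) hPc hvert ?_ ?_ ?_
        hc.le hb.ge ht.ge le_rfl
      · rintro v hv (h | ⟨h1, h2, h3⟩)
        · exact (hPR v hv).2 (.inl (.inl h))
        · have := hcon v hv h1 h2
          omega
      · exact fun v hv => (hPR v hv).1.2.2
      · rintro v (h | ⟨h1, h2, h3⟩)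
        · exact ⟨(hUR h).1.1, (hUR h).1.2.1⟩
        · omega
    have hwz : dst z w ≤ r := by rw [dst_le_iff]; simp only [hz]; omega
    by_cases hright : u.1 + 6 * r ≤ n
    · have hbz : 6 * r ≤ dst z b := by
        by_contra hcon
        have : dst z b ≤ 6 * r - 1 := by omega
        rw [dst_le_iff] at this
        simp only [hz] at this
        omega
      rcases hwP with hw | rfl
      · exact harm (Conn.arm hw (by omega) (by omega) hbz hopen)
      · have := dst_adj z d w hcd.symm
        exact harm (Conn.arm hdb (by omega) (by omega) hbz hopen)
    · have hdz : 6 * r ≤ dst z d := by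
        by_contra hcon
        have : dst z d ≤ 6 * r - 1 := by omega
        rw [dst_le_iff] at this
        simp only [hz] at this
        rw [adj_iff] at hcd
        omega
      rcases hwP with hw | rfl
      · exact harm (Conn.arm (hw.trans hdb.symm) (by omega) (by omega) hdz hopen)
      · omega
  · rw [compl_compl] at h
    obtain ⟨t, d, ht, hd, h⟩ := h
    have hts : t ∈ s := by
      have := h.left.1
      have ht' : t ∈ rect (-n) n (-n + 1) n := ⟨this.1, this.2.1, by omega, this.2.2.2⟩
      exact ⟨ht', .inl ⟨ht', ht⟩⟩
    obtain ⟨c, hcs, e, htc, hce, hed⟩ := h.last_exit s hts (fun hds => by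
      have := hds.1.2.2.1
      omega)
    have hcl : ∀ v ∈ (rect (-n) n (-n) n ∩ A) \ s, v ∈ R ∩ Col false ω ∧ dst z v ≤ 6 * r := by
      rintro v ⟨⟨hvR, (hv | hv) | hv⟩, hvs⟩
      · exact absurd (cluster_subset_explored _ _ _ _ hv) hvs
      · exact absurd hv.1 hvs
      · exact ⟨⟨hvR, hv.1⟩, hv.2.1⟩
    have he := hcl e hed.left
    have hez := dst_le_iff.1 he.2
    simp only [hz] at hez
    have hcA := htc.right.2
    have hce' := adj_iff.1 hce
    have hcD := hcs.1
    have hcU : c ∉ U := by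
      intro hcU
      have h1 := hU c hcU
      refine hed.left.2 ⟨⟨he.1.1.1, he.1.1.2.1, ?_, he.1.1.2.2.2⟩, .inr (.inr ⟨c, hcU, hce⟩)⟩
      have := hcD.2.2.1
      omega
    have hc1 : c.1 ≠ -n := by
      rcases hcA with (h | h) | h
      · exact absurd h hcU
      · exact h.2
      · exact absurd hcs h.2.2
    refine ⟨c, ⟨hDR hcD, not_TB_of_topCluster (by omega) hU, ?_, e, d, hce, hd,
      hed.mono fun v hv => (hcl v hv).1⟩, by omega, lt_of_le_of_ne hcD.1 (Ne.symm hc1)⟩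
    rcases hcs.2 with h | h | ⟨v, hv, hvc⟩
    · have := h.2
      omega
    · exact absurd h hcU
    · obtain ⟨t', ht', hvt⟩ := topCluster_conn hv
      exact ⟨v, t', hvc.symm, ht', hvt.mono hUR⟩

/-- Some pivotal site lies in the bottom `m` rows, off the left side. -/
def LowPiv (n m : ℤ) : Set Config := {ω | ∃ c, PivConn n ω c ∧ c.2 ≤ -n + m ∧ -n < c.1}

theorem real_FE_le_lowPiv (hμ : IsBernoulliHalf μ) {n M m : ℤ} (hM : 1 ≤ M)
    (hm : 6 * (M + 1) + 1 ≤ m) (hmn : m ≤ n) :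
    c₀ * μ.real (FE n (-n + 1) M n) ≤ μ.real (LowPiv n m) := by
  classical
  have := hμ.1
  have hf : ∀ c : Set Site, ∃ u : Site, (∃ u ∈ c, u.2 ≤ -n + (M + 1)) → u ∈ c ∧ u.2 ≤ -n + (M + 1) := by
    intro c
    by_cases h : ∃ u ∈ c, u.2 ≤ -n + (M + 1)
    · exact ⟨h.choose, fun _ => h.choose_spec⟩
    · exact ⟨0, fun h' => absurd h' h⟩
  choose f hf using hf
  have key := explore_mul_le (T := rectTop (-n) n (-n + 1) n) (Λ := rect (-2 * n) (2 * n) (-2 * n) (2 * n))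
    hμ (finite_rect (-n) n (-n + 1) n) (finite_rect _ _ _ _) false (q := c₀)
    (fun c => c ⊆ rect (-n) n (-n + 1) n ∧ (∃ u ∈ c, u.2 ≤ -n + (M + 1)) ∧ ∀ v ∈ c, v.2 ≠ -n + 1)
    (fun c => {ω | ¬ Arm ((f c).1, -n) (M + 1) (6 * (M + 1)) (Col true ω \
      explored (rect (-n) n (-n + 1) n) (rectTop (-n) n (-n + 1) n) c)})
    (by
      rintro c ⟨hc, hex, -⟩
      refine (det_not_arm _ _ _ _ true).mono (Set.sdiff_subset_sdiff_left ?_)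
      intro v hv
      have h1 := dst_le_iff.1 hv
      obtain ⟨h2, h3, -⟩ := hc (hf c hex).1
      simp only at h1
      exact ⟨by omega, by omega, by omega, by omega⟩)
    (fun c _ => real_not_arm hμ _ (by omega) rfl _ true)
  refine le_trans (mul_le_mul_of_nonneg_left (measureReal_mono ?_) c₀_pos.le)
    (key.trans (measureReal_mono ?_))
  · rintro ω ⟨h1, h2⟩
    obtain ⟨u, hu, hu2⟩ := exists_topCluster_of_TB (by omega) h2
    exact ⟨fun v hv => (topCluster_subset _ _ _ _ hv).1, ⟨u, hu, by omega⟩,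
      not_TB_iff_topCluster.1 h1⟩
  · rintro ω ⟨⟨-, h2, h3⟩, h4⟩
    obtain ⟨c, h5, h6, h7⟩ := exists_pivConn (by omega) (by omega) (hf _ h2).1 (hf _ h2).2 h3 h4
    exact ⟨c, h5, by omega, h7⟩

theorem real_FE_one_le_lowPiv (hμ : IsBernoulliHalf μ) {n m : ℤ} (hm : 1 ≤ m) (hmn : m ≤ n) :
    1 / 2 * μ.real (FE n (-n + 1) 1 n) ≤ μ.real (LowPiv n m) := by
  classical
  have := hμ.1
  have hf : ∀ c : Set Site, ∃ u : Site, (∃ u ∈ c, u.2 = -n + 2) → u ∈ c ∧ u.2 = -n + 2 := by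
    intro c
    by_cases h : ∃ u ∈ c, u.2 = -n + 2
    · exact ⟨h.choose, fun _ => h.choose_spec⟩
    · exact ⟨0, fun h' => absurd h' h⟩
  choose f hf using hf
  set w : Set Site → Site := fun c => (min ((f c).1 + 1) n, -n) with hw
  have key := explore_mul_le (T := rectTop (-n) n (-n + 1) n) (Λ := rect (-n) n (-n) n)
    hμ (finite_rect (-n) n (-n + 1) n) (finite_rect _ _ _ _) false (q := 1 / 2)
    (fun c => c ⊆ rect (-n) n (-n + 1) n ∧ (∃ u ∈ c, u.2 = -n + 2) ∧ ∀ v ∈ c, v.2 ≠ -n + 1)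
    (fun c => {ω | ω (w c) = false})
    (by
      rintro c ⟨hc, hex, -⟩ ω ω' h hω
      rw [Set.mem_ofPred_eq] at *
      rw [← hω]
      refine (h _ ⟨?_, fun hwe => ?_⟩).symm
      · obtain ⟨h2, h3, -⟩ := hc (hf c hex).1
        simp only [hw, rect, Set.mem_ofPred_eq]
        omega
      · have := hwe.1.2.2.1
        simp only [hw] at this
        omega)
    (fun c _ => by
      have := real_cylinder hμ {w c} (fun _ => false)
      simp only [Finset.mem_singleton, forall_eq, Finset.card_singleton, pow_one] at this
      rw [this])
  refine le_trans (mul_le_mul_of_nonneg_left (measureReal_mono ?_) (by norm_num))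
    (key.trans (measureReal_mono ?_))
  · rintro ω ⟨h1, h2⟩
    obtain ⟨u, hu, hu2⟩ := exists_topCluster_of_TB (by omega) h2
    exact ⟨fun v hv => (topCluster_subset _ _ _ _ hv).1, ⟨u, hu, by omega⟩,
      not_TB_iff_topCluster.1 h1⟩
  · rintro ω ⟨⟨h1, h2, h3⟩, h4⟩
    obtain ⟨hu, hu2⟩ := hf _ h2
    set u := f (cluster (rect (-n) n (-n + 1) n) (rectTop (-n) n (-n + 1) n) false ω) with hudef
    have huR := h1 hu
    obtain ⟨hu3, hu4, hu5, hu6⟩ := huR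
    obtain ⟨t, ht, hut⟩ := topCluster_conn hu
    refine ⟨(min (u.1 + 1) n, -n + 1), ⟨⟨by simp only; omega, by simp only; omega,
      by simp only; omega, by simp only; omega⟩, not_TB_of_topCluster (by omega) h3,
      ⟨u, t, ?_, ht, hut.mono ((topCluster_subset _ _ _ _).trans
        (Set.inter_subset_inter_left _ (rect_subset_rect le_rfl le_rfl (by omega) le_rfl)))⟩,
      (min (u.1 + 1) n, -n), _, ?_, rfl, Conn.refl ⟨⟨by simp only; omega, by simp only; omega,
      by simp only; omega, by simp only; omega⟩, h4⟩⟩, by simp only; omega, by simp only; omega⟩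
    · rw [adj_iff]; simp only; omega
    · rw [adj_iff]; simp

/-- The lower bound for the probability of a pivotal site near the bottom side. -/
theorem le_real_lowPiv (hμ : IsBernoulliHalf μ) {n m : ℤ} (hm : 1 ≤ m) (hmn : m ≤ n) :
    2⁻¹ ^ 150 * ((m : ℝ) / n) ≤ μ.real (LowPiv n m) := by
  have := hμ.1
  have hnR : (1 : ℝ) ≤ n := by exact_mod_cast hm.trans hmn
  have hmR : (1 : ℝ) ≤ m := by exact_mod_cast hm
  rcases lt_or_ge m 64 with h | h
  · have h1 := real_FE_one_le_lowPiv hμ hm hmn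
    have h2 := le_real_FE hμ (n := n) (y := -n + 1) (M := 1) (y' := n) (by omega) le_rfl
      (by omega) (by omega)
    have h3 : (m : ℝ) ≤ 64 := by exact_mod_cast h.le
    refine le_trans ?_ ((mul_le_mul_of_nonneg_left h2 (by norm_num)).trans h1)
    calc (2 : ℝ)⁻¹ ^ 150 * ((m : ℝ) / n) ≤ 2⁻¹ ^ 150 * (64 / (n : ℝ)) := by gcongr
      _ = (2⁻¹ ^ 150 * 64) * (1 / (n : ℝ)) := by ring
      _ ≤ (1 / 2 * 2⁻¹ ^ 44 / 3) * (1 / (n : ℝ)) := by gcongr; norm_num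
      _ = _ := by push_cast; field_simp
  · have h1 := real_FE_le_lowPiv hμ (n := n) (M := m / 16 - 1) (m := m) (by omega) (by omega) hmn
    have h2 := le_real_FE hμ (n := n) (y := -n + 1) (M := m / 16 - 1) (y' := n) (by omega) (by omega)
      (by omega) (by omega)
    have h3 : (m : ℝ) / 32 ≤ (m / 16 - 1 : ℤ) := by
      rw [div_le_iff₀ (by norm_num)]
      have : m ≤ (m / 16 - 1) * 32 := by omega
      exact_mod_cast this
    refine le_trans ?_ ((mul_le_mul_of_nonneg_left h2 c₀_pos.le).trans h1)
    calc (2 : ℝ)⁻¹ ^ 150 * ((m : ℝ) / n) ≤ (c₀ * 2⁻¹ ^ 44 / 96) * (m / n) := by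
          unfold c₀; gcongr; norm_num
      _ = c₀ * (2⁻¹ ^ 44 * ((m / 32) / (3 * n))) := by field_simp; ring
      _ ≤ _ := by
        have := c₀_pos
        gcongr

/-- Some pivotal site lies within distance `m` of `z`. -/
def PivNear (n m : ℤ) (z : Site) : Set Config := {ω | ∃ v, PivConn n ω v ∧ dst z v ≤ m}

theorem pivNear_subset_FE {n m : ℤ} (hm : 1 ≤ m) (hmn : m < n) {z : Site} (hz : z.2 = -n) :
    PivNear n m z ⊆ FE n (-n) (m + 1) n := by
  rintro ω ⟨v, ⟨-, h, ⟨a, t, hva, ht, hat⟩, -⟩, hv⟩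
  refine ⟨h, hat.symm.toTB (by omega) ht.ge ?_ fun w hw _ _ => ⟨hw.1.1, hw.1.2.1, hw.2⟩⟩
  rw [dst_le_iff] at hv
  rw [adj_iff] at hva
  omega

/-- The box `[-n, n]²` without the ball of radius `m` around `z`. -/
def holed (n m : ℤ) (z : Site) : Set Site := rect (-n) n (-n) n \ {v | dst z v ≤ m}

theorem finite_holed (n m : ℤ) (z : Site) : (holed n m z).Finite :=
  (finite_rect _ _ _ _).subset Set.sdiff_subset

/-- Open walks off the hole join both vertical sides to the bottom side near the hole, but do not
join the vertical sides to each other. -/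
def Legs (n m : ℤ) (z : Site) (ω : Config) : Prop :=
  (∃ a b : Site, a.1 = -n ∧ b.2 = -n ∧ z.1 - 6 * m - 1 ≤ b.1 ∧
      Conn (holed n m z ∩ Col true ω) a b) ∧
    (∃ a b : Site, a.1 = n ∧ b.2 = -n ∧ b.1 ≤ z.1 + 6 * m + 1 ∧
      Conn (holed n m z ∩ Col true ω) a b) ∧
    ∀ a b : Site, a.1 = -n → b.1 = n → ¬ Conn (holed n m z ∩ Col true ω) a b

/-- The closed cluster of the top side off the hole reaches the hole but not the bottom side. -/
def TopMeetsHole (n m : ℤ) (z : Site) (c : Set Site) : Prop :=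
  (∀ v ∈ c, v.2 ≠ -n) ∧ ∃ u ∈ c, ∃ w ∈ rect (-n) n (-n) n, dst z w ≤ m ∧ Adj u w

theorem topMeetsHole_of_pivNear {n m : ℤ} (hmn : m < n) {z : Site} (hz : z.2 = -n) {ω : Config}
    (h : ω ∈ PivNear n m z) :
    TopMeetsHole n m z (cluster (holed n m z) (rectTop (-n) n (-n) n) false ω) := by
  obtain ⟨v, ⟨hvR, hTB, ⟨a, t, hva, ht, hat⟩, -⟩, hv⟩ := h
  constructor
  · rintro w ⟨t', ht', hw⟩ hwn
    exact hTB ⟨t', w, ht'.2, hwn, hw.mono (Set.inter_subset_inter_left _ Set.sdiff_subset)⟩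
  · have h1 : Conn (rect (-n) n (-n) n ∩ Col false ω ∪ {v}) t v :=
      (hat.symm.mono Set.subset_union_left).tail (.inr rfl) hva.symm
    obtain ⟨u, w, hw, htu, huw, hwv⟩ := h1.first_entry {v | dst z v ≤ m} (by
      rw [Set.mem_ofPred_eq, dst_le_iff]; omega) hv
    have hsub : (rect (-n) n (-n) n ∩ Col false ω ∪ {v}) \ {v | dst z v ≤ m} ⊆
        holed n m z ∩ Col false ω := by
      rintro w ⟨hw | rfl, hw'⟩
      · exact ⟨⟨hw.1, hw'⟩, hw.2⟩
      · exact absurd hv hw'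
    have htu' := htu.mono hsub
    refine ⟨u, ⟨t, ⟨htu'.left.1.1, ht⟩, htu'⟩, w, ?_, hw, huw⟩
    rcases hwv.left with h | h
    · exact h.1
    · rw [h]; exact hvR

theorem not_conn_of_topMeetsHole {n m : ℤ} {z : Site} (hz : z.2 = -n) {ω : Config}
    (h : TopMeetsHole n m z (cluster (holed n m z) (rectTop (-n) n (-n) n) false ω)) {a b : Site}
    (ha : a.1 = -n) (hb : b.1 = n) : ¬ Conn (holed n m z ∩ Col true ω) a b := by
  intro hab
  obtain ⟨-, u, hu, w, hwR, hw, huw⟩ := h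
  obtain ⟨t, ht, htu⟩ := cluster_conn hu
  set U := cluster (holed n m z) (rectTop (-n) n (-n) n) false ω with hU
  have hUs : U ⊆ holed n m z ∩ Col false ω := cluster_subset _ _ _ _
  rw [dst_le_iff] at hw
  have hcol : Conn (U ∪ {v | v ∈ rect (-n) n (-n) n ∧ dst z v ≤ m}) w (w.1, -n) := by
    refine Conn.symm (conn_col (x := w.1) (y := -n) (y' := w.2) hwR.2.2.1 fun t h1 h2 => .inr ?_)
    refine ⟨⟨hwR.1, hwR.2.1, h1, h2.trans hwR.2.2.2⟩, ?_⟩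
    rw [dst_le_iff]; simp only; omega
  have hT : Conn (U ∪ {v | v ∈ rect (-n) n (-n) n ∧ dst z v ≤ m}) t (w.1, -n) :=
    ((htu.mono Set.subset_union_left).tail hcol.left huw).trans hcol
  refine not_disjoint_of_cross (x₀ := -n) (x₁ := n) (y₀ := -n) (y₁ := n) hab hT ?_ ?_ ?_
    ha.le hb.ge ht.2.ge le_rfl
  · rintro v hv (h | h)
    · have h1 := (hUs h).2
      have h2 := hv.2
      simp_all [Col]
    · exact hv.1.2 h.2
  · exact fun v hv => hv.1.1.2.2
  · rintro v (h | h)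
    · exact ⟨(hUs h).1.1.1, (hUs h).1.1.2.1⟩
    · exact ⟨h.1.1, h.1.2.1⟩

theorem legs_of_topMeetsHole {n m : ℤ} (hm : 1 ≤ m) {z : Site} (hz : z.2 = -n)
    (hz1 : -n + 36 * m < z.1) (hz2 : z.1 + 36 * m < n) {ω : Config}
    (h : TopMeetsHole n m z (cluster (holed n m z) (rectTop (-n) n (-n) n) false ω))
    (harm : ¬ Arm z m (6 * m) (Col false ω \ explored (holed n m z) (rectTop (-n) n (-n) n)
      (cluster (holed n m z) (rectTop (-n) n (-n) n) false ω))) : Legs n m z ω := by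
  have hcross : ∀ a b : Site, a.1 = -n → b.1 = n → ¬ Conn (holed n m z ∩ Col true ω) a b :=
    fun a b ha hb => not_conn_of_topMeetsHole hz h ha hb
  have hfar : ∀ t d : Site, t.2 = n → d.2 = -n → 6 * m ≤ dst z d →
      ¬ Conn (rect (-n) n (-n) n ∩ {v | dst z v ≤ m ∨ ω v = false}) t d := by
    intro t d ht hd hzd htd
    set B : Set Site := {v | dst z v ≤ m} with hB
    have hsub : (rect (-n) n (-n) n ∩ {v | dst z v ≤ m ∨ ω v = false}) \ B ⊆
        holed n m z ∩ Col false ω :=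
      fun v hv => ⟨⟨hv.1.1, hv.2⟩, hv.1.2.resolve_left hv.2⟩
    have hdU : d ∉ cluster (holed n m z) (rectTop (-n) n (-n) n) false ω := fun hd' => h.1 d hd' hd
    rcases htd.symm.avoid_or_entry B (by rw [hB, Set.mem_ofPred_eq]; omega) with h1 | h1
    · have h2 := h1.symm.mono hsub
      exact hdU ⟨t, ⟨h2.left.1.1, ht⟩, h2⟩
    · obtain ⟨e, c, hc, hde, hec, -⟩ := h1
      refine harm (Conn.arm (((hde.mono hsub).diff_explored hdU).symm) (by omega) ?_ hzd ?_)
      · have := dst_adj z e c hec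
        have : dst z c ≤ m := hc
        omega
      · exact fun v hv _ _ => ⟨hv.2, hv.1.2⟩
  refine ⟨?_, ?_, hcross⟩
  · rcases hex (x₀ := -n) (x₁ := n) (y₀ := -n - 1) (y₁ := n) (by omega) (by omega)
      {v | (-n ≤ v.2 ∧ m < dst z v ∧ ω v = true) ∨ (v.2 < -n ∧ z.1 - 6 * m ≤ v.1)} with h1 | h1
    · obtain ⟨a, b, ha, hb, hab⟩ := h1
      have hsub : (rect (-n) n (-n - 1) n ∩ {v | (-n ≤ v.2 ∧ m < dst z v ∧ ω v = true) ∨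
          (v.2 < -n ∧ z.1 - 6 * m ≤ v.1)}) \ {v | v.2 < -n} ⊆ holed n m z ∩ Col true ω := by
        rintro v ⟨⟨⟨h1, h2, h3, h4⟩, h5⟩, h6⟩
        rw [Set.mem_ofPred_eq, not_lt] at h6
        rcases h5 with h5 | h5
        · exact ⟨⟨⟨h1, h2, h6, h4⟩, not_le.2 h5.2.1⟩, h5.2.2⟩
        · omega
      rcases hab.avoid_or_entry {v | v.2 < -n} (by
        intro h
        rcases hab.left.2 with h' | h'
        · exact absurd h (not_lt.2 h'.1)
        · omega) with h2 | ⟨d, c, hc, had, hdc, hcS⟩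
      · exact absurd (h2.mono hsub) (hcross a b ha hb)
      · have hd := (hsub had.right).1.1.2.2.1
        rw [Set.mem_ofPred_eq] at hc
        rw [adj_iff] at hdc
        rcases hcS.2 with h' | h'
        · omega
        · exact ⟨a, d, ha, by omega, by omega, had.mono hsub⟩
    · obtain ⟨c, d, hc, hd, hcd⟩ := h1
      obtain ⟨e, f, hf, hce, hef, hfd⟩ := hcd.first_entry {v | v.2 < -n} (by
        rw [Set.mem_ofPred_eq]; omega) (by rw [Set.mem_ofPred_eq]; omega)
      rw [Set.mem_ofPred_eq] at hf
      have hf' := hfd.left.2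
      simp only [Set.mem_compl_iff, Set.mem_ofPred_eq, not_or, not_and, not_le] at hf'
      have hf'' := hf'.2 hf
      have he := hce.right.2
      rw [Set.mem_ofPred_eq, not_lt] at he
      rw [adj_iff] at hef
      refine absurd (hce.mono ?_) (hfar c e hc (by omega) ?_)
      · rintro v ⟨⟨⟨h1, h2, h3, h4⟩, h5⟩, h6⟩
        simp only [Set.mem_compl_iff, Set.mem_ofPred_eq, not_or, not_and, not_le, not_lt,
          Bool.not_eq_true] at h5 h6
        refine ⟨⟨h1, h2, h6, h4⟩, ?_⟩
        rw [Set.mem_ofPred_eq]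
        by_contra hcon
        push Not at hcon
        exact hcon.2 (h5.1 h6 hcon.1)
      · by_contra hcon
        have : dst z e ≤ 6 * m - 1 := by omega
        rw [dst_le_iff] at this
        omega
  · rcases hex (x₀ := -n) (x₁ := n) (y₀ := -n - 1) (y₁ := n) (by omega) (by omega)
      {v | (-n ≤ v.2 ∧ m < dst z v ∧ ω v = true) ∨ (v.2 < -n ∧ v.1 ≤ z.1 + 6 * m)} with h1 | h1
    · obtain ⟨a, b, ha, hb, hab⟩ := h1
      have hsub : (rect (-n) n (-n - 1) n ∩ {v | (-n ≤ v.2 ∧ m < dst z v ∧ ω v = true) ∨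
          (v.2 < -n ∧ v.1 ≤ z.1 + 6 * m)}) \ {v | v.2 < -n} ⊆ holed n m z ∩ Col true ω := by
        rintro v ⟨⟨⟨h1, h2, h3, h4⟩, h5⟩, h6⟩
        rw [Set.mem_ofPred_eq, not_lt] at h6
        rcases h5 with h5 | h5
        · exact ⟨⟨⟨h1, h2, h6, h4⟩, not_le.2 h5.2.1⟩, h5.2.2⟩
        · omega
      rcases hab.symm.avoid_or_entry {v | v.2 < -n} (by
        intro h
        rcases hab.right.2 with h' | h'
        · exact absurd h (not_lt.2 h'.1)
        · omega) with h2 | ⟨d, c, hc, had, hdc, hcS⟩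
      · exact absurd (h2.symm.mono hsub) (hcross a b ha hb)
      · have hd := (hsub had.right).1.1.2.2.1
        rw [Set.mem_ofPred_eq] at hc
        rw [adj_iff] at hdc
        rcases hcS.2 with h' | h'
        · omega
        · exact ⟨b, d, hb, by omega, by omega, had.mono hsub⟩
    · obtain ⟨c, d, hc, hd, hcd⟩ := h1
      obtain ⟨e, f, hf, hce, hef, hfd⟩ := hcd.first_entry {v | v.2 < -n} (by
        rw [Set.mem_ofPred_eq]; omega) (by rw [Set.mem_ofPred_eq]; omega)
      rw [Set.mem_ofPred_eq] at hf
      have hf' := hfd.left.2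
      simp only [Set.mem_compl_iff, Set.mem_ofPred_eq, not_or, not_and, not_le] at hf'
      have hf'' := hf'.2 hf
      have he := hce.right.2
      rw [Set.mem_ofPred_eq, not_lt] at he
      rw [adj_iff] at hef
      refine absurd (hce.mono ?_) (hfar c e hc (by omega) ?_)
      · rintro v ⟨⟨⟨h1, h2, h3, h4⟩, h5⟩, h6⟩
        simp only [Set.mem_compl_iff, Set.mem_ofPred_eq, not_or, not_and, not_le, not_lt,
          Bool.not_eq_true] at h5 h6
        refine ⟨⟨h1, h2, h6, h4⟩, ?_⟩
        rw [Set.mem_ofPred_eq]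
        by_contra hcon
        push Not at hcon
        exact hcon.2 (h5.1 h6 hcon.1)
      · by_contra hcon
        have : dst z e ≤ 6 * m - 1 := by omega
        rw [dst_le_iff] at this
        omega

theorem real_pivNear_le_legs (hμ : IsBernoulliHalf μ) {n m : ℤ} (hm : 1 ≤ m) {z : Site}
    (hz : z.2 = -n) (hz1 : -n + 36 * m < z.1) (hz2 : z.1 + 36 * m < n) :
    c₀ * μ.real (PivNear n m z) ≤ μ.real {ω | Legs n m z ω} := by
  have := hμ.1
  have key := explore_mul_le (T := rectTop (-n) n (-n) n) (Λ := {v | dst z v ≤ 6 * m})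
    hμ (finite_holed n m z) (finite_ball _ _) false (q := c₀) (TopMeetsHole n m z)
    (fun c => {ω | ¬ Arm z m (6 * m)
      (Col false ω \ explored (holed n m z) (rectTop (-n) n (-n) n) c)})
    (fun c _ => det_not_arm _ _ _ _ _) (fun c _ => real_not_arm hμ _ hm rfl _ _)
  refine le_trans (mul_le_mul_of_nonneg_left (measureReal_mono ?_) c₀_pos.le)
    (key.trans (measureReal_mono ?_))
  · exact fun ω h => topMeetsHole_of_pivNear (by omega) hz h
  · exact fun ω h => legs_of_topMeetsHole hm hz hz1 hz2 h.1 h.2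

/-- The open cluster of the left side off the hole reaches the bottom side near the hole and
stays away from the rest of the bottom side on the right of the hole. -/
def LeftLeg (n m : ℤ) (z : Site) (c : Set Site) : Prop :=
  (∀ v ∈ c, v.1 ≠ n) ∧
    (∃ a b : Site, a.1 = -n ∧ b.2 = -n ∧ z.1 - 6 * m - 1 ≤ b.1 ∧ Conn c a b) ∧
    ∀ v ∈ explored (holed n m z) {v | v.1 = -n} c, v.2 = -n → v.1 ≤ z.1 + 36 * m

/-- No walk of `U` off `s` and off the ball of radius `6 * m` leads from the bottom side on the right
of the hole to the top side or to `s`. -/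
def RightFree (n m : ℤ) (z : Site) (s U : Set Site) : Prop :=
  ¬ ∃ d w : Site, d.2 = -n ∧ z.1 + 36 * m < d.1 ∧ (w.2 = n ∨ ∃ v ∈ s, Adj v w) ∧
    Conn ((rect (-n) n (-n) n \ (s ∪ {v | dst z v ≤ 6 * m})) ∩ U) d w

theorem det_rightFree (n m : ℤ) (z : Site) (s : Set Site) (b : Bool) :
    Det (rect (-n) n (-n) n \ (s ∪ {v | dst z v ≤ 6 * m})) {ω | RightFree n m z s (Col b ω)} :=
  (det_col _ b fun S => ∃ d w : Site, d.2 = -n ∧ z.1 + 36 * m < d.1 ∧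
    (w.2 = n ∨ ∃ v ∈ s, Adj v w) ∧ Conn S d w).compl

theorem av_rightFree (n m : ℤ) (z : Site) (s : Set Site) (b : Bool) :
    Av b {ω | RightFree n m z s (Col b ω)} :=
  av_not_col b (fun U => ∃ d w : Site, d.2 = -n ∧ z.1 + 36 * m < d.1 ∧
    (w.2 = n ∨ ∃ v ∈ s, Adj v w) ∧
    Conn ((rect (-n) n (-n) n \ (s ∪ {v | dst z v ≤ 6 * m})) ∩ U) d w)
    fun _ _ h ⟨d, w, h1, h2, h3, h4⟩ =>
      ⟨d, w, h1, h2, h3, h4.mono (Set.inter_subset_inter_right _ h)⟩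

theorem mem_explored_left {n m : ℤ} {z : Site} {ω : Config} {v : Site}
    (hv : v ∈ explored (holed n m z) {v | v.1 = -n}
      (cluster (holed n m z) {v | v.1 = -n} true ω)) :
    ∃ a : Site, a.1 = -n ∧
      Conn (cluster (holed n m z) {v | v.1 = -n} true ω ∪ {v}) a v := by
  rcases hv.2 with h | h | ⟨u, hu, huv⟩
  · exact ⟨v, h, Conn.refl (.inr rfl)⟩
  · obtain ⟨t, ht, htv⟩ := cluster_conn h
    exact ⟨t, ht, htv.mono Set.subset_union_left⟩
  · obtain ⟨t, ht, htu⟩ := cluster_conn hu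
    exact ⟨t, ht, (htu.mono Set.subset_union_left).tail (.inr rfl) huv⟩

theorem Legs.leftLeg_and_rightFree {n m : ℤ} (hm : 1 ≤ m) {z : Site} {ω : Config}
    (h : Legs n m z ω) :
    LeftLeg n m z (cluster (holed n m z) {v | v.1 = -n} true ω) ∧
      RightFree n m z (explored (holed n m z) {v | v.1 = -n}
        (cluster (holed n m z) {v | v.1 = -n} true ω)) (Col false ω) := by
  obtain ⟨⟨a, b, ha, hb, hab1, hab⟩, ⟨c, d, hc, hd, hcd1, hcd⟩, hcross⟩ := h
  set L := cluster (holed n m z) {v | v.1 = -n} true ω with hL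
  set s := explored (holed n m z) {v | v.1 = -n} L with hs
  set P : Set Site := {v | Conn (holed n m z ∩ Col true ω) c v} with hP
  have hcP : Conn P c d := (hcd.restrict P (Conn.refl hcd.left) fun u v hu _ hv huv =>
    hu.tail hv huv).mono Set.inter_subset_right
  have hPR : P ⊆ holed n m z ∩ Col true ω := fun v hv => hv.right
  have hLR : L ⊆ holed n m z ∩ Col true ω := cluster_subset _ _ _ _
  have hLP : ∀ v ∈ L, v ∉ P := by
    rintro v ⟨t, ht, htv⟩ hv
    exact hcross t c ht hc (htv.trans hv.symm)
  have hsP : ∀ v ∈ s, v ∉ P := by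
    intro v hv hvP
    by_cases hvL : v ∈ L
    · exact hLP v hvL hvP
    · exact color_of_explored hv hvL (hPR hvP).2
  refine ⟨⟨?_, ?_, ?_⟩, ?_⟩
  · rintro v ⟨t, ht, htv⟩ hv
    exact hcross t v ht hv htv
  · refine ⟨a, b, ha, hb, hab1, ?_⟩
    exact (hab.restrict L ⟨a, ha, Conn.refl hab.left⟩ fun u v hu _ hv huv =>
      mem_cluster_of_adj hu huv hv.1 hv.2).mono Set.inter_subset_right
  · intro v hv hvn
    by_contra hlt
    obtain ⟨a', ha', hav⟩ := mem_explored_left hv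
    refine legs_meet (x₀ := -n) (x₁ := n) (y₀ := -n) (y₁ := n) hav hcP ?_ ?_ ?_ ha'.le hvn hc hd
      (by omega)
    · rintro w (hw | rfl)
      · exact hLP w hw
      · exact hsP w hv
    · rintro w (hw | rfl)
      · exact (hLR hw).1.1.2
      · exact hv.1.1.2
    · exact fun w hw => (hPR hw).1.1
  · rintro ⟨d', w, hd', hd1, hw, hdw⟩
    rcases hw with hw | ⟨v, hv, hvw⟩
    · refine right_leg_meets (x₀ := -n) (x₁ := n) (y₀ := -n) (y₁ := n) hcP hdw.symm ?_ ?_ ?_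
        hc.ge hd hw.ge hd' (by omega)
      · intro v hv hv'
        have h1 := (hPR hv).2
        have h2 := hv'.2
        simp_all [Col]
      · exact fun v hv => (hPR hv).1.1.2.2
      · exact fun v hv => ⟨hv.1.1.1, hv.1.1.2.1, hv.1.1.2.2.1⟩
    · obtain ⟨a', ha', hav⟩ := mem_explored_left hv
      set W := (rect (-n) n (-n) n \ (s ∪ {v | dst z v ≤ 6 * m})) ∩ Col false ω with hW
      have h1 : Conn (L ∪ {v} ∪ W) a' d' :=
        ((hav.mono Set.subset_union_left).tail (.inr hdw.right) hvw).trans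
          (hdw.symm.mono Set.subset_union_right)
      refine legs_meet (x₀ := -n) (x₁ := n) (y₀ := -n) (y₁ := n) h1 hcP ?_ ?_ ?_ ha'.le hd' hc hd
        (by omega)
      · rintro w ((hw | rfl) | hw) hwP
        · exact hLP w hw hwP
        · exact hsP w hv hwP
        · have h1 := (hPR hwP).2
          have h2 := hw.2
          simp_all [Col]
      · rintro w ((hw | rfl) | hw)
        · exact (hLR hw).1.1.2
        · exact hv.1.1.2
        · exact hw.1.1.2
      · exact fun w hw => (hPR hw).1.1

/-- The closed cluster of the top side touches the bottom side, but only near `z`. -/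
def TouchNear (n m : ℤ) (z : Site) : Set Config :=
  {ω | (∃ v ∈ topCluster n (-n) n ω, v.2 = -n) ∧
    ∀ v ∈ topCluster n (-n) n ω, v.2 = -n → |v.1 - z.1| ≤ 36 * m}

theorem touchNear_of_leftLeg {n m : ℤ} (hm : 1 ≤ m) {z : Site}
    (hz1 : -n + 36 * m < z.1) (hz2 : z.1 + 36 * m < n) {ω : Config}
    (h : LeftLeg n m z (cluster (holed n m z) {v | v.1 = -n} true ω))
    (hfree : RightFree n m z (explored (holed n m z) {v | v.1 = -n}
        (cluster (holed n m z) {v | v.1 = -n} true ω)) (Col false ω))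
    (h1 : ¬ Arm z m (6 * m) (Col true ω \ explored (holed n m z) {v | v.1 = -n}
        (cluster (holed n m z) {v | v.1 = -n} true ω)))
    (h2 : ¬ Arm z (6 * m) (36 * m) (Col false ω \ explored (holed n m z) {v | v.1 = -n}
        (cluster (holed n m z) {v | v.1 = -n} true ω))) : ω ∈ TouchNear n m z := by
  set L := cluster (holed n m z) {v | v.1 = -n} true ω with hL
  set s := explored (holed n m z) {v | v.1 = -n} L with hs
  have hLR : L ⊆ holed n m z ∩ Col true ω := cluster_subset _ _ _ _
  obtain ⟨hright, ⟨a, b, ha, hb, hbz, hab⟩, hsfar⟩ := h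
  constructor
  · by_contra hcon
    push Not at hcon
    have hTB := mt (not_LR_iff (x₀ := -n) (x₁ := n) (y₀ := -n) (y₁ := n) (by omega) (by omega)
      (Col true ω)).1
    rw [not_not, col_compl] at hTB
    obtain ⟨a', b', ha', hb', h⟩ := hTB (not_TB_iff_topCluster.2 hcon)
    have haL : a' ∈ L := by
      refine ⟨a', ha', Conn.refl ⟨⟨h.left.1, fun hd => ?_⟩, h.left.2⟩⟩
      rw [Set.mem_ofPred_eq, dst_le_iff] at hd
      omega
    obtain ⟨c, hc, d, -, hcd, hdb⟩ := h.last_exit L haL fun hb => hright _ hb hb'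
    have hd : dst z d ≤ m := by
      by_contra hd
      exact hdb.left.2 (mem_cluster_of_adj hc hcd ⟨hdb.left.1.1, hd⟩ hdb.left.1.2)
    refine h1 (Conn.arm hdb (by omega) (by omega) ?_ fun v hv hvm _ => ⟨hv.1.2, fun hvs =>
      color_of_explored hvs hv.2 hv.1.2⟩)
    by_contra hcon
    have : dst z b' ≤ 6 * m - 1 := by omega
    rw [dst_le_iff] at this
    omega
  · intro d hd hdn
    obtain ⟨t, ht, hdt⟩ := topCluster_conn hd
    have hU : topCluster n (-n) n ω ⊆ rect (-n) n (-n) n ∩ Col false ω := topCluster_subset _ _ _ _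
    rw [abs_le]
    constructor
    · by_contra hlt
      refine left_leg_meets (x₀ := -n) (x₁ := n) (y₀ := -n) (y₁ := n) hab hdt.symm ?_ ?_ ?_
        ha.le hb ht.ge hdn (by omega)
      · intro v hv hv'
        have h1 := (hLR hv).2
        have h2 := (hU hv').2
        simp_all [Col]
      · exact fun v hv => (hLR hv).1.1.2.2
      · exact fun v hv => ⟨(hU hv).1.1, (hU hv).1.2.1, (hU hv).1.2.2.1⟩
    · by_contra hlt
      have hds : d ∉ s := fun hds => hlt (by have := hsfar d hds hdn; omega)
      have hd36 : 36 * m ≤ dst z d := by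
        by_contra hcon
        have : dst z d ≤ 36 * m - 1 := by omega
        rw [dst_le_iff] at this
        omega
      have hsub : (rect (-n) n (-n) n ∩ Col false ω) \ (s ∪ {v | dst z v ≤ 6 * m}) ⊆
          (rect (-n) n (-n) n \ (s ∪ {v | dst z v ≤ 6 * m})) ∩ Col false ω :=
        fun v hv => ⟨⟨hv.1.1, hv.2⟩, hv.1.2⟩
      rcases (hdt.mono hU).avoid_or_entry (s ∪ {v | dst z v ≤ 6 * m}) (by
        rintro (h | h)
        · exact hds h
        · rw [Set.mem_ofPred_eq] at h
          omega) with h | ⟨e, c, hc | hc, hde, hec, -⟩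
      · exact hfree ⟨d, t, hdn, by omega, .inl ht, h.mono hsub⟩
      · exact hfree ⟨d, e, hdn, by omega, .inr ⟨c, hc, hec.symm⟩, hde.mono hsub⟩
      · rw [Set.mem_ofPred_eq] at hc
        have := dst_adj z e c hec
        exact h2 (Conn.arm hde.symm (by omega) (by omega) hd36 fun v hv _ _ =>
          ⟨hv.1.2, fun hvs => hv.2 (.inl hvs)⟩)

theorem det_not_arm_annulus (z : Site) (r R : ℤ) (s : Set Site) (b : Bool) :
    Det ({v | r + 1 ≤ dst z v ∧ dst z v ≤ R} \ s) {ω | ¬ Arm z r R (Col b ω \ s)} := by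
  have h := (det_col ({v | r + 1 ≤ dst z v ∧ dst z v ≤ R} \ s) b fun S =>
    ∃ a b : Site, dst z a = R ∧ dst z b = r + 1 ∧ Conn S a b).compl
  convert h using 1
  · ext ω
    simp only [Arm, Set.mem_ofPred_eq, Set.mem_compl_iff, ← Set.inter_sdiff_assoc,
      Set.sdiff_inter_right_comm]

theorem real_legs_le_touchNear (hμ : IsBernoulliHalf μ) {n m : ℤ} (hm : 1 ≤ m) {z : Site}
    (hz1 : -n + 36 * m < z.1) (hz2 : z.1 + 36 * m < n) :
    c₀ * c₀ * μ.real {ω | Legs n m z ω} ≤ μ.real (TouchNear n m z) := by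
  classical
  have := hμ.1
  set ex := explored (holed n m z) {v | v.1 = -n} with hex
  set Λ := rect (-n) n (-n) n ∪ {v | dst z v ≤ 36 * m} with hΛ
  have hΛf : Λ.Finite := (finite_rect _ _ _ _).union (finite_ball _ _)
  have dR : ∀ c, Det ((Λ \ ex c) \ {v | dst z v ≤ 6 * m})
      {ω | RightFree n m z (ex c) (Col false ω)} := fun c =>
    (det_rightFree n m z (ex c) false).mono fun v hv =>
      ⟨⟨.inl hv.1, fun h => hv.2 (.inl h)⟩, fun h => hv.2 (.inr h)⟩
  have dG1 : ∀ c, Det ({v | dst z v ≤ 6 * m} \ ex c)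
      {ω | ¬ Arm z m (6 * m) (Col true ω \ ex c)} := fun c => det_not_arm _ _ _ _ _
  have dG2 : ∀ c, Det ((Λ \ ex c) \ {v | dst z v ≤ 6 * m})
      {ω | ¬ Arm z (6 * m) (36 * m) (Col false ω \ ex c)} := fun c =>
    (det_not_arm_annulus _ _ _ _ _).mono fun v hv =>
      ⟨⟨.inr hv.1.2, hv.2⟩, fun h => by
      have := hv.1.1
      rw [Set.mem_ofPred_eq] at h
      omega⟩
  have key := explore_le (T := {v | v.1 = -n}) hμ (finite_holed n m z) hΛf true (q := c₀ * c₀)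
    (E₁ := fun c => if LeftLeg n m z c then {ω | RightFree n m z (ex c) (Col false ω)} else ∅)
    (E₂ := fun c => if LeftLeg n m z c then {ω | RightFree n m z (ex c) (Col false ω)} ∩
      {ω | ¬ Arm z (6 * m) (36 * m) (Col false ω \ ex c)} ∩
      {ω | ¬ Arm z m (6 * m) (Col true ω \ ex c)} else ∅)
    (by
      intro c
      split_ifs
      · exact (dR c).mono Set.sdiff_subset
      · exact det_empty _)
    (by
      intro c
      split_ifs
      · refine (((dR c).inter (dG2 c)).mono Set.sdiff_subset).inter ((dG1 c).mono ?_)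
        refine Set.sdiff_subset_sdiff_left fun v hv => .inr ?_
        rw [Set.mem_ofPred_eq] at *
        omega
      · exact det_empty _)
    (by
      intro c
      split_ifs
      · have h1 := harris hμ hΛf.sdiff.sdiff (dR c) (dG2 c) (av_rightFree n m z (ex c) false)
          (av_not_arm _ _ _ _ _)
        have h2 := real_indep hμ hΛf.sdiff.sdiff (finite_ball z (6 * m)).sdiff
          (Set.disjoint_left.2 fun v hv hv' => hv.2 hv'.1) ((dR c).inter (dG2 c)) (dG1 c)
        rw [h2]
        have h3 := real_not_arm hμ z (r := 6 * m) (R := 36 * m) (by omega) (by omega) (ex c) false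
        have h4 := real_not_arm hμ z (r := m) (R := 6 * m) hm rfl (ex c) true
        refine le_trans ?_ (mul_le_mul (le_trans (mul_le_mul_of_nonneg_left h3 measureReal_nonneg)
          h1) h4 c₀_pos.le measureReal_nonneg)
        exact le_of_eq (by ring)
      · simp)
  refine le_trans (mul_le_mul_of_nonneg_left (measureReal_mono ?_)
    (mul_nonneg c₀_pos.le c₀_pos.le)) (key.trans (measureReal_mono ?_))
  · intro ω h
    obtain ⟨h1, h2⟩ := h.leftLeg_and_rightFree hm
    rw [Set.mem_ofPred_eq, if_pos h1]
    exact h2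
  · intro ω h
    rw [Set.mem_ofPred_eq] at h
    split_ifs at h with h1
    · exact touchNear_of_leftLeg hm hz1 hz2 h1 h.1.1 h.2 h.1.2
    · exact h.elim

/-- The closed cluster of the top side touches the bottom side in a short stretch. -/
def NarrowTouch (n m : ℤ) : Set Config :=
  {ω | ∃ v ∈ topCluster n (-n) n ω, v.2 = -n ∧
    ∀ v' ∈ topCluster n (-n) n ω, v'.2 = -n → |v'.1 - v.1| ≤ 72 * m}

theorem det_touchNear (n m : ℤ) (z : Site) : Det (rect (-n) n (-n) n) (TouchNear n m z) :=
  det_col (rect (-n) n (-n) n) false fun S =>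
    (∃ v ∈ {v | ∃ t ∈ rectTop (-n) n (-n) n, Conn S t v}, v.2 = -n) ∧
      ∀ v ∈ {v | ∃ t ∈ rectTop (-n) n (-n) n, Conn S t v}, v.2 = -n → |v.1 - z.1| ≤ 36 * m

theorem det_narrowTouch (n m : ℤ) : Det (rect (-n) n (-n) n) (NarrowTouch n m) :=
  det_col (rect (-n) n (-n) n) false fun S =>
    ∃ v ∈ {v | ∃ t ∈ rectTop (-n) n (-n) n, Conn S t v}, v.2 = -n ∧
      ∀ v' ∈ {v | ∃ t ∈ rectTop (-n) n (-n) n, Conn S t v}, v'.2 = -n → |v'.1 - v.1| ≤ 72 * m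

theorem not_TB_of_narrow {n m : ℤ} (hn : 0 ≤ n) (hm : 1 ≤ m) {ω : Config} {z : Site} (hz : z.2 = -n)
    (hU : ∀ v ∈ topCluster n (-n) n ω, v.2 = -n → |v.1 - z.1| ≤ 72 * m)
    (harm : ¬ Arm z (73 * m) (438 * m) (Col false ω \
      explored (rect (-n) n (-n) n) (rectTop (-n) n (-n) n) (topCluster n (-n) n ω))) :
    ¬ TB (-n) n (-n - (438 * m + 1)) n (Col false ω) := by
  rintro ⟨x, y, hx, hy, hxy⟩
  have hxU : x ∈ topCluster n (-n) n ω := by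
    have h := hxy.left
    have hxR : x ∈ rect (-n) n (-n) n := ⟨h.1.1, h.1.2.1, by omega, h.1.2.2.2⟩
    exact ⟨x, ⟨hxR, hx⟩, Conn.refl ⟨hxR, h.2⟩⟩
  obtain ⟨c, hc, d, -, hcd, hdy⟩ := hxy.last_exit _ hxU fun hyU => by
    have := (topCluster_subset _ _ _ _ hyU).1.2.2.1
    omega
  have hcR := (topCluster_subset _ _ _ _ hc).1
  have hd2 : d.2 < -n := by
    by_contra hd
    have h := hdy.left.1
    exact hdy.left.2 (mem_cluster_of_adj hc hcd ⟨h.1.1, h.1.2.1, by omega, h.1.2.2.2⟩ h.2)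
  have hadj := adj_iff.1 hcd
  obtain ⟨h1, h2, h3, h4⟩ := hcR
  have hcz := abs_le.1 (hU c hc (by omega))
  refine harm (Conn.arm hdy (by omega) ?_ ?_ fun v hv _ _ => ⟨hv.1.2, fun hvs =>
    color_of_explored hvs hv.2 hv.1.2⟩)
  · rw [dst_le_iff]
    omega
  · by_contra hcon
    have : dst z y ≤ 438 * m - 1 := by omega
    rw [dst_le_iff] at this
    omega

theorem real_narrowTouch_le (hμ : IsBernoulliHalf μ) {n m : ℤ} (hn : 1 ≤ n) (hm : 1 ≤ m) :
    c₀ * μ.real (NarrowTouch n m) ≤ 2 ^ 23 * ((438 * m + 1 : ℤ) / (n : ℝ)) := by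
  classical
  have := hμ.1
  have hf : ∀ c : Set Site, ∃ z : Site,
      (∃ v ∈ c, v.2 = -n ∧ ∀ v' ∈ c, v'.2 = -n → |v'.1 - v.1| ≤ 72 * m) →
      z ∈ c ∧ z.2 = -n ∧ ∀ v' ∈ c, v'.2 = -n → |v'.1 - z.1| ≤ 72 * m := by
    intro c
    by_cases h : ∃ v ∈ c, v.2 = -n ∧ ∀ v' ∈ c, v'.2 = -n → |v'.1 - v.1| ≤ 72 * m
    · exact ⟨h.choose, fun _ => h.choose_spec⟩
    · exact ⟨0, fun h' => absurd h' h⟩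
  choose f hf using hf
  have key := explore_mul_le (T := rectTop (-n) n (-n) n)
    (Λ := rect (-n - 438 * m) (n + 438 * m) (-n - 438 * m) (n + 438 * m))
    hμ (finite_rect (-n) n (-n) n) (finite_rect _ _ _ _) false (q := c₀)
    (fun c => c ⊆ rect (-n) n (-n) n ∧
      ∃ v ∈ c, v.2 = -n ∧ ∀ v' ∈ c, v'.2 = -n → |v'.1 - v.1| ≤ 72 * m)
    (fun c => {ω | ¬ Arm (f c) (73 * m) (438 * m) (Col false ω \
      explored (rect (-n) n (-n) n) (rectTop (-n) n (-n) n) c)})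
    (by
      rintro c ⟨hc, hex⟩
      refine (det_not_arm _ _ _ _ false).mono (Set.sdiff_subset_sdiff_left ?_)
      intro v hv
      have h1 := dst_le_iff.1 hv
      obtain ⟨h2, h3, h4, h5⟩ := hc (hf c hex).1
      exact ⟨by omega, by omega, by omega, by omega⟩)
    (fun c _ => real_not_arm hμ _ (by omega) (by ring) _ false)
  have hFE := real_FE_le hμ (n := n) (y := -n - (438 * m + 1)) (M := 438 * m + 1) (y' := n) hn
    (by omega) (by omega)
  refine le_trans (mul_le_mul_of_nonneg_left (measureReal_mono ?_) c₀_pos.le)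
    ((key.trans (measureReal_mono ?_)).trans hFE)
  · exact fun ω h => ⟨fun v hv => (topCluster_subset _ _ _ _ hv).1, h⟩
  · rintro ω ⟨⟨-, hex⟩, h⟩
    obtain ⟨h1, h2, h3⟩ := hf _ hex
    refine ⟨not_TB_of_narrow (by omega) hm h2 h3 h, ?_⟩
    rw [Int.sub_add_cancel]
    obtain ⟨t, ht, hvt⟩ := h1
    exact ⟨t, _, ht.2, h2, hvt⟩

theorem sum_touchNear_le (hμ : IsBernoulliHalf μ) {n m : ℤ} (hm : 1 ≤ m) (s : Finset ℕ) :
    ∑ k ∈ s, μ.real (TouchNear n m (-n + k * m, -n)) ≤ 73 * μ.real (NarrowTouch n m) := by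
  classical
  have := hμ.1
  have key := sum_real_le (μ := μ) s {()} (fun k : ℕ => TouchNear n m (-n + k * m, -n))
    (fun _ => NarrowTouch n m) 73
    (fun k _ => (det_touchNear n m _).measurableSet (finite_rect _ _ _ _))
    (fun _ _ => (det_narrowTouch n m).measurableSet (finite_rect _ _ _ _)) ?_
  · simpa using key
  intro ω
  simp only [Set.indicator_apply, Pi.one_apply, Finset.sum_boole]
  by_cases h : ∃ k ∈ s, ω ∈ TouchNear n m (-n + (k : ℤ) * m, -n)
  · obtain ⟨k₀, -, ⟨v, hv, hvn⟩, h₀⟩ := h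
    have hN : ω ∈ NarrowTouch n m := by
      refine ⟨v, hv, hvn, fun v' hv' hvn' => ?_⟩
      have h1 := abs_le.1 (h₀ v hv hvn)
      have h2 := abs_le.1 (h₀ v' hv' hvn')
      rw [abs_le]
      omega
    rw [Finset.filter_true_of_mem fun _ _ => hN, Finset.card_singleton, Nat.cast_one, mul_one]
    have hcard : (s.filter fun k : ℕ => ω ∈ TouchNear n m (-n + (k : ℤ) * m, -n)).card ≤
        (Finset.Icc ((v.1 + n) / m - 36) ((v.1 + n) / m + 36)).card := by
      refine Finset.card_le_card_of_injOn (fun k : ℕ => (k : ℤ)) ?_ fun a _ b _ h => by simpa using h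
      intro k hk
      have hk' := (Finset.mem_filter.1 hk).2
      have h1 := abs_le.1 (hk'.2 v hv hvn)
      simp only at h1
      have h2 := Int.mul_ediv_self_le (x := v.1 + n) (k := m) (by omega)
      have h3 := Int.lt_mul_ediv_self_add (x := v.1 + n) (k := m) (by omega)
      simp only [Finset.coe_Icc, Set.mem_Icc]
      constructor
      · by_contra hlt
        nlinarith
      · by_contra hlt
        nlinarith
    rw [Int.card_Icc] at hcard
    have : (s.filter fun k : ℕ => ω ∈ TouchNear n m (-n + (k : ℤ) * m, -n)).card ≤ 73 := by omega
    exact_mod_cast this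
  · rw [Finset.filter_false_of_mem fun k hk hk' => h ⟨k, hk, hk'⟩]
    simp

/-- The expected number of bottom blocks, away from the corners, near which a pivotal site lies. -/
theorem sum_pivNear_le (hμ : IsBernoulliHalf μ) {n m : ℤ} (hn : 1 ≤ n) (hm : 1 ≤ m) (s : Finset ℕ)
    (hs : ∀ k ∈ s, 36 * m < k * m ∧ k * m + 36 * m < 2 * n) :
    c₀ ^ 4 * ∑ k ∈ s, μ.real (PivNear n m (-n + k * m, -n)) ≤ 2 ^ 39 * ((m : ℝ) / n) := by
  have h1 : ∀ k ∈ s, c₀ ^ 3 * μ.real (PivNear n m (-n + k * m, -n)) ≤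
      μ.real (TouchNear n m (-n + k * m, -n)) := by
    intro k hk
    obtain ⟨h1, h2⟩ := hs k hk
    have e1 := real_pivNear_le_legs hμ hm (z := (-n + k * m, -n)) rfl (n := n) (by simp only; omega)
      (by simp only; omega)
    have e2 := real_legs_le_touchNear hμ hm (z := (-n + k * m, -n)) (n := n)
      (by simp only; omega) (by simp only; omega)
    calc _ = c₀ * c₀ * (c₀ * μ.real (PivNear n m (-n + k * m, -n))) := by ring
      _ ≤ _ := (mul_le_mul_of_nonneg_left e1 (mul_nonneg c₀_pos.le c₀_pos.le)).trans e2
  have h2 := real_narrowTouch_le hμ hn hm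
  have hnR : (1 : ℝ) ≤ n := by exact_mod_cast hn
  have hmR : (1 : ℝ) ≤ m := by exact_mod_cast hm
  calc c₀ ^ 4 * ∑ k ∈ s, μ.real (PivNear n m (-n + k * m, -n))
      = c₀ * ∑ k ∈ s, c₀ ^ 3 * μ.real (PivNear n m (-n + k * m, -n)) := by
        rw [← Finset.mul_sum]; ring
    _ ≤ c₀ * (73 * μ.real (NarrowTouch n m)) := mul_le_mul_of_nonneg_left
        ((Finset.sum_le_sum h1).trans (sum_touchNear_le hμ hm s)) c₀_pos.le
    _ = 73 * (c₀ * μ.real (NarrowTouch n m)) := by ring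
    _ ≤ 73 * (2 ^ 23 * ((439 * m) / (n : ℝ))) := by
        refine mul_le_mul_of_nonneg_left (h2.trans ?_) (by norm_num)
        push_cast
        gcongr
        linarith
    _ = 73 * 2 ^ 23 * 439 * (m / (n : ℝ)) := by ring
    _ ≤ _ := by gcongr; norm_num

theorem Conn.exists_path {S : Set Site} {a b : Site} (h : Conn S a b) :
    ∃ p, PathIn S p ∧ p.head? = some a ∧ p.getLast? = some b := by
  induction h using Conn.induction with
  | base h => exact ⟨[a], ⟨⟨by simp, by simp, List.isChain_singleton a⟩, by simpa using h⟩, rfl, rfl⟩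
  | step u v hu hv huv ih =>
    obtain ⟨p, ⟨⟨hp, hnd, hch⟩, hS⟩, ha, hb⟩ := ih
    by_cases hvp : v ∈ p
    · obtain ⟨s, t, rfl⟩ := List.append_of_mem hvp
      have hpre : s ++ [v] <+: s ++ v :: t := ⟨t, by simp⟩
      refine ⟨s ++ [v], ⟨⟨by simp, hnd.sublist hpre.sublist, (List.isChain_split.1 hch).1⟩,
        fun w hw => hS w (hpre.subset hw)⟩, ?_, by simp⟩
      cases s <;> simpa using ha
    · refine ⟨p ++ [v], ⟨⟨by simp, ?_, ?_⟩, ?_⟩, ?_, by simp⟩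
      · rw [List.nodup_append_comm]
        simp [hvp, hnd]
      · refine List.isChain_append.2 ⟨hch, List.isChain_singleton v, fun x hx y hy => ?_⟩
        rw [hb] at hx
        simp at hx hy
        subst hx hy
        exact huv
      · intro w hw
        rcases List.mem_append.1 hw with h | h
        · exact hS w h
        · rw [List.mem_singleton.1 h]
          exact hv
      · cases p with
        | nil => exact absurd rfl hp
        | cons x l => simpa using ha

theorem conn_of_isChain {p : List Site} {a b : Site} (hp : p.IsChain Adj) (ha : p.head? = some a)
    (hb : p.getLast? = some b) : Conn {v | v ∈ p} a b := by
  induction p generalizing a with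
  | nil => simp at ha
  | cons x l ih =>
    obtain rfl : x = a := by simpa using ha
    cases l with
    | nil =>
      obtain rfl : x = b := by simpa using hb
      exact Conn.refl (by simp)
    | cons y l =>
      rw [List.isChain_cons_cons] at hp
      refine Conn.head (by simp) hp.1 ((ih hp.2 rfl (by simpa using hb)).mono fun v hv => ?_)
      exact List.mem_cons_of_mem x hv

theorem Conn.restrict_component {S : Set Site} {a t : Site} (h : Conn S a t) :
    Conn (S ∩ {w | Conn S t w}) a t :=
  h.restrict {w | Conn S t w} h.symm fun _ _ h1 _ h3 h4 => h1.tail h3 h4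

theorem Pivotal.pivConn {n : ℤ} {ω : Config} {v : Site} (h : Pivotal n ω v) : PivConn n ω v := by
  obtain ⟨⟨p, ⟨⟨hp, hpR⟩, hpo, ⟨a, ha, hpa⟩, ⟨b, hb, hpb⟩⟩, hvp⟩, q₁, q₂, ⟨hq1, hq1R⟩, hq1c,
    ⟨c, hc, hqc⟩, ⟨t, ht, hqt⟩, ⟨hq2, hq2R⟩, hq2c, ⟨d, hd, hqd⟩, ⟨e, he, hqe⟩, -⟩ := h
  refine ⟨hpR v hvp, fun hTB => ?_, ⟨c, t, hc, ht.2, ?_⟩, d, e, hd, he.2, ?_⟩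
  · have hLR : LR (-n) n (-n) n (Col true ω) :=
      ⟨a, b, ha.2, hb.2, (conn_of_isChain hp.2.2 hpa hpb).mono fun w hw => ⟨hpR w hw, hpo w hw⟩⟩
    exact hLR.not_TB hTB fun w h1 h2 => by simp_all [Col]
  · exact (conn_of_isChain hq1.2.2 hqc hqt).mono fun w hw => ⟨hq1R w hw, hq1c w hw⟩
  · exact (conn_of_isChain hq2.2.2 hqd hqe).mono fun w hw => ⟨hq2R w hw, hq2c w hw⟩

theorem PivConn.pivotal {n : ℤ} {ω : Config} {v : Site} (h : PivConn n ω v) : Pivotal n ω v := by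
  obtain ⟨hv, hTB, ⟨c, t, hvc, ht, hct⟩, d, e, hvd, he, hde⟩ := h
  have hn : -n ≤ n := hv.1.trans hv.2.1
  constructor
  · have hLR := mt (not_LR_iff hn hn (Col true ω)).1
    rw [not_not, col_compl] at hLR
    obtain ⟨a, b, ha, hb, hab⟩ := hLR hTB
    obtain ⟨p, ⟨hp, hpS⟩, hpa, hpb⟩ := hab.exists_path
    refine ⟨p, ⟨⟨hp, fun w hw => (hpS w hw).1⟩, fun w hw => (hpS w hw).2,
      ⟨a, ⟨hab.left.1, ha⟩, hpa⟩, b, ⟨hab.right.1, hb⟩, hpb⟩, ?_⟩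
    by_contra hvp
    have h1 : LR (-n) n (-n) n {w | w ∈ p ∧ ω w = true} :=
      ⟨a, b, ha, hb, (conn_of_isChain hp.2.2 hpa hpb).mono fun w hw =>
        ⟨(hpS w hw).1, hw, (hpS w hw).2⟩⟩
    have hsub : rect (-n) n (-n) n ∩ Col false ω ⊆
        rect (-n) n (-n) n ∩ (Col false ω ∪ {v}) := fun w hw => ⟨hw.1, .inl hw.2⟩
    have h2 : TB (-n) n (-n) n (Col false ω ∪ {v}) :=
      ⟨t, e, ht, he, ((hct.symm.mono hsub).tail ⟨hv, .inr rfl⟩ hvc.symm).trans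
        (Conn.head ⟨hv, .inr rfl⟩ hvd (hde.mono hsub))⟩
    refine h1.not_TB h2 ?_
    rintro w ⟨hw, hw1⟩ (hw2 | rfl)
    · simp_all [Col]
    · exact hvp hw
  · obtain ⟨q₁, ⟨hq1, hq1S⟩, hqc, hqt⟩ := hct.restrict_component.exists_path
    obtain ⟨q₂, ⟨hq2, hq2S⟩, hqd, hqe⟩ := hde.restrict_component.exists_path
    refine ⟨q₁, q₂, ⟨hq1, fun w hw => (hq1S w hw).1.1⟩, fun w hw => (hq1S w hw).1.2,
      ⟨c, hvc, hqc⟩, ⟨t, ⟨hct.right.1, ht⟩, hqt⟩, ⟨hq2, fun w hw => (hq2S w hw).1.1⟩,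
      fun w hw => (hq2S w hw).1.2, ⟨d, hvd, hqd⟩, ⟨e, ⟨hde.right.1, he⟩, hqe⟩, fun w h1 h2 => ?_⟩
    exact hTB ⟨t, e, ht, he, (hq1S w h1).2.trans (hq2S w h2).2.symm⟩

/-- The event that the block `H_k` contains a pivotal site. -/
def Hit (n m : ℤ) (k : ℕ) : Set Config := {ω | (Qset n ω ∩ Hblock n m k).Nonempty}

theorem mem_hit_iff {n m : ℤ} {k : ℕ} {ω : Config} :
    ω ∈ Hit n m k ↔ ∃ v, PivConn n ω v ∧ v ∈ Hblock n m k :=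
  ⟨fun ⟨v, h1, h2⟩ => ⟨v, Pivotal.pivConn h1, h2⟩, fun ⟨v, h1, h2⟩ => ⟨v, h1.pivotal, h2⟩⟩

theorem measurableSet_hit (n m : ℤ) (k : ℕ) : MeasurableSet (Hit n m k) := by
  have h : Hit n m k = {ω | ∃ v, PivConn n ω v ∧ v ∈ Hblock n m k} := by
    ext ω
    exact mem_hit_iff
  rw [h]
  refine Det.measurableSet (A := rect (-n) n (-n) n) ?_ (finite_rect _ _ _ _)
  exact det_col (rect (-n) n (-n) n) false fun S => ∃ v, (v ∈ rect (-n) n (-n) n ∧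
    (¬ ∃ c d : Site, c.2 = n ∧ d.2 = -n ∧ Conn S c d) ∧
    (∃ a t : Site, Adj v a ∧ t.2 = n ∧ Conn S a t) ∧
    ∃ b d : Site, Adj v b ∧ d.2 = -n ∧ Conn S b d) ∧ v ∈ Hblock n m k

theorem hit_subset_pivNear (n m : ℤ) (k : ℕ) : Hit n m k ⊆ PivNear n m (-n + k * m, -n) := by
  intro ω h
  obtain ⟨v, hv, h1, h2, h3, h4⟩ := mem_hit_iff.1 h
  refine ⟨v, hv, ?_⟩
  rw [dst_le_iff]
  simp only
  rw [sub_mul] at h1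
  omega

theorem le_sum_real_hit (hμ : IsBernoulliHalf μ) {n m : ℤ} (hm : 1 ≤ m) (hmn : m ≤ n) {K : ℕ}
    (hK : m * K = 2 * n) :
    2⁻¹ ^ 150 * ((m : ℝ) / n) ≤ ∑ k ∈ Finset.Icc 1 K, μ.real (Hit n m k) := by
  have := hμ.1
  refine (le_real_lowPiv hμ hm hmn).trans ((measureReal_mono ?_ (measure_ne_top _ _)).trans
    (measureReal_biUnion_finset_le (Finset.Icc 1 K) fun k => Hit n m k))
  rintro ω ⟨c, hc, hc2, hc1⟩
  have hcR := hc.1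
  obtain ⟨-, h2, h3, -⟩ := hcR
  set q := (c.1 + n + m - 1) / m with hq
  have e1 := Int.mul_ediv_self_le (x := c.1 + n + m - 1) (k := m) (by omega)
  have e2 := Int.lt_mul_ediv_self_add (x := c.1 + n + m - 1) (k := m) (by omega)
  rw [← hq] at e1 e2
  have hq1 : 1 ≤ q := by
    by_contra hlt
    nlinarith
  have hqK : q ≤ K := by
    by_contra hlt
    nlinarith
  simp only [Set.mem_iUnion, Finset.mem_Icc, exists_prop]
  refine ⟨q.toNat, by omega, mem_hit_iff.2 ⟨c, hc, ?_, ?_, h3, hc2⟩⟩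
  · rw [Int.toNat_of_nonneg (by omega)]
    nlinarith
  · rw [Int.toNat_of_nonneg (by omega)]
    nlinarith

theorem real_pivNear_le (hμ : IsBernoulliHalf μ) {n m : ℤ} (hm : 1 ≤ m) (hmn : m ≤ n) {z : Site}
    (hz : z.2 = -n) : μ.real (PivNear n m z) ≤ 2 ^ 24 * ((m : ℝ) / n) := by
  have := hμ.1
  have hnR : (1 : ℝ) ≤ n := by exact_mod_cast hm.trans hmn
  have hmR : (1 : ℝ) ≤ m := by exact_mod_cast hm
  rcases hmn.lt_or_eq with h | rfl
  · refine (measureReal_mono (pivNear_subset_FE hm h hz)).trans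
      ((real_FE_le hμ (by omega) (by omega) (by omega)).trans ?_)
    calc (2 : ℝ) ^ 23 * ((m + 1 : ℤ) / (n : ℝ)) ≤ 2 ^ 23 * ((2 * m) / n) := by
          push_cast; gcongr; linarith
      _ = _ := by ring
  · rw [div_self (by positivity)]
    exact measureReal_le_one.trans (by norm_num)

theorem sum_real_hit_le (hμ : IsBernoulliHalf μ) {n m : ℤ} (hm : 1 ≤ m) (hmn : m ≤ n) {K : ℕ}
    (hK : m * K = 2 * n) :
    ∑ k ∈ Finset.Icc 1 K, μ.real (Hit n m k) ≤ 2 ^ 392 * ((m : ℝ) / n) := by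
  classical
  have := hμ.1
  have hnR : (1 : ℝ) ≤ n := by exact_mod_cast hm.trans hmn
  have hmR : (1 : ℝ) ≤ m := by exact_mod_cast hm
  have hmid := sum_pivNear_le hμ (hm.trans hmn) hm
    ((Finset.Icc 1 K).filter fun k => 36 < k ∧ k + 36 < K) (by
      intro k hk
      obtain ⟨-, h1, h2⟩ := Finset.mem_filter.1 hk
      constructor <;> nlinarith)
  have hend : ∑ k ∈ (Finset.Icc 1 K).filter (fun k => ¬ (36 < k ∧ k + 36 < K)),
      μ.real (PivNear n m (-n + k * m, -n)) ≤ 73 * (2 ^ 24 * ((m : ℝ) / n)) := by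
    refine (Finset.sum_le_card_nsmul _ _ (2 ^ 24 * ((m : ℝ) / n)) fun k _ =>
      real_pivNear_le hμ hm hmn rfl).trans ?_
    rw [nsmul_eq_mul]
    refine mul_le_mul_of_nonneg_right ?_ (by positivity)
    have hcard : ((Finset.Icc 1 K).filter (fun k => ¬ (36 < k ∧ k + 36 < K))).card ≤
        (Finset.Icc 1 36 ∪ Finset.Icc (K - 36) K).card := by
      refine Finset.card_le_card fun k hk => ?_
      simp only [Finset.mem_filter, Finset.mem_union, Finset.mem_Icc] at *
      omega
    have h2 := hcard.trans (Finset.card_union_le _ _)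
    simp only [Nat.card_Icc] at h2
    have : ((Finset.Icc 1 K).filter (fun k => ¬ (36 < k ∧ k + 36 < K))).card ≤ 73 := by omega
    exact_mod_cast this
  have hc : c₀ ^ 4 = 2⁻¹ ^ 352 := by rw [c₀, ← pow_mul]
  rw [hc] at hmid
  have hmid' : ∑ k ∈ (Finset.Icc 1 K).filter (fun k => 36 < k ∧ k + 36 < K),
      μ.real (PivNear n m (-n + k * m, -n)) ≤ 2 ^ 391 * ((m : ℝ) / n) := by
    calc _ = 2 ^ 352 * (2⁻¹ ^ 352 * ∑ k ∈ (Finset.Icc 1 K).filter (fun k => 36 < k ∧ k + 36 < K),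
          μ.real (PivNear n m (-n + k * m, -n))) := by
          rw [← mul_assoc, ← mul_pow, mul_inv_cancel₀ (by norm_num), one_pow, one_mul]
      _ ≤ 2 ^ 352 * (2 ^ 39 * ((m : ℝ) / n)) := mul_le_mul_of_nonneg_left hmid (by positivity)
      _ = _ := by rw [← mul_assoc, ← pow_add]
  calc _ ≤ ∑ k ∈ Finset.Icc 1 K, μ.real (PivNear n m (-n + k * m, -n)) :=
        Finset.sum_le_sum fun k _ => measureReal_mono (hit_subset_pivNear n m k)
    _ ≤ 2 ^ 391 * ((m : ℝ) / n) + 73 * (2 ^ 24 * ((m : ℝ) / n)) := by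
        rw [← Finset.sum_filter_add_sum_filter_not _ fun k => 36 < k ∧ k + 36 < K]
        exact add_le_add hmid' hend
    _ = (2 ^ 391 + 73 * 2 ^ 24) * ((m : ℝ) / n) := by rw [← mul_assoc 73, ← add_mul]
    _ ≤ (2 ^ 391 + 2 ^ 391) * ((m : ℝ) / n) := by
        gcongr
        exact le_trans (by norm_num : (73 : ℝ) * 2 ^ 24 ≤ 2 ^ 31)
          (pow_le_pow_right₀ one_le_two (by norm_num : 31 ≤ 391))
    _ = _ := by rw [← mul_two, ← pow_succ]

theorem lintegral_Xnm (hμ : IsBernoulliHalf μ) (j₀ i₀ : ℕ) :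
    ∫⁻ ω, (Xnm j₀ i₀ ω : ℝ≥0∞) ∂μ = ENNReal.ofReal
      (∑ k ∈ Finset.Icc 1 (2 ^ (i₀ + 1)), μ.real (Hit (2 ^ j₀) (2 ^ (j₀ - i₀)) k)) := by
  classical
  have := hμ.1
  have hX : ∀ ω, (Xnm j₀ i₀ ω : ℝ≥0∞) = ∑ k ∈ Finset.Icc 1 (2 ^ (i₀ + 1)),
      (Hit (2 ^ j₀) (2 ^ (j₀ - i₀)) k).indicator 1 ω := by
    intro ω
    simp only [Set.indicator_apply, Pi.one_apply, Finset.sum_boole]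
    rw [Xnm, ← Set.ncard_coe_finset]
    congr 2
    ext k
    rw [Finset.mem_coe, Finset.mem_filter, Finset.mem_Icc]
    exact and_assoc.symm
  simp_rw [hX]
  rw [lintegral_finsetSum _ fun k _ => measurable_one.indicator (measurableSet_hit _ _ k),
    ENNReal.ofReal_sum_of_nonneg fun _ _ => measureReal_nonneg]
  refine Finset.sum_congr rfl fun k _ => ?_
  rw [lintegral_indicator_one (measurableSet_hit _ _ k), ofReal_measureReal]

end Percolation

open Percolation in
/-- There exist constants `0 < c ≤ C < ∞` such that for all `n = 2^{j₀}` and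
`m = 2^{-i₀}n`, `c·m/n ≤ E(X_{n,m}) ≤ C·m/n`. -/
theorem statement8 :
    ∃ c C : ℝ≥0∞, 0 < c ∧ c ≤ C ∧ C < ⊤ ∧
      ∀ μ : Measure Config, IsBernoulliHalf μ →
        ∀ j₀ i₀ : ℕ, i₀ ≤ j₀ →
          ∀ n m : ℕ, n = 2 ^ j₀ → m = 2 ^ (j₀ - i₀) →
            c * m / n ≤ ∫⁻ ω, (Xnm j₀ i₀ ω : ℝ≥0∞) ∂μ ∧
              ∫⁻ ω, (Xnm j₀ i₀ ω : ℝ≥0∞) ∂μ ≤ C * m / n := by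
  refine ⟨ENNReal.ofReal (2⁻¹ ^ 150), ENNReal.ofReal (2 ^ 392), ENNReal.ofReal_pos.2 (by positivity),
    ENNReal.ofReal_le_ofReal
    ((pow_le_one₀ (by norm_num) (by norm_num)).trans (one_le_pow₀ one_le_two)), ENNReal.ofReal_lt_top, ?_⟩
  intro μ hμ j₀ i₀ hij n m hn hm
  have hm1 : (1 : ℤ) ≤ 2 ^ (j₀ - i₀) := one_le_pow₀ (by norm_num)
  have hmn : (2 : ℤ) ^ (j₀ - i₀) ≤ 2 ^ j₀ := pow_le_pow_right₀ (by norm_num) (Nat.sub_le _ _)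
  have hK : (2 : ℤ) ^ (j₀ - i₀) * (2 ^ (i₀ + 1) : ℕ) = 2 * 2 ^ j₀ := by
    push_cast
    rw [← pow_add, ← pow_succ']
    congr 1
    omega
  have hconv : ∀ a : ℝ, 0 ≤ a → ENNReal.ofReal a * m / n =
      ENNReal.ofReal (a * (((2 ^ (j₀ - i₀) : ℤ) : ℝ) / ((2 ^ j₀ : ℤ) : ℝ))) := by
    intro a ha
    have h1 : ((2 ^ (j₀ - i₀) : ℤ) : ℝ) = m := by rw [hm]; push_cast; rfl
    have h2 : ((2 ^ j₀ : ℤ) : ℝ) = n := by rw [hn]; push_cast; rfl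
    have h3 : (0 : ℝ) < n := by rw [hn]; positivity
    rw [h1, h2, ← mul_div_assoc, ENNReal.ofReal_div_of_pos h3, ENNReal.ofReal_mul ha,
      ENNReal.ofReal_natCast, ENNReal.ofReal_natCast]
  rw [lintegral_Xnm hμ, hconv _ (by positivity), hconv _ (by positivity)]
  exact ⟨ENNReal.ofReal_le_ofReal (le_sum_real_hit hμ hm1 hmn hK),
    ENNReal.ofReal_le_ofReal (sum_real_hit_le hμ hm1 hmn hK)⟩
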